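/- Let r > 0, θ ∈ ℝ, σ > 0, and let h : ℝ → ℝ be Lipschitz with constant L ≥ 0. Let f_h be the solution of the VG(r,θ,σ,0) Stein equation with test function h. Then for every x ≠ 0, every function g₁ : ℝ → ℝ such that f_h has derivative g₁(y) at every y ≠ 0 in some neighborhood of x, every function g₂ : ℝ → ℝ such that g₁ has derivative g₂(y) at every y ≠ 0 in some neighborhood of x, and every d ∈ ℝ such that g₂ has derivative d at x, one has |x·d| ≤ (1/σ²)·{5 + 2(r+1)·A(r+1,θ,σ) + (5 + 4θ²/σ²)·(1 + 6/(r+1) + B(r+1,θ,σ))}·{1 + (2 + θ²/σ²)·C(r,θ,σ)}·L. -/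

import Mathlib

open MeasureTheory Real Filter

/-- Modified Bessel function of the second kind. -/
noncomputable def besselK (ν x : ℝ) : ℝ :=
  ∫ t in Set.Ioi (0:ℝ), Real.exp (-x * Real.cosh t) * Real.cosh (ν * t)

/-- Modified Bessel function of the first kind. -/
noncomputable def besselI (ν x : ℝ) : ℝ :=
  ∑' k : ℕ, (x / 2) ^ (ν + 2 * (k : ℝ)) / (Real.Gamma (ν + (k : ℝ) + 1) * (Nat.factorial k))

/-- The VG(r,θ,σ,0) density. -/
noncomputable def vgDensity (r θ σ x : ℝ) : ℝ :=
  (σ * Real.sqrt Real.pi * Real.Gamma (r / 2))⁻¹ * Real.exp (θ * x / σ ^ 2) *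
    (|x| / (2 * Real.sqrt (θ ^ 2 + σ ^ 2))) ^ ((r - 1) / 2) *
    besselK ((r - 1) / 2) (Real.sqrt (θ ^ 2 + σ ^ 2) * |x| / σ ^ 2)

/-- The centred test function h̃(x) = h(x) − E h(Z). -/
noncomputable def htilde (r θ σ : ℝ) (h : ℝ → ℝ) (x : ℝ) : ℝ :=
  h x - ∫ t, h t * vgDensity r θ σ t

/-- The solution of the VG(r,θ,σ,0) Stein equation with test function h. -/
noncomputable def steinSolution (r θ σ : ℝ) (h : ℝ → ℝ) (x : ℝ) : ℝ :=
  -(Real.exp (-(θ / σ ^ 2) * x) *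
      besselK ((r - 1) / 2) (Real.sqrt (θ ^ 2 + σ ^ 2) / σ ^ 2 * |x|) /
      (σ ^ 2 * |x| ^ ((r - 1) / 2))) *
    (∫ t in (0:ℝ)..x, Real.exp ((θ / σ ^ 2) * t) * |t| ^ ((r - 1) / 2) *
      besselI ((r - 1) / 2) (Real.sqrt (θ ^ 2 + σ ^ 2) / σ ^ 2 * |t|) * htilde r θ σ h t) -
  (Real.exp (-(θ / σ ^ 2) * x) *
      besselI ((r - 1) / 2) (Real.sqrt (θ ^ 2 + σ ^ 2) / σ ^ 2 * |x|) /
      (σ ^ 2 * |x| ^ ((r - 1) / 2))) *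
    (∫ t in Set.Ioi x, Real.exp ((θ / σ ^ 2) * t) * |t| ^ ((r - 1) / 2) *
      besselK ((r - 1) / 2) (Real.sqrt (θ ^ 2 + σ ^ 2) / σ ^ 2 * |t|) * htilde r θ σ h t)

/-- The constant A(r,θ,σ). -/
noncomputable def Aconst (r θ σ : ℝ) : ℝ :=
  if 2 ≤ r then 2 * Real.sqrt Real.pi / Real.sqrt (2 * r - 1) * (1 + θ ^ 2 / σ ^ 2) ^ (r / 2)
  else 12 * Real.Gamma (r / 2) * (1 + θ ^ 2 / σ ^ 2)

/-- The constant B(r,θ,σ). -/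
noncomputable def Bconst (r θ σ : ℝ) : ℝ :=
  if 2 ≤ r then Real.sqrt (Real.pi * (r - 1) / 2) * (1 + θ ^ 2 / σ ^ 2) ^ (r / 2 - 1)
  else 2

/-- The constant C(r,θ,σ). -/
noncomputable def Cconst (r θ σ : ℝ) : ℝ :=
  6 + 2 * Real.sqrt 2 / Real.sqrt r +
    2 * Real.sqrt (2 * Real.pi * (r + 1)) * (|θ| / σ) * (1 + θ ^ 2 / σ ^ 2) ^ ((r - 1) / 2) +
    2 * (Real.sqrt (2 * r) + r) * Aconst r θ σ


lemma sq_half_le_cosh (t : ℝ) (ht : 0 ≤ t) : t ^ 2 / 2 ≤ Real.cosh t := by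
  have h1 : Real.cosh t = 1 + 2 * Real.sinh (t / 2) ^ 2 := by
    have : t = 2 * (t / 2) := by ring
    conv_lhs => rw [this, Real.cosh_two_mul, Real.cosh_sq]
    ring
  have h2 : t / 2 ≤ Real.sinh (t / 2) := Real.self_le_sinh_iff.2 (by positivity)
  have h3 : (t / 2) ^ 2 ≤ Real.sinh (t / 2) ^ 2 := by gcongr
  nlinarith

lemma exp_cosh_bound (x C c t : ℝ) (hx : 0 < x) (ht : 0 ≤ t) (y : ℝ) (hy : |y| ≤ C * Real.exp (c * t)) :
    |Real.exp (-x * Real.cosh t) * y| ≤ C * Real.exp ((c + 1) ^ 2 / (2 * x)) * Real.exp (-1 * t) := by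
  have hC : 0 ≤ C := by
    have := (abs_nonneg y).trans hy
    by_contra hneg
    push Not at hneg
    nlinarith [Real.exp_pos (c * t)]
  rw [abs_mul, abs_of_pos (Real.exp_pos _)]
  calc _ ≤ Real.exp (-x * Real.cosh t) * (C * Real.exp (c * t)) := by gcongr
    _ = C * Real.exp (-x * Real.cosh t + c * t) := by rw [Real.exp_add]; ring
    _ ≤ C * Real.exp ((c + 1) ^ 2 / (2 * x) + -1 * t) := by
      apply mul_le_mul_of_nonneg_left _ hC
      apply Real.exp_le_exp.2
      have h1 := sq_half_le_cosh t ht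
      have h2 : x * (t ^ 2 / 2) ≤ x * Real.cosh t := by gcongr
      have h3 : 0 ≤ (x * t - (c + 1)) ^ 2 / (2 * x) := by positivity
      have h4 : (x * t - (c + 1)) ^ 2 / (2 * x) = x * (t ^ 2 / 2) - (c + 1) * t + (c + 1) ^ 2 / (2 * x) := by
        field_simp
        ring
      nlinarith
    _ = _ := by rw [Real.exp_add]; ring

lemma tendsto_exp_cosh (x : ℝ) (hx : 0 < x) (g : ℝ → ℝ) (C c : ℝ)
    (hb : ∀ t, 0 ≤ t → |g t| ≤ C * Real.exp (c * t)) :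
    Tendsto (fun t => Real.exp (-x * Real.cosh t) * g t) atTop (nhds 0) := by
  have h1 : Tendsto (fun t : ℝ => C * Real.exp ((c + 1) ^ 2 / (2 * x)) * Real.exp (-1 * t)) atTop
      (nhds (C * Real.exp ((c + 1) ^ 2 / (2 * x)) * 0)) := by
    apply Tendsto.const_mul
    simpa using Real.tendsto_exp_neg_atTop_nhds_zero
  rw [mul_zero] at h1
  refine squeeze_zero_norm' ?_ h1
  filter_upwards [eventually_ge_atTop 0] with t ht
  exact exp_cosh_bound x C c t hx ht _ (hb t ht)

lemma integ_exp_cosh (x : ℝ) (hx : 0 < x) (g : ℝ → ℝ) (hg : Continuous g) (C c : ℝ)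
    (hb : ∀ t, 0 ≤ t → |g t| ≤ C * Real.exp (c * t)) :
    IntegrableOn (fun t => Real.exp (-x * Real.cosh t) * g t) (Set.Ioi 0) := by
  refine integrable_of_isBigO_exp_neg (b := 1) one_pos ?_ ?_
  · exact ((Real.continuous_exp.comp (continuous_const.mul Real.continuous_cosh)).mul hg).continuousOn
  · refine Asymptotics.IsBigO.of_bound (C * Real.exp ((c + 1) ^ 2 / (2 * x))) ?_
    filter_upwards [eventually_ge_atTop 0] with t ht
    rw [Real.norm_eq_abs, Real.norm_eq_abs, abs_of_pos (Real.exp_pos (-1 * t))]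
    exact exp_cosh_bound x C c t hx ht _ (hb t ht)

lemma cosh_le_exp_abs (ν t : ℝ) (ht : 0 ≤ t) : |Real.cosh (ν * t)| ≤ 1 * Real.exp (|ν| * t) := by
  rw [abs_of_pos (Real.cosh_pos _), one_mul, ← Real.cosh_abs, abs_mul, abs_of_nonneg ht, Real.cosh_eq]
  have : Real.exp (-(|ν| * t)) ≤ Real.exp (|ν| * t) := by
    gcongr
    nlinarith [abs_nonneg ν, mul_nonneg (abs_nonneg ν) ht]
  linarith

lemma sinh_le_exp_abs (ν t : ℝ) (ht : 0 ≤ t) : |Real.sinh (ν * t)| ≤ 1 * Real.exp (|ν| * t) := by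
  refine le_trans ?_ (cosh_le_exp_abs ν t ht)
  rw [abs_of_pos (Real.cosh_pos _)]
  apply abs_le_of_sq_le_sq _ (Real.cosh_pos _).le
  rw [Real.cosh_sq]; linarith

lemma besselK_integrable (ν x : ℝ) (hx : 0 < x) :
    IntegrableOn (fun t => Real.exp (-x * Real.cosh t) * Real.cosh (ν * t)) (Set.Ioi 0) :=
  integ_exp_cosh x hx _ (by fun_prop) 1 |ν| (fun t ht => cosh_le_exp_abs ν t ht)

lemma besselK_pos (ν x : ℝ) (hx : 0 < x) : 0 < besselK ν x := by
  unfold besselK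
  rw [setIntegral_pos_iff_support_of_nonneg_ae]
  · have : Function.support (fun t => Real.exp (-x * Real.cosh t) * Real.cosh (ν * t)) = Set.univ := by
      ext t
      simp [(Real.cosh_pos (ν * t)).ne']
    rw [this, Set.univ_inter]
    simp
  · exact Eventually.of_forall fun t => mul_nonneg (Real.exp_pos _).le (Real.cosh_pos _).le
  · exact besselK_integrable ν x hx

lemma besselK_mono {ν μ : ℝ} (h : |ν| ≤ |μ|) (x : ℝ) (hx : 0 < x) : besselK ν x ≤ besselK μ x := by
  unfold besselK
  apply setIntegral_mono (besselK_integrable ν x hx) (besselK_integrable μ x hx)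
  intro t
  have : Real.cosh (ν * t) ≤ Real.cosh (μ * t) := by
    rw [Real.cosh_le_cosh, abs_mul, abs_mul]; gcongr
  dsimp only
  gcongr

lemma besselK_neg (ν x : ℝ) : besselK (-ν) x = besselK ν x := by
  unfold besselK
  congr 1; ext t
  rw [neg_mul ν t, Real.cosh_neg]

lemma besselK_decay (ν x : ℝ) (hx : 1 ≤ x) : besselK ν x ≤ Real.exp (-(x - 1)) * besselK ν 1 := by
  unfold besselK
  rw [← integral_const_mul]
  apply setIntegral_mono (besselK_integrable ν x (by linarith))
  · exact (besselK_integrable ν 1 one_pos).const_mul _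
  intro t
  dsimp only
  rw [← mul_assoc, ← Real.exp_add]
  have := Real.cosh_pos (ν * t)
  gcongr
  nlinarith [Real.one_le_cosh t]

lemma besselK_sum_integral (ν x : ℝ) (hx : 0 < x) :
    ∫ t in Set.Ioi (0:ℝ), -Real.cosh t * Real.exp (-x * Real.cosh t) * Real.cosh (ν * t)
      = -(besselK (ν + 1) x + besselK (ν - 1) x) / 2 := by
  unfold besselK
  rw [← integral_add (besselK_integrable _ x hx) (besselK_integrable _ x hx), neg_div, ← integral_div,
    ← integral_neg]
  congr 1; ext t
  have e1 : (ν + 1) * t = ν * t + t := by ring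
  have e2 : (ν - 1) * t = ν * t - t := by ring
  rw [e1, e2, Real.cosh_add, Real.cosh_sub]
  ring

lemma besselK_hasDerivAt (ν x : ℝ) (hx : 0 < x) :
    HasDerivAt (besselK ν) (-(besselK (ν + 1) x + besselK (ν - 1) x) / 2) x := by
  rw [← besselK_sum_integral ν x hx]
  have key := hasDerivAt_integral_of_dominated_loc_of_deriv_le (𝕜 := ℝ) (μ := volume.restrict (Set.Ioi (0:ℝ)))
    (F := fun x t => Real.exp (-x * Real.cosh t) * Real.cosh (ν * t))
    (F' := fun x t => -Real.cosh t * Real.exp (-x * Real.cosh t) * Real.cosh (ν * t))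
    (x₀ := x) (s := Set.Ioi (x / 2))
    (bound := fun t => Real.exp (-(x / 2) * Real.cosh t) * (Real.cosh t * Real.cosh (ν * t)))
    (Ioi_mem_nhds (by linarith)) ?_ (besselK_integrable ν x hx) ?_ ?_ ?_ ?_
  · exact key.2
  · refine Eventually.of_forall fun y => ?_
    exact (by fun_prop : Continuous fun t => Real.exp (-y * Real.cosh t) * Real.cosh (ν * t)).aestronglyMeasurable
  · exact (by fun_prop : Continuous fun t => -Real.cosh t * Real.exp (-x * Real.cosh t) * Real.cosh (ν * t)).aestronglyMeasurable
  · refine Eventually.of_forall fun t => ?_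
    intro y hy
    have h1 := Real.cosh_pos t
    have h2 := Real.cosh_pos (ν * t)
    rw [Real.norm_eq_abs, abs_mul, abs_mul, abs_neg, abs_of_pos h1, abs_of_pos h2, abs_of_pos (Real.exp_pos _)]
    have : Real.exp (-y * Real.cosh t) ≤ Real.exp (-(x / 2) * Real.cosh t) := by
      have : x / 2 < y := hy
      gcongr
    calc _ ≤ Real.cosh t * Real.exp (-(x / 2) * Real.cosh t) * Real.cosh (ν * t) := by gcongr
      _ = _ := by ring
  · refine integ_exp_cosh (x / 2) (by linarith) _ (by fun_prop) 1 (1 + |ν|) ?_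
    intro t ht
    have h1 := cosh_le_exp_abs 1 t ht
    have h2 := cosh_le_exp_abs ν t ht
    rw [one_mul, one_mul, abs_one, one_mul] at h1
    rw [abs_mul]
    calc _ ≤ Real.exp t * (1 * Real.exp (|ν| * t)) := by gcongr
      _ = _ := by rw [add_mul, Real.exp_add]; ring_nf
  · refine Eventually.of_forall fun t => ?_
    intro y hy
    have := (((hasDerivAt_id y).neg.mul_const (Real.cosh t)).exp).mul_const (Real.cosh (ν * t))
    refine HasDerivAt.congr_deriv this ?_
    simp only [Pi.neg_apply, id]; ring

lemma besselK_rec (ν x : ℝ) (hx : 0 < x) :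
    x * (besselK (ν + 1) x - besselK (ν - 1) x) = 2 * ν * besselK ν x := by
  have hd : ∀ t ∈ Set.Ici (0:ℝ), HasDerivAt (fun t => Real.exp (-x * Real.cosh t) * Real.sinh (ν * t))
      (ν * (Real.exp (-x * Real.cosh t) * Real.cosh (ν * t)) -
        x * ((Real.exp (-x * Real.cosh t) * Real.cosh ((ν + 1) * t)
          - Real.exp (-x * Real.cosh t) * Real.cosh ((ν - 1) * t)) / 2)) t := by
    intro t _
    have h1 := ((Real.hasDerivAt_cosh t).const_mul (-x)).exp
    have h2 : HasDerivAt (fun t => Real.sinh (ν * t)) (Real.cosh (ν * t) * (ν * 1)) t :=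
      ((hasDerivAt_id t).const_mul ν).sinh
    refine HasDerivAt.congr_deriv (h1.mul h2) ?_
    have e1 : (ν + 1) * t = ν * t + t := by ring
    have e2 : (ν - 1) * t = ν * t - t := by ring
    rw [e1, e2, Real.cosh_add, Real.cosh_sub]
    ring
  have i1 := besselK_integrable ν x hx
  have i2 := besselK_integrable (ν + 1) x hx
  have i3 := besselK_integrable (ν - 1) x hx
  have i23 : IntegrableOn (fun t => Real.exp (-x * Real.cosh t) * Real.cosh ((ν + 1) * t)
          - Real.exp (-x * Real.cosh t) * Real.cosh ((ν - 1) * t)) (Set.Ioi 0) := i2.sub i3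
  have hI := integral_Ioi_of_hasDerivAt_of_tendsto' hd
    ((i1.const_mul ν).sub ((i23.div_const 2).const_mul x))
    (tendsto_exp_cosh x hx (fun t => Real.sinh (ν * t)) 1 |ν| (fun t ht => sinh_le_exp_abs ν t ht))
  rw [integral_sub (i1.const_mul ν) ((i23.div_const 2).const_mul x), integral_const_mul,
    integral_const_mul, integral_div] at hI
  have e : ∫ (a : ℝ) in Set.Ioi 0, Real.exp (-x * Real.cosh a) * Real.cosh ((ν + 1) * a) -
      Real.exp (-x * Real.cosh a) * Real.cosh ((ν - 1) * a) = besselK (ν + 1) x - besselK (ν - 1) x := by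
    unfold besselK
    exact integral_sub i2 i3
  rw [e] at hI
  simp only [mul_zero, Real.sinh_zero, sub_zero] at hI
  change ν * besselK ν x - _ = 0 at hI
  linarith

lemma besselK_upper (ν x : ℝ) (hν : -(1/2) ≤ ν) (hx : 0 < x) :
    x * (besselK (ν + 1) x - besselK ν x) ≤ (2 * ν + 1) * besselK ν x := by
  set g : ℝ → ℝ := fun t => (ν + 1/2) * Real.cosh ((ν + 1/2) * t) / Real.cosh (1/2 * t)
      - 1/2 * Real.sinh ((ν + 1/2) * t) * Real.sinh (1/2 * t) / Real.cosh (1/2 * t) ^ 2 with hg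
  have hd : ∀ t ∈ Set.Ici (0:ℝ), HasDerivAt
      (fun t => Real.exp (-x * Real.cosh t) * (Real.sinh ((ν + 1/2) * t) / Real.cosh (1/2 * t)))
      (Real.exp (-x * Real.cosh t) * g t -
        x * (Real.exp (-x * Real.cosh t) * Real.cosh ((ν + 1) * t)
          - Real.exp (-x * Real.cosh t) * Real.cosh (ν * t))) t := by
    intro t _
    have h1 := ((Real.hasDerivAt_cosh t).const_mul (-x)).exp
    have h2 : HasDerivAt (fun t => Real.sinh ((ν + 1/2) * t)) (Real.cosh ((ν + 1/2) * t) * ((ν + 1/2) * 1)) t :=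
      ((hasDerivAt_id t).const_mul (ν + 1/2)).sinh
    have h3 : HasDerivAt (fun t => Real.cosh (1/2 * t)) (Real.sinh (1/2 * t) * (1/2 * 1)) t :=
      ((hasDerivAt_id t).const_mul (1/2 : ℝ)).cosh
    have hc := (Real.cosh_pos (1/2 * t)).ne'
    refine HasDerivAt.congr_deriv (h1.mul (h2.div h3 hc)) ?_
    have e1 : (ν + 1) * t = (ν + 1/2) * t + 1/2 * t := by ring
    have e2 : ν * t = (ν + 1/2) * t - 1/2 * t := by ring
    have e3 : Real.sinh t = 2 * Real.sinh (1/2 * t) * Real.cosh (1/2 * t) := by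
      rw [← Real.sinh_two_mul]; congr 1; ring
    rw [e1, e2, e3, Real.cosh_add, Real.cosh_sub, hg]
    field_simp
    ring
  have hgc : Continuous g := by
    rw [hg]
    have hc : ∀ t : ℝ, Real.cosh (1/2 * t) ≠ 0 := fun t => (Real.cosh_pos _).ne'
    have hc2 : ∀ t : ℝ, Real.cosh (1/2 * t) ^ 2 ≠ 0 := fun t => pow_ne_zero _ (hc t)
    refine Continuous.sub (Continuous.div (by fun_prop) (by fun_prop) hc) (Continuous.div (by fun_prop) (by fun_prop) hc2)
  have hu : 0 ≤ ν + 1/2 := by linarith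
  have hs2 : ∀ t : ℝ, 0 ≤ t → 0 ≤ Real.sinh ((ν + 1/2) * t) * Real.sinh (1/2 * t) := fun t ht =>
    mul_nonneg (Real.sinh_nonneg_iff.2 (by positivity)) (Real.sinh_nonneg_iff.2 (by positivity))
  have hgle : ∀ t : ℝ, 0 ≤ t → g t ≤ (2 * ν + 1) * Real.cosh (ν * t) := by
    intro t ht
    have hc := Real.cosh_pos (1/2 * t)
    have h1 : 0 ≤ 1/2 * Real.sinh ((ν + 1/2) * t) * Real.sinh (1/2 * t) / Real.cosh (1/2 * t) ^ 2 := by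
      have := hs2 t ht
      rw [mul_assoc]; positivity
    have h2 : Real.cosh ((ν + 1/2) * t) ≤ 2 * Real.cosh (ν * t) * Real.cosh (1/2 * t) := by
      have e1 : (ν + 1/2) * t = ν * t + 1/2 * t := by ring
      have : 0 < Real.cosh (ν * t - 1/2 * t) := Real.cosh_pos _
      rw [Real.cosh_sub] at this
      rw [e1, Real.cosh_add]
      linarith
    have h3 : (ν + 1/2) * Real.cosh ((ν + 1/2) * t) / Real.cosh (1/2 * t) ≤ (2 * ν + 1) * Real.cosh (ν * t) := by
      rw [div_le_iff₀ hc]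
      nlinarith
    simp only [hg]
    linarith
  have hsb : ∀ t : ℝ, 0 ≤ t → |Real.sinh ((ν + 1/2) * t) / Real.cosh (1/2 * t)| ≤ 1 * Real.exp (|ν + 1/2| * t) := by
    intro t ht
    rw [abs_div]
    refine le_trans (div_le_self (abs_nonneg _) ?_) (sinh_le_exp_abs _ t ht)
    rw [abs_of_pos (Real.cosh_pos _)]; exact Real.one_le_cosh _
  have hgb : ∀ t : ℝ, 0 ≤ t → |g t| ≤ (|ν + 1/2| + 1/2) * Real.exp (|ν + 1/2| * t) := by
    intro t ht
    have hc := Real.cosh_pos (1/2 * t)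
    have hc1 := Real.one_le_cosh (1/2 * t)
    have a1 : |(ν + 1/2) * Real.cosh ((ν + 1/2) * t) / Real.cosh (1/2 * t)| ≤ |ν + 1/2| * Real.exp (|ν + 1/2| * t) := by
      rw [abs_div, abs_of_pos hc]
      refine le_trans (div_le_self (abs_nonneg _) hc1) ?_
      rw [abs_mul]
      have := cosh_le_exp_abs (ν + 1/2) t ht
      rw [one_mul] at this
      gcongr
    have a2 : |1/2 * Real.sinh ((ν + 1/2) * t) * Real.sinh (1/2 * t) / Real.cosh (1/2 * t) ^ 2| ≤ 1/2 * Real.exp (|ν + 1/2| * t) := by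
      have e : 1/2 * Real.sinh ((ν + 1/2) * t) * Real.sinh (1/2 * t) / Real.cosh (1/2 * t) ^ 2
        = 1/2 * (Real.sinh ((ν + 1/2) * t) / Real.cosh (1/2 * t)) * (Real.sinh (1/2 * t) / Real.cosh (1/2 * t)) := by
        field_simp
      have h5 : |Real.sinh (1/2 * t) / Real.cosh (1/2 * t)| ≤ 1 := by
        rw [abs_div, abs_of_pos hc, div_le_one hc]
        apply abs_le_of_sq_le_sq _ hc.le
        rw [Real.cosh_sq]; linarith
      have h6 := hsb t ht
      rw [e, abs_mul, abs_mul, abs_of_pos (by norm_num : (0:ℝ) < 1/2)]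
      calc _ ≤ 1/2 * (1 * Real.exp (|ν + 1/2| * t)) * 1 := by gcongr
        _ = _ := by ring
    calc |g t| ≤ _ := abs_sub _ _
      _ ≤ _ := by linarith
  have i0 := integ_exp_cosh x hx g hgc _ _ hgb
  have i1 := besselK_integrable ν x hx
  have i2 := besselK_integrable (ν + 1) x hx
  have i21 : IntegrableOn (fun t => Real.exp (-x * Real.cosh t) * Real.cosh ((ν + 1) * t)
          - Real.exp (-x * Real.cosh t) * Real.cosh (ν * t)) (Set.Ioi 0) := i2.sub i1
  have hI := integral_Ioi_of_hasDerivAt_of_tendsto' hd (i0.sub (i21.const_mul x))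
    (tendsto_exp_cosh x hx (fun t => Real.sinh ((ν + 1/2) * t) / Real.cosh (1/2 * t)) 1 |ν + 1/2| hsb)
  rw [integral_sub i0 (i21.const_mul x), integral_const_mul] at hI
  have e : ∫ (a : ℝ) in Set.Ioi 0, Real.exp (-x * Real.cosh a) * Real.cosh ((ν + 1) * a) -
      Real.exp (-x * Real.cosh a) * Real.cosh (ν * a) = besselK (ν + 1) x - besselK ν x := by
    unfold besselK
    exact integral_sub i2 i1
  rw [e] at hI
  simp only [mul_zero, Real.sinh_zero, zero_div, sub_zero] at hI
  have hle : ∫ (a : ℝ) in Set.Ioi 0, Real.exp (-x * Real.cosh a) * g a ≤ (2 * ν + 1) * besselK ν x := by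
    unfold besselK
    rw [← integral_const_mul]
    apply setIntegral_mono_on i0 (i1.const_mul _) measurableSet_Ioi
    intro t ht
    have := hgle t (le_of_lt ht)
    have h3 := Real.exp_pos (-x * Real.cosh t)
    nlinarith
  linarith


lemma integrableOn_Iic_of_neg (f : ℝ → ℝ) (hf : IntegrableOn (fun t => f (-t)) (Set.Ioi 0)) :
    IntegrableOn f (Set.Iic 0) := by
  rw [integrableOn_Iic_iff_integrableOn_Iio]
  have h := (Measure.measurePreserving_neg (volume : Measure ℝ)).integrableOn_comp_preimage
    (Homeomorph.neg ℝ).isClosedEmbedding.measurableEmbedding (f := f) (s := Set.Iio 0)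
  rw [← h]
  have e : (Neg.neg ⁻¹' Set.Iio (0:ℝ)) = Set.Ioi 0 := by ext x; simp
  rw [e]
  exact hf

lemma besselK_full (ν x : ℝ) (hx : 0 < x) :
    Integrable (fun t : ℝ => Real.exp (-x * Real.cosh t) * Real.exp (ν * t)) ∧
    ∫ t : ℝ, Real.exp (-x * Real.cosh t) * Real.exp (ν * t) = 2 * besselK ν x := by
  have key : ∀ μ : ℝ, IntegrableOn (fun t : ℝ => Real.exp (-x * Real.cosh t) * Real.exp (μ * t)) (Set.Ioi 0) := by
    intro μ
    refine integ_exp_cosh x hx _ (by fun_prop) 1 μ ?_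
    intro t ht
    rw [one_mul, abs_of_pos (Real.exp_pos _)]
  have h1 := key ν
  have h2 := key (-ν)
  have h3 : IntegrableOn (fun t : ℝ => Real.exp (-x * Real.cosh t) * Real.exp (ν * t)) (Set.Iic 0) := by
    apply integrableOn_Iic_of_neg
    refine h2.congr_fun ?_ measurableSet_Ioi
    intro t _
    simp
  have hi : Integrable (fun t : ℝ => Real.exp (-x * Real.cosh t) * Real.exp (ν * t)) := by
    rw [← integrableOn_univ, ← Set.Iic_union_Ioi (a := (0:ℝ))]
    exact h3.union h1
  refine ⟨hi, ?_⟩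
  rw [← intervalIntegral.integral_Iic_add_Ioi h3 h1]
  have e : ∫ (t : ℝ) in Set.Iic 0, Real.exp (-x * Real.cosh t) * Real.exp (ν * t) =
      ∫ (t : ℝ) in Set.Ioi 0, Real.exp (-x * Real.cosh t) * Real.exp (-ν * t) := by
    have := integral_comp_neg_Iic (0:ℝ) (fun t => Real.exp (-x * Real.cosh t) * Real.exp (-ν * t))
    simpa using this
  rw [e, ← integral_add h2 h1]
  unfold besselK
  rw [← integral_const_mul]
  congr 1; ext t
  rw [Real.cosh_eq (ν * t)]
  ring_nf

lemma besselK_repr (ν x : ℝ) (hx : 0 < x) :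
    IntegrableOn (fun s : ℝ => s ^ (ν - 1) * Real.exp (-s - x ^ 2 / (4 * s))) (Set.Ioi 0) ∧
    ∫ s in Set.Ioi (0:ℝ), s ^ (ν - 1) * Real.exp (-s - x ^ 2 / (4 * s)) = 2 * (x / 2) ^ ν * besselK ν x := by
  have him : (fun t : ℝ => x / 2 * Real.exp t) '' Set.univ = Set.Ioi 0 := by
    ext s
    simp only [Set.image_univ, Set.mem_range, Set.mem_Ioi]
    constructor
    · rintro ⟨t, rfl⟩; positivity
    · intro hs
      refine ⟨Real.log (s / (x / 2)), ?_⟩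
      rw [Real.exp_log (by positivity)]; field_simp
  have hinj : Set.InjOn (fun t : ℝ => x / 2 * Real.exp t) Set.univ := by
    intro a _ b _ hab
    have : Real.exp a = Real.exp b := by
      have := hab
      simpa [hx.ne'] using this
    exact Real.exp_injective this
  have hd : ∀ t ∈ (Set.univ : Set ℝ), HasDerivWithinAt (fun t : ℝ => x / 2 * Real.exp t) (x / 2 * Real.exp t) Set.univ t :=
    fun t _ => ((Real.hasDerivAt_exp t).const_mul (x / 2)).hasDerivWithinAt
  have e : ∀ t : ℝ, |x / 2 * Real.exp t| • ((x / 2 * Real.exp t) ^ (ν - 1) * Real.exp (-(x / 2 * Real.exp t) - x ^ 2 / (4 * (x / 2 * Real.exp t))))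
      = (x / 2) ^ ν * (Real.exp (-x * Real.cosh t) * Real.exp (ν * t)) := by
    intro t
    have hp : 0 < x / 2 * Real.exp t := by positivity
    rw [abs_of_pos hp, smul_eq_mul, ← mul_assoc]
    have e1 : x / 2 * Real.exp t * (x / 2 * Real.exp t) ^ (ν - 1) = (x / 2) ^ ν * Real.exp (ν * t) := by
      rw [Real.rpow_sub_one hp.ne', mul_div_cancel₀ _ hp.ne', Real.mul_rpow (by positivity) (by positivity), ← Real.exp_mul]
      ring_nf
    have e2 : -(x / 2 * Real.exp t) - x ^ 2 / (4 * (x / 2 * Real.exp t)) = -x * Real.cosh t := by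
      rw [Real.cosh_eq, Real.exp_neg]
      field_simp
      ring
    rw [e1, e2]; ring
  obtain ⟨f1, f2⟩ := besselK_full ν x hx
  constructor
  · rw [← him, integrableOn_image_iff_integrableOn_abs_deriv_smul MeasurableSet.univ hd hinj]
    simp_rw [e]
    rw [integrableOn_univ]
    exact f1.const_mul _
  · rw [← him, integral_image_eq_integral_abs_deriv_smul MeasurableSet.univ hd hinj]
    simp_rw [e]
    rw [setIntegral_univ, integral_const_mul, f2]
    ring

lemma gauss_shift (β c : ℝ) (hc : 0 < c) :
    Integrable (fun x : ℝ => Real.exp (β * x) * Real.exp (-(c * x ^ 2))) ∧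
    ∫ x : ℝ, Real.exp (β * x) * Real.exp (-(c * x ^ 2)) = Real.exp (β ^ 2 / (4 * c)) * Real.sqrt (Real.pi / c) := by
  have e : ∀ x : ℝ, Real.exp (β * x) * Real.exp (-(c * x ^ 2)) =
      Real.exp (β ^ 2 / (4 * c)) * Real.exp (-c * (x - β / (2 * c)) ^ 2) := by
    intro x
    rw [← Real.exp_add, ← Real.exp_add]
    congr 1
    field_simp
    ring
  simp_rw [e]
  constructor
  · exact ((integrable_exp_neg_mul_sq hc).comp_sub_right (β / (2 * c))).const_mul _
  · rw [integral_const_mul, integral_sub_right_eq_self (fun x => Real.exp (-c * x ^ 2)) (β / (2 * c)), integral_gaussian]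

/-- the kernel on the whole line -/
noncomputable def wfun (ν α β x : ℝ) : ℝ := Real.exp (β * x) * |x| ^ ν * besselK ν (α * |x|)

lemma wfun_repr (ν α β x : ℝ) (hα : 0 < α) (hx : x ≠ 0) :
    wfun ν α β x = (1/2) * (2 / α) ^ ν *
      ∫ s in Set.Ioi (0:ℝ), Real.exp (β * x) * (s ^ (ν - 1) * Real.exp (-s - (α * |x|) ^ 2 / (4 * s))) := by
  have hx' : 0 < |x| := abs_pos.2 hx
  rw [integral_const_mul, (besselK_repr ν (α * |x|) (by positivity)).2]
  unfold wfun
  have : |x| ^ ν = (2 / α) ^ ν * (α * |x| / 2) ^ ν := by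
    rw [← Real.mul_rpow (by positivity) (by positivity)]
    congr 1
    field_simp
  rw [this]; ring

lemma wfun_prod (ν α β : ℝ) (hν : -(1/2) < ν) (hα : 0 < α) (hβ : |β| < α) :
    Integrable (fun z : ℝ × ℝ => Real.exp (β * z.1) * (z.2 ^ (ν - 1) * Real.exp (-z.2 - (α * |z.1|) ^ 2 / (4 * z.2))))
      ((volume : Measure ℝ).prod (volume.restrict (Set.Ioi 0))) ∧
    ∫ s in Set.Ioi (0:ℝ), ∫ x, Real.exp (β * x) * (s ^ (ν - 1) * Real.exp (-s - (α * |x|) ^ 2 / (4 * s)))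
      = 2 * Real.sqrt Real.pi / α * (1 / (1 - β ^ 2 / α ^ 2)) ^ (ν + 1/2) * Real.Gamma (ν + 1/2) := by
  have hk : 0 < 1 - β ^ 2 / α ^ 2 := by
    rw [sub_pos, div_lt_one (by positivity)]
    exact sq_lt_sq.2 (by rwa [abs_of_pos hα])
  have e : ∀ s : ℝ, ∀ x : ℝ, 0 < s → Real.exp (β * x) * (s ^ (ν - 1) * Real.exp (-s - (α * |x|) ^ 2 / (4 * s)))
      = s ^ (ν - 1) * Real.exp (-s) * (Real.exp (β * x) * Real.exp (-(α ^ 2 / (4 * s) * x ^ 2))) := by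
    intro s x hs
    rw [sub_eq_add_neg (-s), Real.exp_add, mul_pow, sq_abs]
    have : -(α ^ 2 * x ^ 2 / (4 * s)) = -(α ^ 2 / (4 * s) * x ^ 2) := by ring
    rw [this]; ring
  have e2 : ∀ s : ℝ, 0 < s → ∫ x, Real.exp (β * x) * (s ^ (ν - 1) * Real.exp (-s - (α * |x|) ^ 2 / (4 * s)))
      = 2 * Real.sqrt Real.pi / α * (s ^ ((ν + 1/2) - 1) * Real.exp (-((1 - β ^ 2 / α ^ 2) * s))) := by
    intro s hs
    simp_rw [e s _ hs]
    rw [integral_const_mul, (gauss_shift β (α ^ 2 / (4 * s)) (by positivity)).2]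
    have e3 : Real.sqrt (Real.pi / (α ^ 2 / (4 * s))) = 2 * Real.sqrt Real.pi / α * s ^ (1/2 : ℝ) := by
      have : Real.pi / (α ^ 2 / (4 * s)) = (2 / α) ^ 2 * (Real.pi * s) := by field_simp; norm_num
      rw [this, Real.sqrt_mul (by positivity), Real.sqrt_sq (by positivity), Real.sqrt_mul Real.pi_pos.le, Real.sqrt_eq_rpow s]
      ring
    have e4 : (ν + 1/2) - 1 = (ν - 1) + 1/2 := by ring
    have e5 : Real.exp (-((1 - β ^ 2 / α ^ 2) * s)) = Real.exp (-s) * Real.exp (β ^ 2 / (4 * (α ^ 2 / (4 * s)))) := by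
      rw [← Real.exp_add]
      congr 1
      field_simp
      ring
    rw [e3, e4, e5, Real.rpow_add hs]
    ring
  constructor
  · rw [integrable_prod_iff']
    · constructor
      · rw [ae_restrict_iff' measurableSet_Ioi]
        refine Eventually.of_forall fun s hs => ?_
        simp only
        simp_rw [e s _ hs]
        exact (gauss_shift β (α ^ 2 / (4 * s)) (by have : (0:ℝ) < s := hs; positivity)).1.const_mul _
      · have hg : IntegrableOn (fun s : ℝ => 2 * Real.sqrt Real.pi / α * (s ^ ((ν + 1/2) - 1) * Real.exp (-((1 - β ^ 2 / α ^ 2) * s)))) (Set.Ioi 0) := by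
          apply Integrable.const_mul
          have := integrableOn_rpow_mul_exp_neg_mul_rpow (p := 1) (s := ν + 1/2 - 1) (b := 1 - β ^ 2 / α ^ 2) (by linarith) one_pos hk
          simp_rw [Real.rpow_one, neg_mul] at this
          exact this
        refine IntegrableOn.congr_fun hg ?_ measurableSet_Ioi
        intro s hs
        have hs' : (0:ℝ) < s := hs
        simp only
        rw [← e2 s hs]
        congr 1; ext x
        rw [Real.norm_of_nonneg]
        positivity
    · apply Measurable.aestronglyMeasurable
      fun_prop
  · rw [setIntegral_congr_fun measurableSet_Ioi (fun s hs => e2 s hs), integral_const_mul,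
      Real.integral_rpow_mul_exp_neg_mul_Ioi (by linarith) hk]
    ring

lemma wfun_integral (ν α β : ℝ) (hν : -(1/2) < ν) (hα : 0 < α) (hβ : |β| < α) :
    Integrable (wfun ν α β) ∧
    ∫ x, wfun ν α β x = (2 / α) ^ ν * (Real.sqrt Real.pi / α * (1 / (1 - β ^ 2 / α ^ 2)) ^ (ν + 1/2) * Real.Gamma (ν + 1/2)) := by
  obtain ⟨h1, h2⟩ := wfun_prod ν α β hν hα hβ
  have hae : (fun x => (1/2) * (2 / α) ^ ν *
      ∫ s in Set.Ioi (0:ℝ), Real.exp (β * x) * (s ^ (ν - 1) * Real.exp (-s - (α * |x|) ^ 2 / (4 * s)))) =ᵐ[volume] wfun ν α β := by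
    have : ∀ᵐ x : ℝ, x ≠ 0 := by
      simp [ae_iff]
    filter_upwards [this] with x hx
    exact (wfun_repr ν α β x hα hx).symm
  constructor
  · exact (h1.integral_prod_left.const_mul _).congr hae
  · rw [← integral_congr_ae hae, integral_const_mul, integral_integral_swap (by exact h1), h2]
    ring

lemma besselK_lim_a (ν : ℝ) (hν : 0 < ν) :
    Tendsto (fun x => x ^ ν * besselK ν x) (nhdsWithin 0 (Set.Ioi 0)) (nhds (2 ^ ν / 2 * Real.Gamma ν)) := by
  have h1 : Tendsto (fun x : ℝ => ∫ s in Set.Ioi (0:ℝ), s ^ (ν - 1) * Real.exp (-s - x ^ 2 / (4 * s)))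
      (nhdsWithin 0 (Set.Ioi 0)) (nhds (∫ s in Set.Ioi (0:ℝ), Real.exp (-s) * s ^ (ν - 1))) := by
    apply tendsto_integral_filter_of_dominated_convergence (fun s => Real.exp (-s) * s ^ (ν - 1))
    · refine Eventually.of_forall fun x => ?_
      apply Measurable.aestronglyMeasurable
      fun_prop
    · refine Eventually.of_forall fun x => ?_
      rw [ae_restrict_iff' measurableSet_Ioi]
      refine Eventually.of_forall fun s hs => ?_
      have hs' : (0:ℝ) < s := hs
      rw [Real.norm_of_nonneg (by positivity), mul_comm]
      gcongr
      have : 0 ≤ x ^ 2 / (4 * s) := by positivity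
      linarith
    · exact Real.GammaIntegral_convergent hν
    · rw [ae_restrict_iff' measurableSet_Ioi]
      refine Eventually.of_forall fun s hs => ?_
      apply tendsto_nhdsWithin_of_tendsto_nhds
      have : Continuous fun x : ℝ => s ^ (ν - 1) * Real.exp (-s - x ^ 2 / (4 * s)) := by fun_prop
      have h2 := this.tendsto 0
      simpa [mul_comm] using h2
  rw [← Real.Gamma_eq_integral hν] at h1
  refine Tendsto.congr' ?_ (h1.const_mul (2 ^ ν / 2))
  filter_upwards [self_mem_nhdsWithin] with x hx
  have hx' : (0:ℝ) < x := hx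
  rw [(besselK_repr ν x hx).2, Real.div_rpow hx'.le (by norm_num)]
  have : (2:ℝ) ^ ν ≠ 0 := by positivity
  field_simp

lemma besselK_lim_b (ν : ℝ) (hν : -(1/2) < ν) :
    Tendsto (fun x => x ^ (ν + 1) * besselK ν x) (nhdsWithin 0 (Set.Ioi 0)) (nhds 0) := by
  have h1 : Tendsto (fun x : ℝ => ∫ s in Set.Ioi (0:ℝ), x * (s ^ (ν - 1) * Real.exp (-s - x ^ 2 / (4 * s))))
      (nhdsWithin 0 (Set.Ioi 0)) (nhds (∫ s in Set.Ioi (0:ℝ), (0:ℝ))) := by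
    apply tendsto_integral_filter_of_dominated_convergence (fun s => 2 * (Real.exp (-s) * s ^ ((ν + 1/2) - 1)))
    · refine Eventually.of_forall fun x => ?_
      apply Measurable.aestronglyMeasurable
      fun_prop
    · filter_upwards [self_mem_nhdsWithin] with x hx
      have hx' : (0:ℝ) < x := hx
      rw [ae_restrict_iff' measurableSet_Ioi]
      refine Eventually.of_forall fun s hs => ?_
      have hs' : (0:ℝ) < s := hs
      rw [Real.norm_of_nonneg (by positivity)]
      have e4 : (ν + 1/2) - 1 = (ν - 1) + 1/2 := by ring
      rw [e4, Real.rpow_add hs', ← Real.sqrt_eq_rpow, sub_eq_add_neg (-s), Real.exp_add]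
      have key : x * Real.exp (-(x ^ 2 / (4 * s))) ≤ 2 * Real.sqrt s := by
        set y := x / (2 * Real.sqrt s) with hy
        have hsq : 0 < Real.sqrt s := Real.sqrt_pos.2 hs'
        have hxy : x = 2 * Real.sqrt s * y := by rw [hy]; field_simp
        have hy2 : x ^ 2 / (4 * s) = y ^ 2 := by
          rw [hy, div_pow, mul_pow, Real.sq_sqrt hs'.le]; norm_num
        rw [hy2, Real.exp_neg]
        have h3 : y ≤ Real.exp (y ^ 2) := by
          have := Real.add_one_le_exp (y ^ 2)
          nlinarith [sq_nonneg (y - 1)]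
        have h4 : y * (Real.exp (y ^ 2))⁻¹ ≤ 1 := by
          rw [← div_eq_mul_inv, div_le_one (Real.exp_pos _)]; exact h3
        rw [hxy]
        nlinarith
      have hp : 0 ≤ s ^ (ν - 1) * Real.exp (-s) := by positivity
      nlinarith [mul_le_mul_of_nonneg_left key hp]
    · exact (Real.GammaIntegral_convergent (by linarith)).const_mul 2
    · rw [ae_restrict_iff' measurableSet_Ioi]
      refine Eventually.of_forall fun s hs => ?_
      apply tendsto_nhdsWithin_of_tendsto_nhds
      have : Continuous fun x : ℝ => x * (s ^ (ν - 1) * Real.exp (-s - x ^ 2 / (4 * s))) := by fun_prop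
      have h2 := this.tendsto 0
      simpa using h2
  rw [integral_zero] at h1
  have h3 := h1.const_mul (2 ^ ν / 2)
  rw [mul_zero] at h3
  refine Tendsto.congr' ?_ h3
  filter_upwards [self_mem_nhdsWithin] with x hx
  have hx' : (0:ℝ) < x := hx
  rw [integral_const_mul, (besselK_repr ν x hx).2, Real.div_rpow hx'.le (by norm_num), Real.rpow_add_one hx'.ne']
  have : (2:ℝ) ^ ν ≠ 0 := by positivity
  field_simp


noncomputable def bPhi (ν z : ℝ) : ℝ := ∑' k : ℕ, z ^ k / (Real.Gamma (ν + k + 1) * (Nat.factorial k))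

lemma gamma_lower (ν : ℝ) (hν : -(1/2) < ν) (k : ℕ) : Real.Gamma (ν + 1) / 2 ≤ Real.Gamma (ν + k + 1) := by
  have h0 : 0 < Real.Gamma (ν + 1) := Real.Gamma_pos_of_pos (by linarith)
  have h1 : ∀ k : ℕ, Real.Gamma (ν + 1) / 2 ≤ Real.Gamma (ν + (k + 1 : ℕ) + 1) := by
    intro k
    induction k with
    | zero =>
      have : ν + ((0 + 1 : ℕ) : ℝ) + 1 = (ν + 1) + 1 := by push_cast; ring
      rw [this, Real.Gamma_add_one (s := ν + 1) (by linarith)]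
      nlinarith
    | succ n ih =>
      have hn : (0:ℝ) ≤ n := Nat.cast_nonneg n
      have : ν + ((n + 1 + 1 : ℕ) : ℝ) + 1 = (ν + ((n + 1 : ℕ) : ℝ) + 1) + 1 := by push_cast; ring
      have hp : 0 < Real.Gamma (ν + ((n + 1 : ℕ) : ℝ) + 1) := Real.Gamma_pos_of_pos (by push_cast; linarith)
      rw [this, Real.Gamma_add_one (s := ν + ((n + 1 : ℕ) : ℝ) + 1) (by push_cast; linarith)]
      push_cast at *
      nlinarith
  cases k with
  | zero => simp; linarith
  | succ n => exact h1 n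

lemma gamma_pos' (ν : ℝ) (hν : -(1/2) < ν) (k : ℕ) : 0 < Real.Gamma (ν + k + 1) :=
  Real.Gamma_pos_of_pos (by have : (0:ℝ) ≤ k := Nat.cast_nonneg k; linarith)

lemma bPhi_term_bound (ν z R : ℝ) (hν : -(1/2) < ν) (hz : |z| ≤ R) (k : ℕ) :
    |z ^ k / (Real.Gamma (ν + k + 1) * (Nat.factorial k))| ≤ 2 / Real.Gamma (ν + 1) * (R ^ k / (Nat.factorial k)) := by
  have h0 : 0 < Real.Gamma (ν + 1) := Real.Gamma_pos_of_pos (by linarith)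
  have h1 := gamma_pos' ν hν k
  have h2 := gamma_lower ν hν k
  have hf : (0:ℝ) < Nat.factorial k := by positivity
  have hR : 0 ≤ R := (abs_nonneg z).trans hz
  rw [abs_div, abs_pow, abs_of_pos (by positivity : 0 < Real.Gamma (ν + k + 1) * (Nat.factorial k : ℝ))]
  rw [show 2 / Real.Gamma (ν + 1) * (R ^ k / (Nat.factorial k)) = R ^ k / (Real.Gamma (ν + 1) / 2 * Nat.factorial k) by field_simp]
  gcongr

lemma bPhi_summable (ν z : ℝ) (hν : -(1/2) < ν) :
    Summable (fun k : ℕ => z ^ k / (Real.Gamma (ν + k + 1) * (Nat.factorial k))) :=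
  Summable.of_norm_bounded ((Real.summable_pow_div_factorial |z|).mul_left _)
    (fun k => bPhi_term_bound ν z |z| hν le_rfl k)

lemma bPhi_shift_term (ν z : ℝ) (k : ℕ) :
    ((k + 1 : ℕ) : ℝ) * z ^ k / (Real.Gamma (ν + (k + 1 : ℕ) + 1) * (Nat.factorial (k + 1))) =
      z ^ k / (Real.Gamma (ν + 1 + k + 1) * (Nat.factorial k)) := by
  rw [Nat.factorial_succ]
  push_cast
  have e : ν + (↑k + 1) + 1 = ν + 1 + k + 1 := by ring
  rw [e]
  have hf : (Nat.factorial k : ℝ) ≠ 0 := by positivity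
  have hk : (k : ℝ) + 1 ≠ 0 := by positivity
  rw [mul_div_assoc, ← mul_assoc, mul_comm (Real.Gamma _) ((k:ℝ) + 1), mul_assoc, div_mul_eq_div_div_swap, ← mul_div_assoc, ← mul_div_assoc, mul_div_assoc]
  field_simp

lemma bPhi_deriv_sum (ν z : ℝ) (hν : -(1/2) < ν) :
    Summable (fun k : ℕ => (k : ℝ) * z ^ (k - 1) / (Real.Gamma (ν + k + 1) * (Nat.factorial k))) ∧
    ∑' k : ℕ, (k : ℝ) * z ^ (k - 1) / (Real.Gamma (ν + k + 1) * (Nat.factorial k)) = bPhi (ν + 1) z := by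
  have hs : Summable (fun k : ℕ => (k : ℝ) * z ^ (k - 1) / (Real.Gamma (ν + k + 1) * (Nat.factorial k))) := by
    rw [← summable_nat_add_iff 1]
    refine (bPhi_summable (ν + 1) z (by linarith)).congr fun k => ?_
    rw [← bPhi_shift_term]; rfl
  refine ⟨hs, ?_⟩
  rw [hs.tsum_eq_zero_add]
  simp only [Nat.cast_zero, zero_mul, zero_div, zero_add]
  unfold bPhi
  congr 1; ext k
  rw [← bPhi_shift_term]; rfl

lemma bPhi_hasDerivAt (ν z : ℝ) (hν : -(1/2) < ν) : HasDerivAt (bPhi ν) (bPhi (ν + 1) z) z := by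
  rw [← (bPhi_deriv_sum ν z hν).2]
  set R := |z| + 1
  have hb : ∀ k : ℕ, ∀ y ∈ Set.Ioo (-R) R, ‖(k : ℝ) * y ^ (k - 1) / (Real.Gamma (ν + k + 1) * (Nat.factorial k))‖ ≤
      (k : ℝ) * R ^ (k - 1) / (Real.Gamma (ν + k + 1) * (Nat.factorial k)) := by
    intro k y hy
    have h1 := gamma_pos' ν hν k
    rw [Real.norm_eq_abs, abs_div, abs_mul, abs_pow, Nat.abs_cast, abs_of_pos (by positivity : 0 < Real.Gamma (ν + k + 1) * (Nat.factorial k : ℝ))]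
    have : |y| ≤ R := (abs_lt.2 hy).le
    gcongr
  refine hasDerivAt_tsum_of_isPreconnected (bPhi_deriv_sum ν R hν).1 isOpen_Ioo isPreconnected_Ioo ?_ hb
    (y₀ := z) ?_ (bPhi_summable ν z hν) ?_
  · intro k y hy
    exact (hasDerivAt_pow k y).div_const _
  · exact abs_lt.1 (by simp [R])
  · exact abs_lt.1 (by simp [R])

lemma bPhi_rec (ν z : ℝ) (hν : -(1/2) < ν) : bPhi ν z = (ν + 1) * bPhi (ν + 1) z + z * bPhi (ν + 2) z := by
  have h1 := bPhi_summable (ν + 1) z (by linarith)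
  obtain ⟨h2, h3⟩ := bPhi_deriv_sum (ν + 1) z (by linarith)
  have e : ν + 1 + 1 = ν + 2 := by ring
  rw [e] at h3
  rw [← h3]
  unfold bPhi
  rw [← tsum_mul_left, ← tsum_mul_left, ← (h1.mul_left _).tsum_add (h2.mul_left _)]
  congr 1; ext k
  have hg := gamma_pos' ν hν k
  have e2 : ν + 1 + k + 1 = (ν + k + 1) + 1 := by ring
  have hne : ν + k + 1 ≠ 0 := by have : (0:ℝ) ≤ k := Nat.cast_nonneg k; linarith
  rw [e2, Real.Gamma_add_one hne]
  have hf : (Nat.factorial k : ℝ) ≠ 0 := by positivity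
  rcases k with _ | k
  · simp at *; field_simp
  · simp only [Nat.add_sub_cancel]
    push_cast at *
    field_simp
    ring

lemma bPhi_pos (ν z : ℝ) (hν : -(1/2) < ν) (hz : 0 ≤ z) : 0 < bPhi ν z := by
  refine (bPhi_summable ν z hν).tsum_pos ?_ 0 ?_
  · intro k
    have := gamma_pos' ν hν k
    positivity
  · have := gamma_pos' ν hν 0
    simp only [pow_zero]; positivity

lemma bPhi_zero (ν : ℝ) : bPhi ν 0 = 1 / Real.Gamma (ν + 1) := by
  unfold bPhi
  rw [tsum_eq_single 0]
  · simp
  · intro k hk; simp [hk]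

lemma besselI_eq (ν x : ℝ) (hx : 0 < x) : besselI ν x = (x / 2) ^ ν * bPhi ν (x ^ 2 / 4) := by
  unfold besselI bPhi
  rw [← tsum_mul_left]
  congr 1; ext k
  rw [Real.rpow_add (by positivity), mul_div_assoc]
  congr 2
  rw [Real.rpow_mul (by positivity), Real.rpow_natCast]
  congr 1
  rw [Real.rpow_two]; ring

noncomputable def phi (ν α x : ℝ) : ℝ := (α / 2) ^ ν * bPhi ν (α ^ 2 * x ^ 2 / 4)
noncomputable def phi1 (ν α x : ℝ) : ℝ := (α / 2) ^ ν * (α ^ 2 * x / 2 * bPhi (ν + 1) (α ^ 2 * x ^ 2 / 4))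
noncomputable def psi (ν α x : ℝ) : ℝ := x ^ (-ν) * besselK ν (α * x)
noncomputable def psi1 (ν α x : ℝ) : ℝ := -(α * (x ^ (-ν) * besselK (ν + 1) (α * x)))

lemma besselI_phi (ν α x : ℝ) (hα : 0 < α) (hx : 0 < x) : besselI ν (α * x) = x ^ ν * phi ν α x := by
  rw [besselI_eq ν _ (by positivity)]
  unfold phi
  rw [mul_pow, show α * x / 2 = α / 2 * x by ring, Real.mul_rpow (by positivity) hx.le]
  ring

lemma phi_pos (ν α x : ℝ) (hν : -(1/2) < ν) (hα : 0 < α) : 0 < phi ν α x :=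
  mul_pos (by positivity) (bPhi_pos ν _ hν (by positivity))

lemma phi1_nonneg (ν α x : ℝ) (hν : -(1/2) < ν) (hα : 0 < α) (hx : 0 ≤ x) : 0 ≤ phi1 ν α x := by
  have := bPhi_pos (ν + 1) (α ^ 2 * x ^ 2 / 4) (by linarith) (by positivity)
  unfold phi1; positivity

lemma phi_arg_deriv (α x : ℝ) : HasDerivAt (fun x : ℝ => α ^ 2 * x ^ 2 / 4) (α ^ 2 * x / 2) x := by
  have := ((hasDerivAt_pow 2 x).const_mul (α ^ 2)).div_const 4
  refine this.congr_deriv ?_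
  simp; ring

lemma phi_hasDerivAt (ν α x : ℝ) (hν : -(1/2) < ν) : HasDerivAt (phi ν α) (phi1 ν α x) x := by
  have := ((bPhi_hasDerivAt ν (α ^ 2 * x ^ 2 / 4) hν).comp x (phi_arg_deriv α x)).const_mul ((α / 2) ^ ν)
  refine HasDerivAt.congr_deriv (f := phi ν α) this ?_
  unfold phi1; ring

lemma phi1_hasDerivAt (ν α x : ℝ) (hν : -(1/2) < ν) (hx : 0 < x) :
    HasDerivAt (phi1 ν α) (α ^ 2 * phi ν α x - (2 * ν + 1) / x * phi1 ν α x) x := by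
  have h1 := (bPhi_hasDerivAt (ν + 1) (α ^ 2 * x ^ 2 / 4) (by linarith)).comp x (phi_arg_deriv α x)
  have h2 : HasDerivAt (fun x : ℝ => α ^ 2 * x / 2) (α ^ 2 / 2) x := by
    refine (((hasDerivAt_id x).const_mul (α ^ 2)).div_const 2).congr_deriv ?_
    ring
  have := (h2.mul h1).const_mul ((α / 2) ^ ν)
  refine HasDerivAt.congr_deriv (f := phi1 ν α) this ?_
  unfold phi1 phi
  rw [bPhi_rec ν _ hν, show ν + 1 + 1 = ν + 2 by ring]
  simp only [Function.comp]
  field_simp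
  ring

lemma psi_hasDerivAt (ν α x : ℝ) (hα : 0 < α) (hx : 0 < x) : HasDerivAt (psi ν α) (psi1 ν α x) x := by
  have h1 : HasDerivAt (fun x => besselK ν (α * x)) _ x := (besselK_hasDerivAt ν (α * x) (by positivity)).comp x ((hasDerivAt_id x).const_mul α)
  have h2 := Real.hasDerivAt_rpow_const (x := x) (p := -ν) (Or.inl hx.ne')
  refine HasDerivAt.congr_deriv (f := psi ν α) (h2.mul h1) ?_
  unfold psi1
  have hr := besselK_rec ν (α * x) (by positivity)
  have e : besselK (ν - 1) (α * x) = besselK (ν + 1) (α * x) - 2 * ν * besselK ν (α * x) / (α * x) := by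
    field_simp
    linarith
  rw [e, Real.rpow_sub_one hx.ne']
  field_simp
  ring

lemma psi1_hasDerivAt (ν α x : ℝ) (hα : 0 < α) (hx : 0 < x) :
    HasDerivAt (psi1 ν α) (α ^ 2 * psi ν α x - (2 * ν + 1) / x * psi1 ν α x) x := by
  have h1 : HasDerivAt (fun x => besselK (ν + 1) (α * x)) _ x := (besselK_hasDerivAt (ν + 1) (α * x) (by positivity)).comp x ((hasDerivAt_id x).const_mul α)
  have h2 := Real.hasDerivAt_rpow_const (x := x) (p := -ν) (Or.inl hx.ne')
  refine HasDerivAt.congr_deriv (f := psi1 ν α) ((h2.mul h1).const_mul α).neg ?_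
  unfold psi1 psi
  have hr := besselK_rec (ν + 1) (α * x) (by positivity)
  have e : besselK (ν + 1 + 1) (α * x) = besselK (ν + 1 - 1) (α * x) + 2 * (ν + 1) * besselK (ν + 1) (α * x) / (α * x) := by
    field_simp
    linarith
  rw [e, Real.rpow_sub_one hx.ne', show ν + 1 - 1 = ν by ring]
  field_simp
  ring

lemma psi_pos (ν α x : ℝ) (hα : 0 < α) (hx : 0 < x) : 0 < psi ν α x :=
  mul_pos (by positivity) (besselK_pos ν _ (by positivity))

lemma wronskian (ν α x : ℝ) (hν : -(1/2) < ν) (hα : 0 < α) (hx : 0 < x) :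
    x ^ (2 * ν + 1) * (phi1 ν α x * psi ν α x - phi ν α x * psi1 ν α x) = 1 := by
  set W : ℝ → ℝ := fun x => x ^ (2 * ν + 1) * (phi1 ν α x * psi ν α x - phi ν α x * psi1 ν α x) with hW
  have hd : ∀ y ∈ Set.Ioi (0:ℝ), HasDerivAt W 0 y := by
    intro y hy
    have hy' : (0:ℝ) < y := hy
    have h2 := Real.hasDerivAt_rpow_const (x := y) (p := 2 * ν + 1) (Or.inl hy'.ne')
    have := h2.mul (((phi1_hasDerivAt ν α y hν hy').mul (psi_hasDerivAt ν α y hα hy')).sub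
      ((phi_hasDerivAt ν α y hν).mul (psi1_hasDerivAt ν α y hα hy')))
    refine HasDerivAt.congr_deriv (f := W) this ?_
    simp only [Pi.sub_apply, Pi.mul_apply]
    rw [Real.rpow_sub_one hy'.ne']
    field_simp
    ring
  have hconst : ∀ y ∈ Set.Ioi (0:ℝ), W y = W x := by
    intro y hy
    exact (convex_Ioi (0:ℝ)).is_const_of_fderivWithin_eq_zero (𝕜 := ℝ)
      (fun z hz => (hd z hz).differentiableAt.differentiableWithinAt)
      (fun z hz => by
        have h0 := (hd z hz).hasFDerivAt.hasFDerivWithinAt (s := Set.Ioi 0)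
        rw [h0.fderivWithin (isOpen_Ioi.uniqueDiffWithinAt hz)]
        ext; simp) hy hx
  have hphi : Tendsto (phi ν α) (nhdsWithin 0 (Set.Ioi 0)) (nhds ((α / 2) ^ ν / Real.Gamma (ν + 1))) := by
    have h := (phi_hasDerivAt ν α 0 hν).continuousAt.tendsto
    have e : phi ν α 0 = (α / 2) ^ ν / Real.Gamma (ν + 1) := by
      unfold phi; simp [bPhi_zero]; rfl
    rw [e] at h
    exact tendsto_nhdsWithin_of_tendsto_nhds h
  have hscale : Tendsto (fun x : ℝ => α * x) (nhdsWithin 0 (Set.Ioi 0)) (nhdsWithin 0 (Set.Ioi 0)) := by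
    apply tendsto_nhdsWithin_of_tendsto_nhds_of_eventually_within
    · apply tendsto_nhdsWithin_of_tendsto_nhds
      have : Continuous fun x : ℝ => α * x := by fun_prop
      simpa using this.tendsto 0
    · filter_upwards [self_mem_nhdsWithin] with y hy
      exact mul_pos hα hy
  have hlim : Tendsto W (nhdsWithin 0 (Set.Ioi 0)) (nhds 1) := by
    have ha := (besselK_lim_a (ν + 1) (by linarith)).comp hscale
    have hb := (besselK_lim_b ν hν).comp hscale
    have hc : Tendsto (fun x => (α / 2) ^ ν * (α ^ 2 * x / 2 * bPhi (ν + 1) (α ^ 2 * x ^ 2 / 4))) (nhdsWithin 0 (Set.Ioi 0)) (nhds 0) := by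
      apply tendsto_nhdsWithin_of_tendsto_nhds
      have h1 := ((bPhi_hasDerivAt (ν + 1) (α ^ 2 * 0 ^ 2 / 4) (by linarith)).comp (0:ℝ) (phi_arg_deriv α 0)).continuousAt
      have h2 : ContinuousAt (fun x => (α / 2) ^ ν * (α ^ 2 * x / 2 * bPhi (ν + 1) (α ^ 2 * x ^ 2 / 4))) 0 := by
        apply ContinuousAt.mul continuousAt_const
        exact ContinuousAt.mul (by fun_prop) h1
      simpa using h2.tendsto
    have hall := ((hc.mul hb).const_mul (α ^ (-(ν + 1)))).add ((hphi.mul ha).const_mul (α ^ (-ν)))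
    have elim : α ^ (-(ν + 1)) * (0 * 0) + α ^ (-ν) * ((α / 2) ^ ν / Real.Gamma (ν + 1) * (2 ^ (ν + 1) / 2 * Real.Gamma (ν + 1))) = 1 := by
      have hG : Real.Gamma (ν + 1) ≠ 0 := (Real.Gamma_pos_of_pos (by linarith)).ne'
      rw [Real.div_rpow hα.le (by norm_num), Real.rpow_neg hα.le ν, Real.rpow_add_one (two_ne_zero) ν]
      have h2 : (2:ℝ) ^ ν ≠ 0 := by positivity
      have h3 : α ^ ν ≠ 0 := by positivity
      field_simp
      ring
    rw [elim] at hall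
    refine hall.congr' ?_
    filter_upwards [self_mem_nhdsWithin] with y hy
    have hy' : (0:ℝ) < y := hy
    simp only [Function.comp, hW]
    unfold phi1 psi psi1
    rw [Real.mul_rpow hα.le hy'.le, show 2 * ν + 1 = (ν + 1) + ν by ring, Real.rpow_add hy' (ν + 1) ν, Real.rpow_neg hy'.le ν, Real.rpow_neg hα.le ν, Real.rpow_neg hα.le (ν + 1), Real.rpow_add_one hα.ne' ν, Real.rpow_add_one hy'.ne' ν]
    have : y ^ ν ≠ 0 := by positivity
    have : α ^ ν ≠ 0 := by positivity
    field_simp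
    ring
  have : Tendsto W (nhdsWithin 0 (Set.Ioi 0)) (nhds (W x)) := by
    refine tendsto_const_nhds.congr' ?_
    filter_upwards [self_mem_nhdsWithin] with y hy
    exact (hconst y hy).symm
  exact tendsto_nhds_unique this hlim


lemma integral_Ioi_lim (f f' : ℝ → ℝ) (a b : ℝ) (hd : ∀ x, 0 < x → HasDerivAt f (f' x) x)
    (hi : IntegrableOn f' (Set.Ioi 0)) (h0 : Tendsto f (nhdsWithin 0 (Set.Ioi 0)) (nhds a))
    (h1 : Tendsto f atTop (nhds b)) : ∫ x in Set.Ioi (0:ℝ), f' x = b - a := by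
  have h := integral_Ioi_deriv_mul_eq_sub (a := (0:ℝ)) (u := f) (u' := f') (v := fun _ => (1:ℝ)) (v' := fun _ => 0)
    (a' := a) (b' := b)
    (fun x hx => hd x hx) (fun x _ => hasDerivAt_const x 1) ?_ ?_ ?_
  · simpa using h
  · refine hi.congr_fun ?_ measurableSet_Ioi
    intro x _; simp
  · refine h0.congr ?_; intro x; simp
  · refine h1.congr ?_; intro x; simp

/-- standing parameter assumptions -/
structure PP (r v α β : ℝ) : Prop where
  hr : 0 < r
  hv : 0 < v
  hα : 0 < α
  hβ : |β| < α
  hvab : v * (α ^ 2 - β ^ 2) = 1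

namespace PP
variable {r v α β : ℝ}

lemma neg (P : PP r v α β) : PP r v α (-β) := ⟨P.hr, P.hv, P.hα, by rw [abs_neg]; exact P.hβ, by rw [neg_sq]; exact P.hvab⟩

lemma succ (P : PP r v α β) : PP (r + 1) v α β := ⟨by linarith [P.hr], P.hv, P.hα, P.hβ, P.hvab⟩

end PP

noncomputable def pp (r α β x : ℝ) : ℝ := Real.exp (β * x) * (x ^ (r - 1) * psi ((r - 1) / 2) α x)
noncomputable def rho (r α x : ℝ) : ℝ := -psi1 ((r - 1) / 2) α x / psi ((r - 1) / 2) α x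
noncomputable def qq (r v α β x : ℝ) : ℝ := v * (x * (pp r α β x * (β + rho r α x)))

lemma pp_eq_wfun (r α β x : ℝ) (hx : 0 < x) : pp r α β x = wfun ((r - 1) / 2) α β x := by
  unfold pp wfun psi
  rw [abs_of_pos hx]
  have : x ^ (r - 1) = x ^ ((r - 1) / 2) * x ^ ((r - 1) / 2) := by rw [← Real.rpow_add hx]; ring_nf
  have h0 : x ^ ((r - 1) / 2) ≠ 0 := by positivity
  rw [this, Real.rpow_neg hx.le]
  field_simp

lemma wfun_neg (ν α β x : ℝ) : wfun ν α β (-x) = wfun ν α (-β) x := by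
  unfold wfun
  rw [abs_neg]; ring_nf

lemma wfun_nonneg (ν α β x : ℝ) (hα : 0 < α) (hx : x ≠ 0) : 0 < wfun ν α β x := by
  have := besselK_pos ν (α * |x|) (by positivity)
  unfold wfun; positivity

section
variable {r v α β : ℝ}

lemma pp_pos (hα : 0 < α) {x : ℝ} (hx : 0 < x) : 0 < pp r α β x := by
  have := psi_pos ((r - 1) / 2) α x hα hx
  unfold pp; positivity

lemma pp_hasDerivAt (hα : 0 < α) {x : ℝ} (hx : 0 < x) :
    HasDerivAt (pp r α β) ((β + (r - 1) / x - rho r α x) * pp r α β x) x := by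
  have h0 := psi_pos ((r - 1) / 2) α x hα hx
  have h1 : HasDerivAt (fun x => Real.exp (β * x)) (Real.exp (β * x) * (β * 1)) x := ((hasDerivAt_id x).const_mul β).exp
  have h2 := Real.hasDerivAt_rpow_const (x := x) (p := r - 1) (Or.inl hx.ne')
  refine HasDerivAt.congr_deriv (f := pp r α β) (h1.mul (h2.mul (psi_hasDerivAt ((r - 1) / 2) α x hα hx))) ?_
  unfold pp rho
  rw [Real.rpow_sub_one hx.ne' (r - 1)]
  field_simp
  ring

lemma rho_hasDerivAt (hα : 0 < α) {x : ℝ} (hx : 0 < x) :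
    HasDerivAt (rho r α) (rho r α x ^ 2 - r / x * rho r α x - α ^ 2) x := by
  have h0 := psi_pos ((r - 1) / 2) α x hα hx
  refine HasDerivAt.congr_deriv (f := rho r α) ((psi1_hasDerivAt ((r - 1) / 2) α x hα hx).neg.div (psi_hasDerivAt ((r - 1) / 2) α x hα hx) h0.ne') ?_
  unfold rho
  rw [Pi.neg_apply]
  field_simp
  ring

lemma rho_eq (hα : 0 < α) {x : ℝ} (hx : 0 < x) :
    rho r α x = α * besselK ((r - 1) / 2 + 1) (α * x) / besselK ((r - 1) / 2) (α * x) := by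
  have := besselK_pos ((r - 1) / 2) (α * x) (by positivity)
  unfold rho psi psi1
  have : x ^ (-((r - 1) / 2)) ≠ 0 := by positivity
  field_simp

lemma rho_ge (hr : 0 < r) (hα : 0 < α) {x : ℝ} (hx : 0 < x) : α ≤ rho r α x := by
  have h0 := besselK_pos ((r - 1) / 2) (α * x) (by positivity)
  rw [rho_eq hα hx, le_div_iff₀ h0]
  have : besselK ((r - 1) / 2) (α * x) ≤ besselK ((r - 1) / 2 + 1) (α * x) := by
    apply besselK_mono _ _ (by positivity)
    rw [abs_of_pos (by linarith : 0 < (r - 1) / 2 + 1)]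
    exact abs_le.2 ⟨by linarith, by linarith⟩
  gcongr

lemma rho_le (hr : 0 < r) (hα : 0 < α) {x : ℝ} (hx : 0 < x) : rho r α x ≤ α + r / x := by
  have h0 := besselK_pos ((r - 1) / 2) (α * x) (by positivity)
  rw [rho_eq hα hx, div_le_iff₀ h0]
  have := besselK_upper ((r - 1) / 2) (α * x) (by linarith) (by positivity)
  have e : (α + r / x) * besselK ((r - 1) / 2) (α * x) = (α * x + r) * besselK ((r - 1) / 2) (α * x) / x := by field_simp
  rw [e, le_div_iff₀ hx]
  nlinarith

lemma brho_pos (P : PP r v α β) {x : ℝ} (hx : 0 < x) : 0 < β + rho r α x := by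
  have := rho_ge P.hr P.hα hx
  have := abs_lt.1 P.hβ
  linarith

lemma qq_pos (P : PP r v α β) {x : ℝ} (hx : 0 < x) : 0 < qq r v α β x := by
  have := brho_pos P hx
  have := pp_pos (r := r) (β := β) P.hα hx
  have := P.hv
  unfold qq; positivity

lemma qq_hasDerivAt (P : PP r v α β) {x : ℝ} (hx : 0 < x) :
    HasDerivAt (qq r v α β) (-(x - r * (β * v)) * pp r α β x) x := by
  have h1 := pp_hasDerivAt (r := r) (β := β) P.hα hx
  have h2 := rho_hasDerivAt (r := r) P.hα hx
  have := ((hasDerivAt_id x).mul (h1.mul (h2.const_add β))).const_mul v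
  refine HasDerivAt.congr_deriv (f := qq r v α β) this ?_
  simp only [Pi.mul_apply, id]
  have hv := P.hvab
  set p := pp r α β x
  set ρ := rho r α x
  have e : v * (1 * (p * (β + ρ)) + x * ((β + (r - 1) / x - ρ) * p * (β + ρ) + p * (ρ ^ 2 - r / x * ρ - α ^ 2)))
    = p * (r * (β * v) - x * (v * (α ^ 2 - β ^ 2))) := by
    field_simp
    ring
  rw [e, hv]; ring

lemma rpow_pp_tendsto (P : PP r v α β) (s : ℝ) : Tendsto (fun x => x ^ s * pp r α β x) atTop (nhds 0) := by
  have hab : 0 < α - β := by have := abs_lt.1 P.hβ; linarith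
  have hα := P.hα
  have h1 := (tendsto_rpow_mul_exp_neg_mul_atTop_nhds_zero (s + (r - 1) / 2) (α - β) hab).const_mul (Real.exp 1 * besselK ((r - 1) / 2) 1)
  rw [mul_zero] at h1
  refine squeeze_zero' ?_ ?_ h1
  · filter_upwards [eventually_gt_atTop 0] with x hx
    have := pp_pos (r := r) (β := β) P.hα hx
    positivity
  · filter_upwards [eventually_gt_atTop 0, eventually_ge_atTop (1 / α)] with x hx hx2
    have h3 : 1 ≤ α * x := by rw [div_le_iff₀ P.hα] at hx2; linarith
    have h2 := besselK_decay ((r - 1) / 2) (α * x) h3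
    rw [pp_eq_wfun r α β x hx]
    unfold wfun
    rw [abs_of_pos hx, Real.rpow_add hx]
    have e : Real.exp (-(α - β) * x) * Real.exp 1 = Real.exp (β * x) * Real.exp (-(α * x - 1)) := by
      rw [← Real.exp_add, ← Real.exp_add]; ring_nf
    calc x ^ s * (Real.exp (β * x) * x ^ ((r - 1) / 2) * besselK ((r - 1) / 2) (α * x))
        ≤ x ^ s * (Real.exp (β * x) * x ^ ((r - 1) / 2) * (Real.exp (-(α * x - 1)) * besselK ((r - 1) / 2) 1)) := by gcongr
      _ = x ^ s * x ^ ((r - 1) / 2) * besselK ((r - 1) / 2) 1 * (Real.exp (β * x) * Real.exp (-(α * x - 1))) := by ring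
      _ = _ := by rw [← e]; ring

lemma pow_pp_tendsto (P : PP r v α β) (n : ℕ) : Tendsto (fun x => x ^ n * pp r α β x) atTop (nhds 0) := by
  have := rpow_pp_tendsto P n
  simpa using this

lemma pow_qq_tendsto (P : PP r v α β) (n : ℕ) : Tendsto (fun x => x ^ n * qq r v α β x) atTop (nhds 0) := by
  have h := ((pow_pp_tendsto P (n + 1)).const_mul (v * (β + α + r)))
  rw [mul_zero] at h
  refine squeeze_zero' ?_ ?_ h
  · filter_upwards [eventually_gt_atTop 0] with x hx
    have := qq_pos P hx
    positivity
  · filter_upwards [eventually_ge_atTop 1] with x hx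
    have hx0 : 0 < x := by linarith
    have h2 := rho_le P.hr P.hα hx0
    have h3 : r / x ≤ r := div_le_self P.hr.le hx
    have h4 := pp_pos (r := r) (β := β) P.hα hx0
    have h5 := P.hv
    unfold qq
    calc x ^ n * (v * (x * (pp r α β x * (β + rho r α x)))) ≤ x ^ n * (v * (x * (pp r α β x * (β + α + r)))) := by
          have h6 : β + rho r α x ≤ β + α + r := by linarith
          gcongr
      _ = _ := by ring

lemma scale_tendsto (hα : 0 < α) : Tendsto (fun x : ℝ => α * x) (nhdsWithin 0 (Set.Ioi 0)) (nhdsWithin 0 (Set.Ioi 0)) := by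
  apply tendsto_nhdsWithin_of_tendsto_nhds_of_eventually_within
  · apply tendsto_nhdsWithin_of_tendsto_nhds
    have : Continuous fun x : ℝ => α * x := by fun_prop
    simpa using this.tendsto 0
  · filter_upwards [self_mem_nhdsWithin] with y hy
    exact mul_pos hα hy

lemma exp_tendsto_zero (β : ℝ) : Tendsto (fun x : ℝ => Real.exp (β * x)) (nhdsWithin 0 (Set.Ioi 0)) (nhds 1) := by
  apply tendsto_nhdsWithin_of_tendsto_nhds
  have : Continuous fun x : ℝ => Real.exp (β * x) := by fun_prop
  simpa using this.tendsto 0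

lemma xpp_tendsto_zero (P : PP r v α β) : Tendsto (fun x => x * pp r α β x) (nhdsWithin 0 (Set.Ioi 0)) (nhds 0) := by
  have hα := P.hα
  have h1 := (besselK_lim_b ((r - 1) / 2) (by linarith [P.hr])).comp (scale_tendsto hα)
  have h2 := ((exp_tendsto_zero β).mul h1).const_mul (α ^ (-((r - 1) / 2 + 1)))
  rw [mul_zero, mul_zero] at h2
  refine h2.congr' ?_
  filter_upwards [self_mem_nhdsWithin] with x hx
  have hx' : (0:ℝ) < x := hx
  rw [pp_eq_wfun r α β x hx]
  unfold wfun
  simp only [Function.comp]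
  rw [abs_of_pos hx', Real.mul_rpow hα.le hx'.le, Real.rpow_neg hα.le, Real.rpow_add_one hx'.ne']
  have : α ^ ((r - 1) / 2 + 1) ≠ 0 := by positivity
  field_simp

/-- the common limit of `qq` at zero -/
noncomputable def qlim (r v α : ℝ) : ℝ := v * (α * (α ^ (-((r - 1) / 2 + 1)) * (2 ^ ((r - 1) / 2 + 1) / 2 * Real.Gamma ((r - 1) / 2 + 1))))

lemma qq_tendsto_zero (P : PP r v α β) : Tendsto (qq r v α β) (nhdsWithin 0 (Set.Ioi 0)) (nhds (qlim r v α)) := by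
  have hα := P.hα
  have h1 := (besselK_lim_a ((r - 1) / 2 + 1) (by linarith [P.hr])).comp (scale_tendsto hα)
  have h2 := (((exp_tendsto_zero β).mul h1).const_mul (v * α * α ^ (-((r - 1) / 2 + 1)))).add
    ((xpp_tendsto_zero P).const_mul (v * β))
  have e : v * α * α ^ (-((r - 1) / 2 + 1)) * (1 * (2 ^ ((r - 1) / 2 + 1) / 2 * Real.Gamma ((r - 1) / 2 + 1))) + v * β * 0 = qlim r v α := by
    unfold qlim; ring
  rw [e] at h2
  refine h2.congr' ?_
  filter_upwards [self_mem_nhdsWithin] with x hx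
  have hx' : (0:ℝ) < x := hx
  unfold qq
  rw [pp_eq_wfun r α β x hx, rho_eq hα hx]
  unfold wfun
  have hK := besselK_pos ((r - 1) / 2) (α * x) (by positivity)
  simp only [Function.comp]
  rw [abs_of_pos hx', Real.mul_rpow hα.le hx'.le, Real.rpow_neg hα.le, Real.rpow_add_one hx'.ne']
  have : α ^ ((r - 1) / 2 + 1) ≠ 0 := by positivity
  field_simp
  ring

lemma pow_pp_integrable (P : PP r v α β) (n : ℕ) : IntegrableOn (fun x => x ^ n * pp r α β x) (Set.Ioi 0) := by
  have hβ := abs_lt.1 P.hβ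
  set ε := (α - β) / 2 with hε
  have hεp : 0 < ε := by rw [hε]; linarith
  have hw := (wfun_integral ((r - 1) / 2) α (β + ε) (by linarith [P.hr]) P.hα (abs_lt.2 ⟨by linarith, by rw [hε]; linarith⟩)).1
  have hw2 : IntegrableOn (fun x => (Nat.factorial n / ε ^ n) * wfun ((r - 1) / 2) α (β + ε) x) (Set.Ioi 0) :=
    (hw.const_mul _).integrableOn
  refine Integrable.mono' hw2 ?_ ?_
  · apply ContinuousOn.aestronglyMeasurable _ measurableSet_Ioi
    intro x hx
    exact ((continuousAt_id.pow n).mul (pp_hasDerivAt P.hα hx).continuousAt).continuousWithinAt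
  · rw [ae_restrict_iff' measurableSet_Ioi]
    refine Eventually.of_forall fun x hx => ?_
    have hx' : (0:ℝ) < x := hx
    have h4 := pp_pos (r := r) (β := β) P.hα hx
    rw [Real.norm_of_nonneg (by positivity), ← pp_eq_wfun r α (β + ε) x hx]
    have h5 : pp r α (β + ε) x = Real.exp (ε * x) * pp r α β x := by
      unfold pp; rw [add_mul, Real.exp_add]; ring
    have h6 := Real.pow_div_factorial_le_exp (x := ε * x) (by positivity) n
    rw [div_le_iff₀ (by positivity), mul_pow] at h6
    rw [h5, ← mul_assoc]
    gcongr
    rw [div_mul_eq_mul_div, le_div_iff₀ (by positivity)]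
    linarith

lemma mean_half (P : PP r v α β) : ∫ x in Set.Ioi (0:ℝ), (x - r * (β * v)) * pp r α β x = qlim r v α := by
  have hq0 : Tendsto (qq r v α β) atTop (nhds 0) := by simpa using pow_qq_tendsto P 0
  have hi : IntegrableOn (fun x => -(x - r * (β * v)) * pp r α β x) (Set.Ioi 0) := by
    have h1 : IntegrableOn (fun x => x * pp r α β x) (Set.Ioi 0) := by simpa using pow_pp_integrable P 1
    have h2 : IntegrableOn (fun x => pp r α β x) (Set.Ioi 0) := by simpa using pow_pp_integrable P 0
    have := (h2.const_mul (r * (β * v))).sub h1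
    refine IntegrableOn.congr_fun this ?_ measurableSet_Ioi
    intro x _
    simp only [Pi.sub_apply]; ring
  have := integral_Ioi_lim _ _ _ _ (fun x hx => qq_hasDerivAt P hx) hi (qq_tendsto_zero P) hq0
  have e : (fun x => (x - r * (β * v)) * pp r α β x) = fun x => -(-(x - r * (β * v)) * pp r α β x) := by ext; ring
  rw [e, integral_neg, this]; ring

lemma var_half (P : PP r v α β) :
    ∫ x in Set.Ioi (0:ℝ), pp r α β x * (v * r + (r + 2) * (β * v) * x - x ^ 2) = 0 := by
  have h0 : IntegrableOn (fun x => pp r α β x) (Set.Ioi 0) := by simpa using pow_pp_integrable P 0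
  have h1 : IntegrableOn (fun x => x * pp r α β x) (Set.Ioi 0) := by simpa using pow_pp_integrable P 1
  have h2 := pow_pp_integrable P 2
  have hi : IntegrableOn (fun x => pp r α β x * (v * r + (r + 2) * (β * v) * x - x ^ 2)) (Set.Ioi 0) := by
    refine IntegrableOn.congr_fun (((h0.const_mul (v * r)).add (h1.const_mul ((r + 2) * (β * v)))).sub h2) ?_ measurableSet_Ioi
    intro x _
    simp only [Pi.sub_apply, Pi.add_apply]; ring
  have := integral_Ioi_lim (fun x => v * (x * pp r α β x) + x * qq r v α β x) _ 0 0 ?_ hi ?_ ?_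
  · rw [this]; ring
  · intro x hx
    have d1 := pp_hasDerivAt (r := r) (β := β) P.hα hx
    have d2 := qq_hasDerivAt P hx
    have d := (((hasDerivAt_id x).mul d1).const_mul v).add ((hasDerivAt_id x).mul d2)
    refine HasDerivAt.congr_deriv d ?_
    simp only [id]
    unfold qq
    field_simp
    ring
  · have t1 := (xpp_tendsto_zero P).const_mul v
    have t2 : Tendsto (fun x : ℝ => x) (nhdsWithin 0 (Set.Ioi 0)) (nhds 0) := tendsto_nhdsWithin_of_tendsto_nhds tendsto_id
    have := t1.add (t2.mul (qq_tendsto_zero P))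
    simpa using this
  · have t1 := (pow_pp_tendsto P 1).const_mul v
    have := t1.add (pow_qq_tendsto P 1)
    simpa using this

end


section
variable {r v α β : ℝ}

lemma full_split (g : ℝ → ℝ) (h1 : IntegrableOn (fun x => g x * pp r α β x) (Set.Ioi 0))
    (h2 : IntegrableOn (fun x => g (-x) * pp r α (-β) x) (Set.Ioi 0)) :
    Integrable (fun x => g x * wfun ((r - 1) / 2) α β x) ∧
    ∫ x, g x * wfun ((r - 1) / 2) α β x = (∫ x in Set.Ioi (0:ℝ), g x * pp r α β x) + ∫ x in Set.Ioi (0:ℝ), g (-x) * pp r α (-β) x := by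
  have e1 : Set.EqOn (fun x => g x * pp r α β x) (fun x => g x * wfun ((r - 1) / 2) α β x) (Set.Ioi 0) := by
    intro x hx; simp only; rw [pp_eq_wfun r α β x hx]
  have e2 : Set.EqOn (fun x => g (-x) * pp r α (-β) x) (fun x => g (-x) * wfun ((r - 1) / 2) α β (-x)) (Set.Ioi 0) := by
    intro x hx; simp only; rw [pp_eq_wfun r α (-β) x hx, wfun_neg]
  have i1 := h1.congr_fun e1 measurableSet_Ioi
  have i2 := integrableOn_Iic_of_neg (fun x => g x * wfun ((r - 1) / 2) α β x) (h2.congr_fun e2 measurableSet_Ioi)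
  constructor
  · rw [← integrableOn_univ, ← Set.Iic_union_Ioi (a := (0:ℝ))]
    exact i2.union i1
  · rw [← intervalIntegral.integral_Iic_add_Ioi i2 i1, setIntegral_congr_fun measurableSet_Ioi e1, setIntegral_congr_fun measurableSet_Ioi e2]
    have := integral_comp_neg_Ioi (0:ℝ) (fun x => g x * wfun ((r - 1) / 2) α β x)
    rw [this, neg_zero, add_comm]

lemma quad_integrable (P : PP r v α β) (a b c : ℝ) : IntegrableOn (fun x => (a + b * x + c * x ^ 2) * pp r α β x) (Set.Ioi 0) := by
  have h0 : IntegrableOn (fun x => pp r α β x) (Set.Ioi 0) := by simpa using pow_pp_integrable P 0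
  have h1 : IntegrableOn (fun x => x * pp r α β x) (Set.Ioi 0) := by simpa using pow_pp_integrable P 1
  have h2 := pow_pp_integrable P 2
  refine IntegrableOn.congr_fun (((h0.const_mul a).add (h1.const_mul b)).add (h2.const_mul c)) ?_ measurableSet_Ioi
  intro x _
  simp only [Pi.add_apply]; ring

lemma quad_full (P : PP r v α β) (a b c : ℝ) :
    Integrable (fun x => (a + b * x + c * x ^ 2) * wfun ((r - 1) / 2) α β x) ∧
    ∫ x, (a + b * x + c * x ^ 2) * wfun ((r - 1) / 2) α β x = (∫ x in Set.Ioi (0:ℝ), (a + b * x + c * x ^ 2) * pp r α β x)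
      + ∫ x in Set.Ioi (0:ℝ), (a + (-b) * x + c * x ^ 2) * pp r α (-β) x := by
  have h2 := quad_integrable P.neg a (-b) c
  have e : (fun x : ℝ => (a + (-b) * x + c * x ^ 2) * pp r α (-β) x) = fun x => (a + b * (-x) + c * (-x) ^ 2) * pp r α (-β) x := by
    ext x; ring
  rw [e] at h2 ⊢
  exact full_split (fun x => a + b * x + c * x ^ 2) (quad_integrable P a b c) h2

lemma mean_full (P : PP r v α β) : ∫ x, (x - r * (β * v)) * wfun ((r - 1) / 2) α β x = 0 := by
  have h := (quad_full P (-(r * (β * v))) 1 0).2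
  have m1 := mean_half P
  have m2 := mean_half P.neg
  have e0 : (fun x : ℝ => (x - r * (β * v)) * wfun ((r - 1) / 2) α β x) = fun x => (-(r * (β * v)) + 1 * x + 0 * x ^ 2) * wfun ((r - 1) / 2) α β x := by
    ext x; ring
  have e1 : (fun x : ℝ => (-(r * (β * v)) + 1 * x + 0 * x ^ 2) * pp r α β x) = fun x => (x - r * (β * v)) * pp r α β x := by
    ext x; ring
  have e2 : (fun x : ℝ => (-(r * (β * v)) + -1 * x + 0 * x ^ 2) * pp r α (-β) x) = fun x => -((x - r * (-β * v)) * pp r α (-β) x) := by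
    ext x; ring
  rw [e0, h, e1, e2, integral_neg, m1, m2]; ring

lemma var_full (P : PP r v α β) : ∫ x, (x - r * (β * v)) ^ 2 * wfun ((r - 1) / 2) α β x =
    (v * r + 2 * r * (β * v) ^ 2) * ∫ x, wfun ((r - 1) / 2) α β x := by
  have h := (quad_full P (v * r) ((r + 2) * (β * v)) (-1)).2
  have m1 := var_half P
  have m2 := var_half P.neg
  have e1 : (fun x : ℝ => (v * r + (r + 2) * (β * v) * x + -1 * x ^ 2) * pp r α β x) = fun x => pp r α β x * (v * r + (r + 2) * (β * v) * x - x ^ 2) := by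
    ext x; ring
  have e2 : (fun x : ℝ => (v * r + -((r + 2) * (β * v)) * x + -1 * x ^ 2) * pp r α (-β) x) = fun x => pp r α (-β) x * (v * r + (r + 2) * (-β * v) * x - x ^ 2) := by
    ext x; ring
  rw [e1, e2, m1, m2, add_zero] at h
  have hm := mean_full P
  have i0 : Integrable (wfun ((r - 1) / 2) α β) := by
    have := (quad_full P 1 0 0).1
    simpa using this
  have i1 : Integrable (fun x => (x - r * (β * v)) * wfun ((r - 1) / 2) α β x) := by
    have := (quad_full P (-(r * (β * v))) 1 0).1
    refine this.congr (Eventually.of_forall fun x => ?_)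
    simp only; ring
  have i2 := (quad_full P (v * r) ((r + 2) * (β * v)) (-1)).1
  have e : (fun x => (x - r * (β * v)) ^ 2 * wfun ((r - 1) / 2) α β x) =
      fun x => ((v * r + 2 * r * (β * v) ^ 2) * wfun ((r - 1) / 2) α β x - (r - 2) * (β * v) * ((x - r * (β * v)) * wfun ((r - 1) / 2) α β x))
        - (v * r + (r + 2) * (β * v) * x + -1 * x ^ 2) * wfun ((r - 1) / 2) α β x := by
    ext x; ring
  have i01 : Integrable (fun x => (v * r + 2 * r * (β * v) ^ 2) * wfun ((r - 1) / 2) α β x - (r - 2) * (β * v) * ((x - r * (β * v)) * wfun ((r - 1) / 2) α β x)) :=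
    (i0.const_mul _).sub (i1.const_mul _)
  rw [e, integral_sub i01 i2, integral_sub (i0.const_mul _) (i1.const_mul _), h, integral_const_mul, integral_const_mul, hm]
  ring

lemma PP_of (r θ σ : ℝ) (hr : 0 < r) (hσ : 0 < σ) : PP r (σ ^ 2) (Real.sqrt (θ ^ 2 + σ ^ 2) / σ ^ 2) (θ / σ ^ 2) := by
  have hD : 0 < θ ^ 2 + σ ^ 2 := by positivity
  refine ⟨hr, by positivity, by positivity, ?_, ?_⟩
  · rw [abs_div, abs_of_pos (by positivity : 0 < σ ^ 2)]
    gcongr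
    rw [← Real.sqrt_sq_eq_abs]
    apply Real.sqrt_lt_sqrt (by positivity)
    nlinarith [sq_pos_of_pos hσ]
  · rw [div_pow, div_pow, Real.sq_sqrt hD.le]
    field_simp
    ring

lemma vg_eq (r θ σ x : ℝ) (hσ : 0 < σ) : vgDensity r θ σ x =
    ((σ * Real.sqrt Real.pi * Real.Gamma (r / 2))⁻¹ * (1 / (2 * Real.sqrt (θ ^ 2 + σ ^ 2))) ^ ((r - 1) / 2)) *
    wfun ((r - 1) / 2) (Real.sqrt (θ ^ 2 + σ ^ 2) / σ ^ 2) (θ / σ ^ 2) x := by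
  unfold vgDensity wfun
  rw [show |x| / (2 * Real.sqrt (θ ^ 2 + σ ^ 2)) = 1 / (2 * Real.sqrt (θ ^ 2 + σ ^ 2)) * |x| by ring,
    Real.mul_rpow (by positivity) (abs_nonneg x), show θ * x / σ ^ 2 = θ / σ ^ 2 * x by ring,
    show Real.sqrt (θ ^ 2 + σ ^ 2) * |x| / σ ^ 2 = Real.sqrt (θ ^ 2 + σ ^ 2) / σ ^ 2 * |x| by ring]
  ring

lemma vg_norm (r θ σ : ℝ) (hr : 0 < r) (hσ : 0 < σ) :
    ((σ * Real.sqrt Real.pi * Real.Gamma (r / 2))⁻¹ * (1 / (2 * Real.sqrt (θ ^ 2 + σ ^ 2))) ^ ((r - 1) / 2)) *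
      ∫ x, wfun ((r - 1) / 2) (Real.sqrt (θ ^ 2 + σ ^ 2) / σ ^ 2) (θ / σ ^ 2) x = 1 := by
  have P := PP_of r θ σ hr hσ
  have hDp : 0 < θ ^ 2 + σ ^ 2 := by positivity
  set D := Real.sqrt (θ ^ 2 + σ ^ 2) with hD
  have hD0 : 0 < D := Real.sqrt_pos.2 hDp
  have hD2 : D ^ 2 = θ ^ 2 + σ ^ 2 := Real.sq_sqrt hDp.le
  rw [(wfun_integral ((r - 1) / 2) _ _ (by linarith) P.hα P.hβ).2]
  have e1 : 1 / (1 - (θ / σ ^ 2) ^ 2 / (D / σ ^ 2) ^ 2) = (D / σ) * (D / σ) := by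
    have : 1 - (θ / σ ^ 2) ^ 2 / (D / σ ^ 2) ^ 2 = σ ^ 2 / D ^ 2 := by
      field_simp
      rw [hD2]; ring
    rw [this]; field_simp
  have e2 : (r - 1) / 2 + 1 / 2 = r / 2 := by ring
  have hds : 0 < D / σ := by positivity
  have e3 : (D / σ * (D / σ)) ^ (r / 2) = (D / σ) ^ ((r - 1) / 2) * (D / σ) ^ ((r - 1) / 2) * (D / σ) := by
    rw [Real.mul_rpow hds.le hds.le, ← Real.rpow_add hds, ← Real.rpow_add hds, ← Real.rpow_add_one hds.ne']
    congr 1; ring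
  rw [e1, e2, e3]
  have e4 : (1 / (2 * D)) ^ ((r - 1) / 2) * (2 / (D / σ ^ 2)) ^ ((r - 1) / 2) * ((D / σ) ^ ((r - 1) / 2) * (D / σ) ^ ((r - 1) / 2)) = 1 := by
    rw [← Real.mul_rpow (by positivity) (by positivity), ← Real.mul_rpow (by positivity) (by positivity), ← Real.mul_rpow (by positivity) (by positivity)]
    have : 1 / (2 * D) * (2 / (D / σ ^ 2)) * (D / σ * (D / σ)) = 1 := by field_simp
    rw [this, Real.one_rpow]
  have hG : 0 < Real.Gamma (r / 2) := Real.Gamma_pos_of_pos (by linarith)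
  have hpi : 0 < Real.sqrt Real.pi := Real.sqrt_pos.2 Real.pi_pos
  calc _ = ((1 / (2 * D)) ^ ((r - 1) / 2) * (2 / (D / σ ^ 2)) ^ ((r - 1) / 2) * ((D / σ) ^ ((r - 1) / 2) * (D / σ) ^ ((r - 1) / 2))) *
        ((σ * Real.sqrt Real.pi * Real.Gamma (r / 2))⁻¹ * (Real.sqrt Real.pi / (D / σ ^ 2) * (D / σ) * Real.Gamma (r / 2))) := by ring
    _ = 1 := by rw [e4]; field_simp

end


section
variable {r v α β L : ℝ} {ht : ℝ → ℝ}

lemma wfun_nn (ν α β x : ℝ) : 0 ≤ wfun ν α β x := by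
  have : 0 ≤ besselK ν (α * |x|) := by
    unfold besselK
    refine integral_nonneg fun t => ?_
    have := Real.cosh_pos (ν * t)
    simp only [Pi.zero_apply]
    positivity
  unfold wfun; positivity

lemma lip_cont {h : ℝ → ℝ} {L : ℝ} (hlip : ∀ a b, |h a - h b| ≤ L * |a - b|) : Continuous h := by
  have : LipschitzWith (Real.toNNReal L) h := by
    refine LipschitzWith.of_dist_le_mul fun a b => ?_
    rw [Real.dist_eq, Real.dist_eq]
    refine (hlip a b).trans ?_
    gcongr
    exact Real.le_coe_toNNReal L
  exact this.continuous

lemma w_int (P : PP r v α β) : Integrable (wfun ((r - 1) / 2) α β) := by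
  have := (quad_full P 1 0 0).1
  simpa using this

lemma w_pos (P : PP r v α β) : 0 < ∫ x, wfun ((r - 1) / 2) α β x := by
  rw [integral_pos_iff_support_of_nonneg (fun x => wfun_nn _ _ _ x) (w_int P)]
  have : Set.Ioi (0:ℝ) ⊆ Function.support (wfun ((r - 1) / 2) α β) := by
    intro x hx
    exact (wfun_nonneg _ _ _ x P.hα (ne_of_gt hx)).ne'
  refine lt_of_lt_of_le ?_ (measure_mono this)
  simp

lemma lip_integrable (P : PP r v α β) {h : ℝ → ℝ} (hL : 0 ≤ L) (hlip : ∀ a b, |h a - h b| ≤ L * |a - b|) :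
    Integrable (fun x => h x * wfun ((r - 1) / 2) α β x) := by
  have hq := (quad_full P (|h 0| + L) 0 L).1
  refine hq.mono' ((lip_cont hlip).aestronglyMeasurable.mul (w_int P).aestronglyMeasurable) ?_
  refine Eventually.of_forall fun x => ?_
  have hw := wfun_nn ((r - 1) / 2) α β x
  rw [Real.norm_eq_abs, abs_mul, abs_of_nonneg hw]
  refine mul_le_mul_of_nonneg_right ?_ hw
  have h1 := hlip x 0
  rw [sub_zero] at h1
  have h2 : |h x| ≤ |h x - h 0| + |h 0| := by
    have := abs_add_le (h x - h 0) (h 0); simpa using this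
  have h3 : L * |x| ≤ L * (1 + x ^ 2) := by
    gcongr
    have := sq_abs x
    nlinarith [sq_nonneg (|x| - 1), abs_nonneg x]
  linarith

/-- standing assumptions on the centred test function -/
structure HH (r v α β L : ℝ) (ht : ℝ → ℝ) : Prop where
  P : PP r v α β
  hL : 0 ≤ L
  lip : ∀ a b, |ht a - ht b| ≤ L * |a - b|
  mean : ∫ x, ht x * wfun ((r - 1) / 2) α β x = 0

lemma HH.cont (H : HH r v α β L ht) : Continuous ht := lip_cont H.lip

lemma HH.int (H : HH r v α β L ht) : Integrable (fun x => ht x * wfun ((r - 1) / 2) α β x) := lip_integrable H.P H.hL H.lip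

lemma HH.negh (H : HH r v α β L ht) : HH r v α β L (fun x => - ht x) where
  P := H.P
  hL := H.hL
  lip := fun a b => by
    have := H.lip b a
    rw [abs_sub_comm b a] at this
    rwa [neg_sub_neg]
  mean := by
    have := H.mean
    simp only [neg_mul]
    rw [integral_neg, this, neg_zero]

lemma HH.refl (H : HH r v α β L ht) : HH r v α (-β) L (fun x => ht (-x)) where
  P := H.P.neg
  hL := H.hL
  lip := fun a b => by
    have := H.lip (-a) (-b)
    rw [neg_sub_neg, abs_sub_comm b a] at this
    exact this
  mean := by
    have := integral_neg_eq_self (fun x => ht x * wfun ((r - 1) / 2) α β x) volume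
    rw [H.mean] at this
    rw [← this]
    congr 1; ext x
    rw [wfun_neg]

lemma quad_val (P : PP r v α β) (a b c : ℝ) :
    Integrable (fun x => (a + b * (x - r * (β * v)) + c * (x - r * (β * v)) ^ 2) * wfun ((r - 1) / 2) α β x) ∧
    ∫ x, (a + b * (x - r * (β * v)) + c * (x - r * (β * v)) ^ 2) * wfun ((r - 1) / 2) α β x =
     (a + c * (v * r + 2 * r * (β * v) ^ 2)) * ∫ x, wfun ((r - 1) / 2) α β x := by
  have i0 := w_int P
  have i1 : Integrable (fun x => (x - r * (β * v)) * wfun ((r - 1) / 2) α β x) := by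
    have := (quad_full P (-(r * (β * v))) 1 0).1
    refine this.congr (Eventually.of_forall fun x => ?_)
    simp only; ring
  have i2 : Integrable (fun x => (x - r * (β * v)) ^ 2 * wfun ((r - 1) / 2) α β x) := by
    have := (quad_full P ((r * (β * v)) ^ 2) (-2 * (r * (β * v))) 1).1
    refine this.congr (Eventually.of_forall fun x => ?_)
    simp only; ring
  have e : (fun x => (a + b * (x - r * (β * v)) + c * (x - r * (β * v)) ^ 2) * wfun ((r - 1) / 2) α β x) =
      fun x => (a * wfun ((r - 1) / 2) α β x + b * ((x - r * (β * v)) * wfun ((r - 1) / 2) α β x)) +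
        c * ((x - r * (β * v)) ^ 2 * wfun ((r - 1) / 2) α β x) := by
    ext x; ring
  have i01 : Integrable (fun x => a * wfun ((r - 1) / 2) α β x + b * ((x - r * (β * v)) * wfun ((r - 1) / 2) α β x)) :=
    (i0.const_mul a).add (i1.const_mul b)
  rw [e]
  refine ⟨i01.add (i2.const_mul c), ?_⟩
  rw [integral_add i01 (i2.const_mul c), integral_add (i0.const_mul a) (i1.const_mul b), integral_const_mul, integral_const_mul,
    integral_const_mul, mean_full P, var_full P]
  ring

lemma sdev_pos (P : PP r v α β) : 0 < v * r + 2 * r * (β * v) ^ 2 := by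
  have := P.hr; have := P.hv; positivity

lemma HH.bd (H : HH r v α β L ht) (x : ℝ) :
    |ht x| ≤ L * (|x - r * (β * v)| + √(v * r + 2 * r * (β * v) ^ 2)) := by
  have hs := sdev_pos H.P
  set s := √(v * r + 2 * r * (β * v) ^ 2) with hsd
  have hs0 : 0 < s := Real.sqrt_pos.2 hs
  have hs2 : s ^ 2 = v * r + 2 * r * (β * v) ^ 2 := Real.sq_sqrt hs.le
  have hW := w_pos H.P
  have i0 := w_int H.P
  obtain ⟨j, hj⟩ := quad_val H.P (L * (|x - r * (β * v)| + s / 2)) 0 (L / (2 * s))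
  have e1 : ht x * ∫ t, wfun ((r - 1) / 2) α β t = ∫ t, (ht x - ht t) * wfun ((r - 1) / 2) α β t := by
    simp only [sub_mul]
    rw [integral_sub (i0.const_mul _) H.int, H.mean, integral_const_mul, sub_zero]
  have e2 : |ht x * ∫ t, wfun ((r - 1) / 2) α β t| ≤ ∫ t, (L * (|x - r * (β * v)| + s / 2) + 0 * (t - r * (β * v)) + L / (2 * s) * (t - r * (β * v)) ^ 2) * wfun ((r - 1) / 2) α β t := by
    rw [e1, ← Real.norm_eq_abs]
    refine norm_integral_le_of_norm_le j (Eventually.of_forall fun t => ?_)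
    have hw := wfun_nn ((r - 1) / 2) α β t
    rw [Real.norm_eq_abs, abs_mul, abs_of_nonneg hw]
    refine mul_le_mul_of_nonneg_right ?_ hw
    refine (H.lip x t).trans ?_
    have h1 : |x - t| ≤ |x - r * (β * v)| + |t - r * (β * v)| := by
      have := abs_sub (x - r * (β * v)) (t - r * (β * v))
      simpa using this
    have h2 : |t - r * (β * v)| ≤ s / 2 + (t - r * (β * v)) ^ 2 / (2 * s) := by
      rw [← sq_abs (t - r * (β * v))]
      set y := |t - r * (β * v)|
      have : s / 2 + y ^ 2 / (2 * s) - y = (y - s) ^ 2 / (2 * s) := by field_simp; ring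
      have : 0 ≤ (y - s) ^ 2 / (2 * s) := by positivity
      linarith
    calc L * |x - t| ≤ L * (|x - r * (β * v)| + (s / 2 + (t - r * (β * v)) ^ 2 / (2 * s))) :=
          mul_le_mul_of_nonneg_left (by linarith) H.hL
      _ = _ := by ring
  rw [hj, abs_mul, abs_of_pos hW, ← hs2] at e2
  have e3 := le_of_mul_le_mul_right e2 hW
  refine e3.trans (le_of_eq ?_)
  field_simp
  ring

lemma tail_nonneg {w k : ℝ → ℝ} (hw : ∀ x, 0 ≤ w x) (hk : Monotone k) (hi : Integrable (fun x => k x * w x))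
    (h0 : ∫ x, k x * w x = 0) (x : ℝ) : 0 ≤ ∫ t in Set.Ioi x, k t * w t := by
  rcases le_or_gt 0 (k x) with h | h
  · refine setIntegral_nonneg measurableSet_Ioi fun t ht => ?_
    exact mul_nonneg (h.trans (hk (le_of_lt ht))) (hw t)
  · have h1 : ∫ t in Set.Iic x, k t * w t ≤ 0 := by
      refine setIntegral_nonpos measurableSet_Iic fun t ht => ?_
      exact mul_nonpos_of_nonpos_of_nonneg ((hk ht).trans h.le) (hw t)
    have := intervalIntegral.integral_Iic_add_Ioi (b := x) (f := fun t => k t * w t) hi.integrableOn hi.integrableOn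
    rw [h0] at this
    linarith

lemma qq_tail (P : PP r v α β) {x : ℝ} (hx : 0 < x) :
    ∫ t in Set.Ioi x, (t - r * (β * v)) * wfun ((r - 1) / 2) α β t = qq r v α β x := by
  have hq0 : Tendsto (qq r v α β) atTop (nhds 0) := by simpa using pow_qq_tendsto P 0
  have hi : IntegrableOn (fun t => -(t - r * (β * v)) * pp r α β t) (Set.Ioi x) := by
    have := (quad_integrable P (r * (β * v)) (-1) 0).mono_set (Set.Ioi_subset_Ioi hx.le)
    refine this.congr_fun ?_ measurableSet_Ioi
    intro t _; simp only; ring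
  have := integral_Ioi_of_hasDerivAt_of_tendsto' (a := x) (f := qq r v α β) (f' := fun t => -(t - r * (β * v)) * pp r α β t)
    (fun t ht => qq_hasDerivAt P (lt_of_lt_of_le hx ht)) hi hq0
  have e : ∫ t in Set.Ioi x, (t - r * (β * v)) * wfun ((r - 1) / 2) α β t = - ∫ t in Set.Ioi x, -(t - r * (β * v)) * pp r α β t := by
    rw [← integral_neg]
    refine setIntegral_congr_fun measurableSet_Ioi fun t ht => ?_
    rw [pp_eq_wfun r α β t (hx.trans ht)]; ring
  rw [e, this]; ring

lemma HH.tail1 (H : HH r v α β L ht) {x : ℝ} (hx : 0 < x) :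
    - (L * qq r v α β x) ≤ ∫ t in Set.Ioi x, ht t * wfun ((r - 1) / 2) α β t := by
  have i1 : Integrable (fun x => (x - r * (β * v)) * wfun ((r - 1) / 2) α β x) := by
    have := (quad_val H.P 0 1 0).1
    refine this.congr (Eventually.of_forall fun x => ?_)
    simp only; ring
  have i2 : Integrable (fun t => (L * (t - r * (β * v)) + ht t) * wfun ((r - 1) / 2) α β t) := by
    refine ((i1.const_mul L).add H.int).congr (Eventually.of_forall fun x => ?_)
    simp only [Pi.add_apply]; ring
  have e : (fun t => (L * (t - r * (β * v)) + ht t) * wfun ((r - 1) / 2) α β t) = fun t => L * ((t - r * (β * v)) * wfun ((r - 1) / 2) α β t) + ht t * wfun ((r - 1) / 2) α β t := by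
    ext t; ring
  have := tail_nonneg (w := wfun ((r - 1) / 2) α β) (k := fun t => L * (t - r * (β * v)) + ht t) (wfun_nn _ _ _) ?_ i2 ?_ x
  · rw [e, integral_add (i1.const_mul L).integrableOn H.int.integrableOn, integral_const_mul, qq_tail H.P hx] at this
    linarith
  · intro a b hab
    have h1 := H.lip a b
    rw [abs_sub_comm a b, abs_of_nonneg (sub_nonneg.2 hab)] at h1
    have := le_abs_self (ht a - ht b)
    simp only
    nlinarith
  · rw [e, integral_add (i1.const_mul L) H.int, integral_const_mul, H.mean, mean_full H.P]; ring

end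


section
variable {r v α β L : ℝ} {ht : ℝ → ℝ}

noncomputable def gI (r α β : ℝ) (ht : ℝ → ℝ) (t : ℝ) : ℝ := t ^ (r - 1) * (Real.exp (β * t) * phi ((r - 1) / 2) α t * ht t)
noncomputable def JI (r α β : ℝ) (ht : ℝ → ℝ) (x : ℝ) : ℝ := ∫ t in (0:ℝ)..x, gI r α β ht t
noncomputable def JJ (r α β : ℝ) (ht : ℝ → ℝ) (x : ℝ) : ℝ := ∫ t in Set.Ioi x, ht t * wfun ((r - 1) / 2) α β t
noncomputable def sf (r v α β : ℝ) (ht : ℝ → ℝ) (x : ℝ) : ℝ :=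
  -(Real.exp (-β * x) / v * (psi ((r - 1) / 2) α x * JI r α β ht x + phi ((r - 1) / 2) α x * JJ r α β ht x))
noncomputable def sf1 (r v α β : ℝ) (ht : ℝ → ℝ) (x : ℝ) : ℝ :=
  -β * sf r v α β ht x - Real.exp (-β * x) / v * (psi1 ((r - 1) / 2) α x * JI r α β ht x + phi1 ((r - 1) / 2) α x * JJ r α β ht x)
noncomputable def sw (r v α β : ℝ) (ht : ℝ → ℝ) (x : ℝ) : ℝ :=
  (x - r * (β * v)) * sf r v α β ht x - (v * r + 2 * (β * v) * x) * sf1 r v α β ht x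
noncomputable def sf2 (r v α β : ℝ) (ht : ℝ → ℝ) (x : ℝ) : ℝ := (ht x + sw r v α β ht x) / (v * x)

lemma HH.nu (H : HH r v α β L ht) : -(1/2) < (r - 1) / 2 := by have := H.P.hr; linarith

lemma phi_cont (ν α : ℝ) (hν : -(1/2) < ν) : Continuous (phi ν α) :=
  continuous_iff_continuousAt.2 fun x => (phi_hasDerivAt ν α x hν).continuousAt

lemma HH.gI_int (H : HH r v α β L ht) (a b : ℝ) : IntervalIntegrable (gI r α β ht) volume a b := by
  have h1 := intervalIntegral.intervalIntegrable_rpow' (a := a) (b := b) (r := r - 1) (by linarith [H.P.hr])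
  refine h1.mul_continuousOn (Continuous.continuousOn ?_)
  have := H.cont
  have := phi_cont ((r - 1) / 2) α H.nu
  fun_prop

lemma HH.JI_cont (H : HH r v α β L ht) : Continuous (JI r α β ht) :=
  intervalIntegral.continuous_primitive H.gI_int 0

lemma HH.JI_deriv (H : HH r v α β L ht) {x : ℝ} (hx : 0 < x) : HasDerivAt (JI r α β ht) (gI r α β ht x) x := by
  have hc : ContinuousOn (gI r α β ht) (Set.Ioi 0) := by
    have h1 := H.cont
    have h2 := phi_cont ((r - 1) / 2) α H.nu
    unfold gI
    refine ContinuousOn.mul ?_ (Continuous.continuousOn (by fun_prop))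
    intro t ht
    exact (Real.continuousAt_rpow_const t (r - 1) (Or.inl (ne_of_gt ht))).continuousWithinAt
  exact intervalIntegral.integral_hasDerivAt_right (H.gI_int 0 x)
    (hc.stronglyMeasurableAtFilter isOpen_Ioi x hx) (hc.continuousAt (Ioi_mem_nhds hx))

lemma HH.JJ_deriv (H : HH r v α β L ht) {x : ℝ} (hx : 0 < x) : HasDerivAt (JJ r α β ht) (-(ht x * pp r α β x)) x := by
  set G : ℝ → ℝ := fun t => ht t * wfun ((r - 1) / 2) α β t with hG
  have hi := H.int
  have hc : ContinuousOn G (Set.Ioi 0) := by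
    have : ContinuousOn (fun t => ht t * pp r α β t) (Set.Ioi 0) := by
      refine H.cont.continuousOn.mul ?_
      intro t ht
      exact (pp_hasDerivAt H.P.hα ht).continuousAt.continuousWithinAt
    refine this.congr ?_
    intro t ht
    simp only [hG]
    rw [pp_eq_wfun r α β t ht]
  have e : JJ r α β ht = fun y => (∫ t in Set.Ioi (0:ℝ), G t) - ∫ t in (0:ℝ)..y, G t := by
    ext y
    have := intervalIntegral.integral_interval_add_Ioi (a := 0) (b := y) (f := G) hi.integrableOn hi.integrableOn
    rw [← this]; unfold JJ; ring
  have hd := intervalIntegral.integral_hasDerivAt_right (f := G) (a := 0) (b := x) hi.intervalIntegrable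
    (hc.stronglyMeasurableAtFilter isOpen_Ioi x hx) (hc.continuousAt (Ioi_mem_nhds hx))
  rw [e]
  refine (hd.const_sub _).congr_deriv ?_
  simp only [hG]
  rw [pp_eq_wfun r α β x hx]

lemma HH.JJ_bound (H : HH r v α β L ht) {x : ℝ} (hx : 0 < x) : |JJ r α β ht x| ≤ L * qq r v α β x := by
  have h1 := H.tail1 hx
  have h2 := H.negh.tail1 hx
  simp only [neg_mul] at h2
  rw [integral_neg] at h2
  rw [abs_le]; unfold JJ
  constructor <;> linarith

lemma exp_neg_deriv (β x : ℝ) : HasDerivAt (fun x => Real.exp (-β * x)) (-β * Real.exp (-β * x)) x := by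
  have h1 : HasDerivAt (fun x => Real.exp (-β * x)) (Real.exp (-β * x) * (-β * 1)) x := ((hasDerivAt_id x).const_mul (-β)).exp
  refine h1.congr_deriv ?_
  ring

lemma HH.sf_deriv (H : HH r v α β L ht) {x : ℝ} (hx : 0 < x) : HasDerivAt (sf r v α β ht) (sf1 r v α β ht x) x := by
  have h0 := exp_neg_deriv β x
  have h1 := psi_hasDerivAt ((r - 1) / 2) α x H.P.hα hx
  have h2 := phi_hasDerivAt ((r - 1) / 2) α x H.nu
  have h3 := H.JI_deriv hx
  have h4 := H.JJ_deriv hx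
  have hv := H.P.hv
  refine HasDerivAt.congr_deriv (f := sf r v α β ht) ((h0.div_const v).mul ((h1.mul h3).add (h2.mul h4))).neg ?_
  simp only [sf1, sf, Pi.add_apply, Pi.mul_apply, gI, pp]
  field_simp
  ring

lemma HH.wron (H : HH r v α β L ht) {x : ℝ} (hx : 0 < x) :
    x ^ r * (phi1 ((r - 1) / 2) α x * psi ((r - 1) / 2) α x - phi ((r - 1) / 2) α x * psi1 ((r - 1) / 2) α x) = 1 := by
  have := wronskian ((r - 1) / 2) α x H.nu H.P.hα hx
  rwa [show 2 * ((r - 1) / 2) + 1 = r by ring] at this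

lemma HH.sf1_deriv (H : HH r v α β L ht) {x : ℝ} (hx : 0 < x) : HasDerivAt (sf1 r v α β ht) (sf2 r v α β ht x) x := by
  have h0 := exp_neg_deriv β x
  have h1 := psi1_hasDerivAt ((r - 1) / 2) α x H.P.hα hx
  have h2 := phi1_hasDerivAt ((r - 1) / 2) α x H.nu hx
  have h3 := H.JI_deriv hx
  have h4 := H.JJ_deriv hx
  have hv := H.P.hv
  have hf := H.sf_deriv hx
  refine HasDerivAt.congr_deriv (f := sf1 r v α β ht) ((hf.const_mul (-β)).sub ((h0.div_const v).mul ((h1.mul h3).add (h2.mul h4)))) ?_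
  have hw := H.wron hx
  have hvab := H.P.hvab
  rw [show (2 * ((r - 1) / 2) + 1) = r by ring]
  have hxr : x ^ r = x ^ (r - 1) * x := by rw [← Real.rpow_add_one hx.ne']; ring_nf
  have hE : Real.exp (-β * x) * Real.exp (β * x) = 1 := by rw [← Real.exp_add]; simp
  rw [hxr] at hw
  simp only [sf2, sw, sf1, sf, gI, pp]
  set E := Real.exp (-β * x)
  set E' := Real.exp (β * x)
  set X := x ^ (r - 1)
  set a := psi ((r - 1) / 2) α x
  set a1 := psi1 ((r - 1) / 2) α x
  set b := phi ((r - 1) / 2) α x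
  set b1 := phi1 ((r - 1) / 2) α x
  set I := JI r α β ht x
  set J := JJ r α β ht x
  rw [eq_div_iff (by positivity)]
  have hv0 : v ≠ 0 := hv.ne'
  have hx0 : x ≠ 0 := hx.ne'
  have e1 : α ^ 2 = β ^ 2 + 1 / v := by field_simp; linarith
  rw [e1]
  have e2 : ht x = ht x * (X * x * (b1 * a - b * a1)) * (E * E') := by rw [hw, hE]; ring
  nth_rewrite 3 [e2]
  field_simp
  ring

lemma HH.first (H : HH r v α β L ht) {x : ℝ} (hx : 0 < x) :
    v * (x * (pp r α β x * (sf1 r v α β ht x + (β + rho r α x) * sf r v α β ht x))) = - JJ r α β ht x := by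
  have hv := H.P.hv
  have hw := H.wron hx
  have hxr : x ^ r = x ^ (r - 1) * x := by rw [← Real.rpow_add_one hx.ne']; ring_nf
  have hE : Real.exp (-β * x) * Real.exp (β * x) = 1 := by rw [← Real.exp_add]; simp
  have ha := psi_pos ((r - 1) / 2) α x H.P.hα hx
  rw [hxr] at hw
  simp only [sf1, sf, pp, rho]
  set E := Real.exp (-β * x)
  set E' := Real.exp (β * x)
  set X := x ^ (r - 1)
  set a := psi ((r - 1) / 2) α x
  set a1 := psi1 ((r - 1) / 2) α x
  set b := phi ((r - 1) / 2) α x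
  set b1 := phi1 ((r - 1) / 2) α x
  set I := JI r α β ht x
  set J := JJ r α β ht x
  have e2 : -J = -J * (X * x * (b1 * a - b * a1)) * (E * E') := by rw [hw, hE]; ring
  rw [e2]
  have ha0 : a ≠ 0 := ha.ne'
  field_simp
  ring

lemma HH.E1 (H : HH r v α β L ht) {x : ℝ} (hx : 0 < x) :
    |sf1 r v α β ht x + (β + rho r α x) * sf r v α β ht x| ≤ L * (β + rho r α x) := by
  have h1 := H.first hx
  have h2 := H.JJ_bound hx
  have hp : 0 < pp r α β x := pp_pos H.P.hα hx
  have hv := H.P.hv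
  rw [← abs_neg, ← h1] at h2
  unfold qq at h2
  rw [abs_mul, abs_mul, abs_mul, abs_of_pos hv, abs_of_pos hx, abs_of_pos hp] at h2
  have : 0 < v * (x * pp r α β x) := by positivity
  refine le_of_mul_le_mul_left (a := v * (x * pp r α β x)) ?_ this
  linarith

lemma HH.A1u (H : HH r v α β L ht) {x : ℝ} (hx : 0 < x) : sf r v α β ht x ≤ L := by
  set W : ℝ → ℝ := fun x => Real.exp (β * x) * (sf r v α β ht x - L) / psi ((r - 1) / 2) α x with hW
  have hd : ∀ y, 0 < y → HasDerivAt W (Real.exp (β * y) / psi ((r - 1) / 2) α y *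
      (sf1 r v α β ht y + (β + rho r α y) * sf r v α β ht y - L * (β + rho r α y))) y := by
    intro y hy
    have h1 : HasDerivAt (fun x => Real.exp (β * x)) (Real.exp (β * y) * (β * 1)) y := ((hasDerivAt_id y).const_mul β).exp
    have hps := psi_pos ((r - 1) / 2) α y H.P.hα hy
    refine HasDerivAt.congr_deriv (f := W) ((h1.mul ((H.sf_deriv hy).sub_const L)).div (psi_hasDerivAt ((r - 1) / 2) α y H.P.hα hy) hps.ne') ?_
    simp only [rho, Pi.mul_apply]
    field_simp
    ring
  have hanti : AntitoneOn W (Set.Ioi 0) := by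
    refine antitoneOn_of_deriv_nonpos (convex_Ioi 0) (fun y hy => (hd y hy).continuousAt.continuousWithinAt) ?_ ?_
    · rw [interior_Ioi]
      exact fun y hy => (hd y hy).differentiableAt.differentiableWithinAt
    · rw [interior_Ioi]
      intro y hy
      rw [(hd y hy).deriv]
      have hps := psi_pos ((r - 1) / 2) α y H.P.hα hy
      refine mul_nonpos_of_nonneg_of_nonpos (by positivity) ?_
      have := (abs_le.1 (H.E1 hy)).2
      linarith
  have hub : ∀ y, 0 < y → W y ≤ -JI r α β ht y / v + L * (Real.exp (β * y) * (y ^ r * (phi ((r - 1) / 2) α y * |β|))) := by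
    intro y hy
    have hps := psi_pos ((r - 1) / 2) α y H.P.hα hy
    have hph := phi_pos ((r - 1) / 2) α y H.nu H.P.hα
    have hw := H.wron hy
    have hJ := (abs_le.1 (H.JJ_bound hy)).1
    have hv := H.P.hv
    have hL := H.hL
    have e1 : W y = -JI r α β ht y / v + phi ((r - 1) / 2) α y / (v * psi ((r - 1) / 2) α y) * (- JJ r α β ht y) - L * Real.exp (β * y) / psi ((r - 1) / 2) α y := by
      simp only [hW, sf]
      have hE : Real.exp (β * y) * Real.exp (-β * y) = 1 := by rw [← Real.exp_add]; simp
      rw [show Real.exp (β * y) * (-(Real.exp (-β * y) / v * (psi ((r - 1) / 2) α y * JI r α β ht y + phi ((r - 1) / 2) α y * JJ r α β ht y)) - L)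
        = -((Real.exp (β * y) * Real.exp (-β * y)) / v * (psi ((r - 1) / 2) α y * JI r α β ht y + phi ((r - 1) / 2) α y * JJ r α β ht y)) - L * Real.exp (β * y) by ring, hE]
      field_simp
      ring
    have e2 : phi ((r - 1) / 2) α y / (v * psi ((r - 1) / 2) α y) * (- JJ r α β ht y) ≤ phi ((r - 1) / 2) α y / (v * psi ((r - 1) / 2) α y) * (L * qq r v α β y) :=
      mul_le_mul_of_nonneg_left (by linarith) (by positivity)
    have hxr : y ^ r = y ^ (r - 1) * y := by rw [← Real.rpow_add_one hy.ne']; ring_nf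
    have e3 : phi ((r - 1) / 2) α y / (v * psi ((r - 1) / 2) α y) * (L * qq r v α β y) - L * Real.exp (β * y) / psi ((r - 1) / 2) α y
        = L * (Real.exp (β * y) * (y ^ r * (phi ((r - 1) / 2) α y * β))) - L * (Real.exp (β * y) * (y ^ r * phi1 ((r - 1) / 2) α y)) := by
      have : L * Real.exp (β * y) / psi ((r - 1) / 2) α y = L * Real.exp (β * y) / psi ((r - 1) / 2) α y * (y ^ r * (phi1 ((r - 1) / 2) α y * psi ((r - 1) / 2) α y - phi ((r - 1) / 2) α y * psi1 ((r - 1) / 2) α y)) := by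
        rw [hw, mul_one]
      rw [this, hxr]
      unfold qq pp rho
      field_simp
      ring
    have e4 : 0 ≤ L * (Real.exp (β * y) * (y ^ r * phi1 ((r - 1) / 2) α y)) := by
      have := phi1_nonneg ((r - 1) / 2) α y H.nu H.P.hα hy.le
      positivity
    have e5 : L * (Real.exp (β * y) * (y ^ r * (phi ((r - 1) / 2) α y * β))) ≤ L * (Real.exp (β * y) * (y ^ r * (phi ((r - 1) / 2) α y * |β|))) := by
      gcongr; exact le_abs_self β
    linarith
  have hlim : Tendsto (fun y => -JI r α β ht y / v + L * (Real.exp (β * y) * (y ^ r * (phi ((r - 1) / 2) α y * |β|)))) (nhdsWithin 0 (Set.Ioi 0)) (nhds 0) := by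
    have hc : ContinuousAt (fun y => -JI r α β ht y / v + L * (Real.exp (β * y) * (y ^ r * (phi ((r - 1) / 2) α y * |β|)))) 0 := by
      have h1 := H.JI_cont
      have h2 := phi_cont ((r - 1) / 2) α H.nu
      have h3 : Continuous fun y : ℝ => y ^ r := Real.continuous_rpow_const H.P.hr.le
      exact Continuous.continuousAt (by fun_prop)
    have := hc.tendsto.mono_left (nhdsWithin_le_nhds (s := Set.Ioi 0))
    refine this.trans (le_of_eq ?_)
    simp [JI, Real.zero_rpow H.P.hr.ne']
  have hWx : W x ≤ 0 := by
    refine ge_of_tendsto hlim ?_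
    filter_upwards [Ioc_mem_nhdsGT hx] with y hy
    exact (hanti hy.1 hx hy.2).trans (hub y hy.1)
  have hps := psi_pos ((r - 1) / 2) α x H.P.hα hx
  have h1 : Real.exp (β * x) * (sf r v α β ht x - L) ≤ 0 := by
    have := (div_le_iff₀ hps).1 hWx
    linarith
  have := nonpos_of_mul_nonpos_right h1 (Real.exp_pos _)
  linarith


lemma JI_neg (x : ℝ) : JI r α β (fun x => - ht x) x = - JI r α β ht x := by
  unfold JI
  rw [← intervalIntegral.integral_neg]
  congr 1; ext t; unfold gI; ring

lemma JJ_neg (x : ℝ) : JJ r α β (fun x => - ht x) x = - JJ r α β ht x := by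
  unfold JJ
  rw [← integral_neg]
  congr 1; ext t; ring

lemma sf_neg (x : ℝ) : sf r v α β (fun x => - ht x) x = - sf r v α β ht x := by
  unfold sf
  rw [JI_neg, JJ_neg]; ring

lemma sf1_neg (x : ℝ) : sf1 r v α β (fun x => - ht x) x = - sf1 r v α β ht x := by
  unfold sf1
  rw [JI_neg, JJ_neg, sf_neg]; ring

lemma sf2_neg (x : ℝ) : sf2 r v α β (fun x => - ht x) x = - sf2 r v α β ht x := by
  unfold sf2 sw
  rw [sf_neg, sf1_neg]; ring

lemma HH.A1 (H : HH r v α β L ht) {x : ℝ} (hx : 0 < x) : |sf r v α β ht x| ≤ L := by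
  have h1 := H.A1u hx
  have h2 := H.negh.A1u hx
  rw [sf_neg] at h2
  rw [abs_le]; constructor <;> linarith

lemma HH.A2 (H : HH r v α β L ht) {x : ℝ} (hx : 0 < x) : |sf1 r v α β ht x| ≤ 2 * L * (β + rho r α x) := by
  have h1 := H.E1 hx
  have h2 := H.A1 hx
  have h3 := brho_pos H.P hx
  have h4 : |(β + rho r α x) * sf r v α β ht x| ≤ (β + rho r α x) * L := by
    rw [abs_mul, abs_of_pos h3]; gcongr
  rw [abs_le] at *
  constructor <;> linarith [h1.1, h1.2, h4.1, h4.2]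

lemma HH.sf_bdd (H : HH r v α β L ht) (g : ℝ → ℝ) (hg : Tendsto g (nhdsWithin 0 (Set.Ioi 0)) (nhds 0)) :
    Tendsto (fun x => g x * sf r v α β ht x) (nhdsWithin 0 (Set.Ioi 0)) (nhds 0) := by
  have h2 : Tendsto (fun x => |g x| * L) (nhdsWithin 0 (Set.Ioi 0)) (nhds 0) := by
    have := hg.abs.mul_const L
    simpa using this
  refine squeeze_zero_norm' ?_ h2
  filter_upwards [self_mem_nhdsWithin] with x hx
  rw [Real.norm_eq_abs, abs_mul]
  gcongr
  exact H.A1 hx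

lemma HH.psi1_bd (H : HH r v α β L ht) {x : ℝ} (hx : 0 < x) :
    |x ^ r * psi1 ((r - 1) / 2) α x| ≤ (phi ((r - 1) / 2) α x)⁻¹ := by
  have hps := psi_pos ((r - 1) / 2) α x H.P.hα hx
  have hph := phi_pos ((r - 1) / 2) α x H.nu H.P.hα
  have hph1 := phi1_nonneg ((r - 1) / 2) α x H.nu H.P.hα hx.le
  have hw := H.wron hx
  have hxr : 0 < x ^ r := by positivity
  have hn : psi1 ((r - 1) / 2) α x ≤ 0 := by
    have := besselK_pos ((r - 1) / 2 + 1) (α * x) (by have := H.P.hα; positivity)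
    have := H.P.hα
    unfold psi1
    have : 0 < α * (x ^ (-((r - 1) / 2)) * besselK ((r - 1) / 2 + 1) (α * x)) := by positivity
    linarith
  rw [abs_mul, abs_of_pos hxr, abs_of_nonpos hn, ← mul_le_mul_iff_right₀ hph, mul_inv_cancel₀ hph.ne']
  have : 0 ≤ x ^ r * (phi1 ((r - 1) / 2) α x * psi ((r - 1) / 2) α x) := by positivity
  linarith

lemma HH.lim1 (H : HH r v α β L ht) : Tendsto (fun x => x ^ r * sf1 r v α β ht x) (nhdsWithin 0 (Set.Ioi 0)) (nhds 0) := by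
  have hxr : Tendsto (fun x : ℝ => x ^ r) (nhdsWithin 0 (Set.Ioi 0)) (nhds 0) := by
    have := ((Real.continuous_rpow_const H.P.hr.le).tendsto (0:ℝ)).mono_left (nhdsWithin_le_nhds (s := Set.Ioi 0))
    simpa [Real.zero_rpow H.P.hr.ne'] using this
  have h1 := (H.sf_bdd _ hxr).const_mul (-β)
  have hJI : Tendsto (JI r α β ht) (nhdsWithin 0 (Set.Ioi 0)) (nhds 0) := by
    have := (H.JI_cont.tendsto (0:ℝ)).mono_left (nhdsWithin_le_nhds (s := Set.Ioi 0))
    simpa [JI] using this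
  have hphc : Tendsto (fun x => (phi ((r - 1) / 2) α x)⁻¹) (nhdsWithin 0 (Set.Ioi 0)) (nhds (phi ((r - 1) / 2) α 0)⁻¹) := by
    have := ((phi_cont ((r - 1) / 2) α H.nu).tendsto (0:ℝ)).mono_left (nhdsWithin_le_nhds (s := Set.Ioi 0))
    exact this.inv₀ (phi_pos ((r - 1) / 2) α 0 H.nu H.P.hα).ne'
  have h2 : Tendsto (fun x => x ^ r * psi1 ((r - 1) / 2) α x * JI r α β ht x) (nhdsWithin 0 (Set.Ioi 0)) (nhds 0) := by
    have hb := hphc.mul hJI.abs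
    rw [abs_zero, mul_zero] at hb
    refine squeeze_zero_norm' ?_ hb
    filter_upwards [self_mem_nhdsWithin] with x hx
    rw [Real.norm_eq_abs, abs_mul]
    gcongr
    exact H.psi1_bd hx
  have hJJ : Tendsto (JJ r α β ht) (nhdsWithin 0 (Set.Ioi 0)) (nhds (JJ r α β ht 0)) := by
    have hi := H.int
    have e : JJ r α β ht = fun y => (∫ t in Set.Ioi (0:ℝ), ht t * wfun ((r - 1) / 2) α β t) - ∫ t in (0:ℝ)..y, ht t * wfun ((r - 1) / 2) α β t := by
      ext y
      have := intervalIntegral.integral_interval_add_Ioi (a := 0) (b := y) (f := fun t => ht t * wfun ((r - 1) / 2) α β t) hi.integrableOn hi.integrableOn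
      rw [← this]; unfold JJ; ring
    have hc : Continuous (JJ r α β ht) := by
      rw [e]
      exact continuous_const.sub (intervalIntegral.continuous_primitive (fun a b => hi.intervalIntegrable) 0)
    exact (hc.tendsto 0).mono_left nhdsWithin_le_nhds
  have hphi1 : Tendsto (phi1 ((r - 1) / 2) α) (nhdsWithin 0 (Set.Ioi 0)) (nhds (phi1 ((r - 1) / 2) α 0)) := by
    have hb : Continuous (bPhi ((r - 1) / 2 + 1)) := continuous_iff_continuousAt.2 fun x => (bPhi_hasDerivAt _ x (by linarith [H.nu])).continuousAt
    have : Continuous (phi1 ((r - 1) / 2) α) := by unfold phi1; fun_prop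
    exact (this.tendsto 0).mono_left nhdsWithin_le_nhds
  have h3 := (hxr.mul hphi1).mul hJJ
  have h4 := (exp_tendsto_zero (-β)).div_const v
  have h5 := h1.sub (h4.mul (h2.add h3))
  simp only [mul_zero, zero_mul, add_zero, sub_zero] at h5
  refine h5.congr fun x => ?_
  unfold sf1; ring

lemma HH.lim2 (H : HH r v α β L ht) : Tendsto (fun x => x ^ (r + 1) * sf2 r v α β ht x) (nhdsWithin 0 (Set.Ioi 0)) (nhds 0) := by
  have hxr : Tendsto (fun x : ℝ => x ^ r) (nhdsWithin 0 (Set.Ioi 0)) (nhds 0) := by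
    have := ((Real.continuous_rpow_const H.P.hr.le).tendsto (0:ℝ)).mono_left (nhdsWithin_le_nhds (s := Set.Ioi 0))
    simpa [Real.zero_rpow H.P.hr.ne'] using this
  have c1 : Tendsto (fun x : ℝ => ht x) (nhdsWithin 0 (Set.Ioi 0)) (nhds (ht 0)) := (H.cont.tendsto 0).mono_left nhdsWithin_le_nhds
  have c2 : Tendsto (fun x : ℝ => x - r * (β * v)) (nhdsWithin 0 (Set.Ioi 0)) (nhds (0 - r * (β * v))) :=
    ((show Continuous fun x : ℝ => x - r * (β * v) by fun_prop).tendsto 0).mono_left nhdsWithin_le_nhds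
  have c3 : Tendsto (fun x : ℝ => v * r + 2 * (β * v) * x) (nhdsWithin 0 (Set.Ioi 0)) (nhds (v * r + 2 * (β * v) * 0)) :=
    ((show Continuous fun x : ℝ => v * r + 2 * (β * v) * x by fun_prop).tendsto 0).mono_left nhdsWithin_le_nhds
  have c4 := H.sf_bdd (fun x => x ^ r * (x - r * (β * v))) (by simpa using hxr.mul c2)
  have h5 := (((hxr.mul c1).add c4).sub (c3.mul H.lim1)).div_const v
  simp only [mul_zero, zero_mul, add_zero, sub_zero, zero_div] at h5
  refine h5.congr' ?_
  filter_upwards [self_mem_nhdsWithin] with x hx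
  have hx0 : x ≠ 0 := ne_of_gt hx
  have hv := H.P.hv
  unfold sf2 sw
  rw [Real.rpow_add_one hx0]
  field_simp
  ring

end


/-- ODE data on the half line -/
structure OD (r v α β L : ℝ) (ht f f1 f2 : ℝ → ℝ) : Prop where
  P : PP r v α β
  hL : 0 ≤ L
  lip : ∀ a b, |ht a - ht b| ≤ L * |a - b|
  bd : ∀ x, |ht x| ≤ L * (|x - r * (β * v)| + √(v * r + 2 * r * (β * v) ^ 2))
  d1 : ∀ x, 0 < x → HasDerivAt f (f1 x) x
  d2 : ∀ x, 0 < x → HasDerivAt f1 (f2 x) x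
  ode : ∀ x, 0 < x → v * x * f2 x = ht x + ((x - r * (β * v)) * f x - (v * r + 2 * (β * v) * x) * f1 x)
  A1 : ∀ x, 0 < x → |f x| ≤ L
  A2 : ∀ x, 0 < x → |f1 x| ≤ 2 * L * (β + rho r α x)
  lim1 : Tendsto (fun x => x ^ r * f1 x) (nhdsWithin 0 (Set.Ioi 0)) (nhds 0)
  lim2 : Tendsto (fun x => x ^ (r + 1) * f2 x) (nhdsWithin 0 (Set.Ioi 0)) (nhds 0)

section
variable {r v α β L : ℝ} {ht f f1 f2 : ℝ → ℝ}

lemma HH.od (H : HH r v α β L ht) : OD r v α β L ht (sf r v α β ht) (sf1 r v α β ht) (sf2 r v α β ht) where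
  P := H.P
  hL := H.hL
  lip := H.lip
  bd := H.bd
  d1 := fun _ hx => H.sf_deriv hx
  d2 := fun _ hx => H.sf1_deriv hx
  ode := fun x hx => by
    have := H.P.hv
    unfold sf2 sw
    field_simp
  A1 := fun _ hx => H.A1 hx
  A2 := fun _ hx => H.A2 hx
  lim1 := H.lim1
  lim2 := H.lim2

lemma OD.neg (O : OD r v α β L ht f f1 f2) : OD r v α β L (fun x => -ht x) (fun x => -f x) (fun x => - f1 x) (fun x => - f2 x) where
  P := O.P
  hL := O.hL
  lip := fun a b => by
    have := O.lip b a
    rw [abs_sub_comm b a] at this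
    rwa [neg_sub_neg]
  bd := fun x => by rw [abs_neg]; exact O.bd x
  d1 := fun x hx => (O.d1 x hx).neg
  d2 := fun x hx => (O.d2 x hx).neg
  ode := fun x hx => by
    have := O.ode x hx
    linarith
  A1 := fun x hx => by rw [abs_neg]; exact O.A1 x hx
  A2 := fun x hx => by rw [abs_neg]; exact O.A2 x hx
  lim1 := by simpa using O.lim1.neg
  lim2 := by simpa using O.lim2.neg

lemma nonpos_of_anti {F : ℝ → ℝ} {b : ℝ} (hanti : AntitoneOn F (Set.Ioc 0 b))
    (hl : Tendsto F (nhdsWithin 0 (Set.Ioi 0)) (nhds 0)) {x : ℝ} (hx : x ∈ Set.Ioc 0 b) : F x ≤ 0 := by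
  refine ge_of_tendsto hl ?_
  filter_upwards [Ioc_mem_nhdsGT hx.1] with y hy
  exact hanti ⟨hy.1, hy.2.trans hx.2⟩ hx hy.2

lemma anti_of_deriv {F F' : ℝ → ℝ} {s : Set ℝ} (hs : Convex ℝ s) (hd : ∀ x ∈ s, HasDerivAt F (F' x) x) (hn : ∀ x ∈ s, F' x ≤ 0) :
    AntitoneOn F s := by
  refine antitoneOn_of_deriv_nonpos hs (fun y hy => (hd y hy).continuousAt.continuousWithinAt) ?_ ?_
  · exact fun y hy => (hd y (interior_subset hy)).differentiableAt.differentiableWithinAt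
  · intro y hy
    rw [(hd y (interior_subset hy)).deriv]
    exact hn y (interior_subset hy)

/-- the integrating factor -/
noncomputable def mm (r β x : ℝ) : ℝ := x ^ r * Real.exp (2 * β * x)

lemma mm_pos {x : ℝ} (hx : 0 < x) : 0 < mm r β x := by unfold mm; positivity

lemma mm_hasDerivAt {x : ℝ} (hx : 0 < x) : HasDerivAt (mm r β) (mm r β x * (r / x + 2 * β)) x := by
  have h1 : HasDerivAt (fun x => Real.exp (2 * β * x)) (Real.exp (2 * β * x) * (2 * β * 1)) x := ((hasDerivAt_id x).const_mul (2 * β)).exp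
  have h2 := Real.hasDerivAt_rpow_const (x := x) (p := r) (Or.inl hx.ne')
  refine HasDerivAt.congr_deriv (f := mm r β) (h2.mul h1) ?_
  unfold mm
  rw [Real.rpow_sub_one hx.ne']
  field_simp

lemma mm_tendsto (hr : 0 < r) : Tendsto (mm r β) (nhdsWithin 0 (Set.Ioi 0)) (nhds 0) := by
  have hc : Continuous (mm r β) := by
    have : Continuous fun x : ℝ => x ^ r := Real.continuous_rpow_const hr.le
    unfold mm; fun_prop
  have := (hc.tendsto (0:ℝ)).mono_left (nhdsWithin_le_nhds (s := Set.Ioi 0))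
  simpa [mm, Real.zero_rpow hr.ne'] using this

lemma mm_mul_tendsto {g : ℝ → ℝ} (hg : Tendsto (fun x => x ^ r * g x) (nhdsWithin 0 (Set.Ioi 0)) (nhds 0)) :
    Tendsto (fun x => mm r β x * g x) (nhdsWithin 0 (Set.Ioi 0)) (nhds 0) := by
  have := hg.mul (exp_tendsto_zero (2 * β))
  rw [zero_mul] at this
  refine this.congr fun x => ?_
  unfold mm; ring

noncomputable def G0 (r α L : ℝ) : ℝ := L * α * (12 + 3 / √r)

lemma abv_le (P : PP r v α β) : 1 ≤ v * α * α ∧ v * β ^ 2 ≤ v * α * α := by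
  have := P.hvab
  have h2 : 0 ≤ v * β ^ 2 := by have := P.hv; positivity
  constructor <;> nlinarith

lemma sdev_le (P : PP r v α β) : √(v * r + 2 * r * (β * v) ^ 2) ≤ 3 / 2 * (√r * (α * v)) := by
  have hr := P.hr; have hv := P.hv; have hα := P.hα
  rw [← Real.sqrt_sq (by positivity : 0 ≤ 3 / 2 * (√r * (α * v)))]
  apply Real.sqrt_le_sqrt
  have e : (3 / 2 * (√r * (α * v))) ^ 2 = 9 / 4 * (r * v * (v * α * α)) := by
    have : √r ^ 2 = r := Real.sq_sqrt hr.le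
    calc _ = 9 / 4 * (√r ^ 2 * (α * v) ^ 2) := by ring
      _ = _ := by rw [this]; ring
  rw [e]
  have h := P.hvab
  have h1 : v * r + 2 * r * (β * v) ^ 2 = r * v * (2 * (v * α * α) - 1) := by
    have : v * β ^ 2 = v * α * α - 1 := by linarith
    calc _ = r * v * (1 + 2 * (v * β ^ 2)) := by ring
      _ = _ := by rw [this]; ring
  rw [h1]
  have h2 := abv_le P
  have h3 : 2 * (v * α * α) - 1 ≤ 9 / 4 * (v * α * α) := by linarith
  have h4 : 0 ≤ r * v := by positivity
  have := mul_le_mul_of_nonneg_left h3 h4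
  linarith

lemma OD.A4u (O : OD r v α β L ht f f1 f2) {x : ℝ} (hx : 0 < x) (hx1 : x ≤ r / (4 * α)) : f1 x ≤ G0 r α L := by
  have hr := O.P.hr; have hv := O.P.hv; have hα := O.P.hα; have hβ := O.P.hβ; have hL := O.hL
  have hanti : AntitoneOn (fun x => mm r β x * (f1 x - G0 r α L)) (Set.Ioc 0 (r / (4 * α))) := by
    refine anti_of_deriv (F' := fun y => mm r β y * (f2 y + (r / y + 2 * β) * (f1 y - G0 r α L))) (convex_Ioc _ _) ?_ ?_
    · intro y hy
      refine ((mm_hasDerivAt hy.1).mul ((O.d2 y hy.1).sub_const _)).congr_deriv ?_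
      ring
    · intro y hy
      obtain ⟨hy, hy1⟩ := hy
      refine mul_nonpos_of_nonneg_of_nonpos (mm_pos hy).le ?_
      have hode := O.ode y hy
      have key : v * y * (f2 y + (r / y + 2 * β) * (f1 y - G0 r α L)) = ht y + (y - r * (β * v)) * f y - v * (r + 2 * β * y) * G0 r α L := by
        rw [mul_add, hode]; field_simp; ring
      have hk : ht y + (y - r * (β * v)) * f y - v * (r + 2 * β * y) * G0 r α L ≤ 0 := by
        have hb1 : ht y ≤ L * (|y - r * (β * v)| + √(v * r + 2 * r * (β * v) ^ 2)) := (le_abs_self _).trans (O.bd y)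
        have hb2 : (y - r * (β * v)) * f y ≤ |y - r * (β * v)| * L := by
          refine (le_abs_self _).trans ?_
          rw [abs_mul]; gcongr; exact O.A1 y hy
        have hb3 : |y - r * (β * v)| ≤ y + r * (α * v) := by
          have h1 := abs_sub y (r * (β * v))
          rw [abs_of_pos hy, abs_mul, abs_mul, abs_of_pos hr, abs_of_pos hv] at h1
          have : r * (|β| * v) ≤ r * (α * v) := by gcongr
          linarith
        have hb4 := sdev_le O.P
        have hαy : α * y ≤ r / 4 := by rw [le_div_iff₀ (by positivity)] at hy1; linarith
        have hb5 : y ≤ r * (α * v) / 4 := by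
          have h1 := (abv_le O.P).1
          have : y * 1 ≤ y * (v * α * α) := by gcongr
          have h2 : (α * y) * (α * v) ≤ r / 4 * (α * v) := by gcongr
          linarith
        have hb6 : r / 2 ≤ r + 2 * β * y := by
          have h1 := abs_lt.1 hβ
          nlinarith
        have hb7 : v * (r / 2) * G0 r α L ≤ v * (r + 2 * β * y) * G0 r α L := by
          have : 0 ≤ G0 r α L := by unfold G0; positivity
          gcongr
        have hsr : 0 < √r := Real.sqrt_pos.2 hr
        have hb8 : v * (r / 2) * G0 r α L = L * (6 * (r * (α * v)) + 3 / 2 * (√r * (α * v))) := by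
          unfold G0
          have : r / √r = √r := Real.div_sqrt
          calc _ = L * (6 * (r * (α * v)) + 3 / 2 * ((r / √r) * (α * v))) := by ring
            _ = _ := by rw [this]
        have hb9 : L * (|y - r * (β * v)| + √(v * r + 2 * r * (β * v) ^ 2)) + |y - r * (β * v)| * L ≤ L * (6 * (r * (α * v)) + 3 / 2 * (√r * (α * v))) := by
          have : |y - r * (β * v)| + √(v * r + 2 * r * (β * v) ^ 2) + |y - r * (β * v)| ≤ 6 * (r * (α * v)) + 3 / 2 * (√r * (α * v)) := by
            have : 0 < r * (α * v) := by positivity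
            linarith
          nlinarith
        linarith
      rw [← key] at hk
      exact nonpos_of_mul_nonpos_right hk (by positivity)
  have hl : Tendsto (fun x => mm r β x * (f1 x - G0 r α L)) (nhdsWithin 0 (Set.Ioi 0)) (nhds 0) := by
    have := (mm_mul_tendsto (β := β) O.lim1).sub ((mm_tendsto (β := β) hr).mul_const (G0 r α L))
    simp only [zero_mul, sub_zero] at this
    refine this.congr fun x => ?_
    ring
  have := nonpos_of_anti hanti hl ⟨hx, hx1⟩
  have := nonpos_of_mul_nonpos_right this (mm_pos hx)
  linarith

lemma OD.A4 (O : OD r v α β L ht f f1 f2) {x : ℝ} (hx : 0 < x) : |f1 x| ≤ G0 r α L := by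
  have hr := O.P.hr; have hv := O.P.hv; have hα := O.P.hα; have hβ := abs_lt.1 O.P.hβ; have hL := O.hL
  rcases le_or_gt x (r / (4 * α)) with h | h
  · have h1 := O.A4u hx h
    have h2 := O.neg.A4u hx h
    rw [abs_le]; constructor <;> linarith
  · refine (O.A2 x hx).trans ?_
    have h1 := rho_le (α := α) hr hα hx
    have h2 : r / x ≤ 4 * α := by
      rw [div_lt_iff₀ (by positivity)] at h
      rw [div_le_iff₀ hx]; linarith
    have h3 : 2 * L * (β + rho r α x) ≤ 2 * L * (6 * α) := by
      gcongr; linarith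
    refine h3.trans ?_
    unfold G0
    have : L * α * 12 ≤ L * α * (12 + 3 / √r) := by
      have : 0 ≤ 3 / √r := by positivity
      gcongr; linarith
    linarith

end


section
variable {r v α β L : ℝ} {ht f f1 f2 : ℝ → ℝ}

/-- formal derivative of `f2` when the derivative of the test function is `η` -/
noncomputable def Dd (r v β : ℝ) (f f1 f2 : ℝ → ℝ) (x η : ℝ) : ℝ :=
  (η + f x - β * v * f1 x - (v * (r + 1) + 2 * (β * v) * x) * f2 x + (x - (r + 1) * (β * v)) * f1 x) / (v * x)

lemma OD.Y (O : OD r v α β L ht f f1 f2) {a b : ℝ} (ha : 0 < a) (hab : a ≤ b) {A A' B B' : ℝ → ℝ}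
    (hA : ∀ x ∈ Set.Icc a b, HasDerivAt A (A' x) x) (hB : ∀ x ∈ Set.Icc a b, HasDerivAt B (B' x) x)
    (hn : ∀ x ∈ Set.Icc a b, ∀ η, |η| ≤ L → A' x * f2 x + A x * Dd r v β f f1 f2 x η + B' x ≤ 0) :
    A b * f2 b + B b ≤ A a * f2 a + B a := by
  have hv := O.P.hv
  have hf2 : ∀ x, 0 < x → f2 x = (ht x + ((x - r * (β * v)) * f x - (v * r + 2 * (β * v) * x) * f1 x)) / (v * x) := by
    intro x hx
    rw [eq_div_iff (by positivity), ← O.ode x hx]; ring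
  set C : ℝ → ℝ := fun x => A x / (v * x) with hC
  set w : ℝ → ℝ := fun x => (x - r * (β * v)) * f x - (v * r + 2 * (β * v) * x) * f1 x with hw
  set M : ℝ → ℝ := fun x => C x * w x + B x with hM
  have hFe : ∀ x, 0 < x → A x * f2 x + B x = C x * ht x + M x := by
    intro x hx
    rw [hf2 x hx]; simp only [hM, hC, hw]; field_simp; ring
  have hCd : ∀ x ∈ Set.Icc a b, HasDerivAt C ((A' x * (v * x) - A x * v) / (v * x) ^ 2) x := by
    intro x hx
    have hx0 : 0 < x := lt_of_lt_of_le ha hx.1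
    refine HasDerivAt.congr_deriv (f := C) ((hA x hx).div ((hasDerivAt_id x).const_mul v) (by simp; constructor <;> positivity)) ?_
    simp
  have hwd : ∀ x, 0 < x → HasDerivAt w (f x + (x - r * (β * v)) * f1 x - 2 * (β * v) * f1 x - (v * r + 2 * (β * v) * x) * f2 x) x := by
    intro x hx
    have h1 := ((hasDerivAt_id x).sub_const (r * (β * v))).mul (O.d1 x hx)
    have h2 := (((hasDerivAt_id x).const_mul (2 * (β * v))).const_add (v * r)).mul (O.d2 x hx)
    refine HasDerivAt.congr_deriv (f := w) (h1.sub h2) ?_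
    simp; ring
  have hMd : ∀ x ∈ Set.Icc a b, HasDerivAt M ((A' x * (v * x) - A x * v) / (v * x) ^ 2 * w x + C x * (f x + (x - r * (β * v)) * f1 x - 2 * (β * v) * f1 x - (v * r + 2 * (β * v) * x) * f2 x) + B' x) x := by
    intro x hx
    have hx0 : 0 < x := lt_of_lt_of_le ha hx.1
    exact ((hCd x hx).mul (hwd x hx0)).add (hB x hx)
  have hcont : ContinuousOn (fun x => C x * ht x + M x) (Set.Icc a b) := by
    refine ContinuousOn.add (ContinuousOn.mul ?_ (lip_cont O.lip).continuousOn) ?_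
    · exact fun x hx => (hCd x hx).continuousAt.continuousWithinAt
    · exact fun x hx => (hMd x hx).continuousAt.continuousWithinAt
  have main := image_le_of_liminf_slope_right_le_deriv_boundary hcont (B := fun _ => C a * ht a + M a) (B' := fun _ => 0) le_rfl
    continuousOn_const (fun x _ => hasDerivWithinAt_const _ _ _) ?_ (x := b) ⟨hab, le_rfl⟩
  · rw [hFe a ha, hFe b (ha.trans_le hab)]; exact main
  intro x hx ε hε
  apply Eventually.frequently
  have hx' : x ∈ Set.Icc a b := ⟨hx.1, hx.2.le⟩
  have hx0 : 0 < x := lt_of_lt_of_le ha hx.1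
  have t1 := (hasDerivAt_iff_tendsto_slope.1 (hCd x hx')).mono_left (nhdsWithin_mono x (fun z hz => ne_of_gt hz : Set.Ioi x ⊆ {x}ᶜ))
  have t2 := (hasDerivAt_iff_tendsto_slope.1 (hMd x hx')).mono_left (nhdsWithin_mono x (fun z hz => ne_of_gt hz : Set.Ioi x ⊆ {x}ᶜ))
  have t3 : Tendsto ht (nhdsWithin x (Set.Ioi x)) (nhds (ht x)) := ((lip_cont O.lip).tendsto x).mono_left nhdsWithin_le_nhds
  have t4 := ((t1.mul t3).add t2).add_const (|C x| * L)
  have hlt : (A' x * (v * x) - A x * v) / (v * x) ^ 2 * ht x + ((A' x * (v * x) - A x * v) / (v * x) ^ 2 * w x + C x * (f x + (x - r * (β * v)) * f1 x - 2 * (β * v) * f1 x - (v * r + 2 * (β * v) * x) * f2 x) + B' x) + |C x| * L < ε := by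
    refine lt_of_le_of_lt ?_ hε
    have key : ∀ η, (A' x * (v * x) - A x * v) / (v * x) ^ 2 * ht x + ((A' x * (v * x) - A x * v) / (v * x) ^ 2 * w x + C x * (f x + (x - r * (β * v)) * f1 x - 2 * (β * v) * f1 x - (v * r + 2 * (β * v) * x) * f2 x) + B' x) + C x * η =
        A' x * f2 x + A x * Dd r v β f f1 f2 x η + B' x := by
      intro η
      have : ht x + w x = v * x * f2 x := by rw [O.ode x hx0]
      have e : ht x = v * x * f2 x - w x := by linarith
      rw [e]
      simp only [hC, Dd]
      field_simp
      ring
    rcases le_total 0 (C x) with h | h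
    · rw [abs_of_nonneg h, key L]
      exact hn x hx' L (by rw [abs_of_nonneg O.hL])
    · rw [abs_of_nonpos h, show -C x * L = C x * (-L) by ring, key (-L)]
      exact hn x hx' (-L) (by rw [abs_neg, abs_of_nonneg O.hL])
  filter_upwards [t4.eventually_lt_const hlt, self_mem_nhdsWithin] with z hz hzx
  refine lt_of_le_of_lt ?_ hz
  have hzx' : 0 < z - x := sub_pos.2 hzx
  have e : slope (fun x => C x * ht x + M x) x z = slope C x z * ht z + slope M x z + C x * ((ht z - ht x) / (z - x)) := by
    rw [slope_def_field, slope_def_field, slope_def_field]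
    field_simp
    ring
  rw [e]
  have : C x * ((ht z - ht x) / (z - x)) ≤ |C x| * L := by
    refine (le_abs_self _).trans ?_
    rw [abs_mul]
    gcongr
    rw [abs_div, div_le_iff₀ (by positivity)]
    exact O.lip z x
  linarith

lemma max_princ {F F' : ℝ → ℝ} {a b m : ℝ} (hab : a ≤ b) (hd : ∀ x ∈ Set.Icc a b, HasDerivAt F (F' x) x)
    (ha : F a ≤ m) (hF : ∀ x ∈ Set.Icc a b, m < F x → F' x ≤ 0) : F b ≤ m := by
  have key : ∀ ε > 0, F b ≤ m + ε * (b - a + 1) := by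
    intro ε hε
    have hB : ∀ x, HasDerivAt (fun x => m + ε * (x - a + 1)) ε x := by
      intro x
      have := ((((hasDerivAt_id x).sub_const a).add_const 1).const_mul ε).const_add m
      simpa using this
    refine image_le_of_liminf_slope_right_lt_deriv_boundary (f := F) (f' := F') (B := fun x => m + ε * (x - a + 1)) (B' := fun _ => ε)
      (a := a) (b := b) (fun x hx => (hd x hx).continuousAt.continuousWithinAt) ?_ ?_ (fun x => hB x) ?_ ⟨hab, le_rfl⟩
    · intro x hx q hq
      exact (hd x ⟨hx.1, hx.2.le⟩).hasDerivWithinAt.liminf_right_slope_le hq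
    · nlinarith
    · intro x hx hxe
      have : m < F x := by rw [hxe]; have := hx.1; nlinarith
      exact lt_of_le_of_lt (hF x ⟨hx.1, hx.2.le⟩ this) hε
  by_contra hcon
  push Not at hcon
  have hp : 0 < b - a + 1 := by linarith
  have := key ((F b - m) / (2 * (b - a + 1))) (by have : 0 < F b - m := by linarith
                                                  positivity)
  have e : (F b - m) / (2 * (b - a + 1)) * (b - a + 1) = (F b - m) / 2 := by field_simp
  rw [e] at this
  linarith

noncomputable def H0 (r v α β L : ℝ) : ℝ := 2 * L + |β| * v * G0 r α L

lemma OD.G0_nn (O : OD r v α β L ht f f1 f2) : 0 ≤ G0 r α L := by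
  have := O.P.hα; have := O.hL
  unfold G0; positivity

lemma OD.H0_nn (O : OD r v α β L ht f f1 f2) : 0 ≤ H0 r v α β L := by
  have := O.G0_nn; have := O.hL; have := O.P.hv
  unfold H0; positivity

lemma OD.eta (O : OD r v α β L ht f f1 f2) {x : ℝ} (hx : 0 < x) {η : ℝ} (hη : |η| ≤ L) : |η + f x - β * v * f1 x| ≤ H0 r v α β L := by
  have h1 := O.A1 x hx
  have h2 : |β * v * f1 x| ≤ |β| * v * G0 r α L := by
    have hv := O.P.hv
    rw [abs_mul, abs_mul, abs_of_pos hv]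
    gcongr
    exact O.A4 hx
  unfold H0
  rw [abs_le] at *
  constructor <;> linarith [hη.1, hη.2, h1.1, h1.2, h2.1, h2.2]

lemma OD.Tlim (O : OD r v α β L ht f f1 f2) :
    Tendsto (fun x => -(v * x * pp (r + 1) α β x) * f2 x + -(qq (r + 1) v α β x) * f1 x) atTop (nhds 0) := by
  have P := O.P.succ
  have hv := P.hv
  have p0 : Tendsto (pp (r + 1) α β) atTop (nhds 0) := by simpa using pow_pp_tendsto P 0
  have p1 : Tendsto (fun x => x * pp (r + 1) α β x) atTop (nhds 0) := by simpa using pow_pp_tendsto P 1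
  have q0 : Tendsto (qq (r + 1) v α β) atTop (nhds 0) := by simpa using pow_qq_tendsto P 0
  have hL := O.hL
  have hG := O.G0_nn
  set s := √(v * r + 2 * r * (β * v) ^ 2)
  have hb : Tendsto (fun x => (2 * L + 2 * |β * v| * G0 r α L) * (x * pp (r + 1) α β x) + (2 * L * |r * (β * v)| + L * s + v * r * G0 r α L) * pp (r + 1) α β x
      + qq (r + 1) v α β x * G0 r α L) atTop (nhds 0) := by
    have := ((p1.const_mul (2 * L + 2 * |β * v| * G0 r α L)).add (p0.const_mul (2 * L * |r * (β * v)| + L * s + v * r * G0 r α L))).add (q0.mul_const (G0 r α L))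
    simpa using this
  refine squeeze_zero_norm' ?_ hb
  filter_upwards [eventually_gt_atTop 0] with x hx
  have hp : 0 < pp (r + 1) α β x := pp_pos P.hα hx
  have hq := qq_pos P hx
  have hr := O.P.hr
  rw [Real.norm_eq_abs]
  have e : -(v * x * pp (r + 1) α β x) * f2 x + -(qq (r + 1) v α β x) * f1 x = -(pp (r + 1) α β x * (v * x * f2 x)) + -(qq (r + 1) v α β x * f1 x) := by ring
  rw [e, O.ode x hx]
  refine (abs_add_le _ _).trans ?_
  rw [abs_neg, abs_neg, abs_mul, abs_mul, abs_of_pos hp, abs_of_pos hq]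
  have h4 := O.A4 hx
  have h5 : |ht x + ((x - r * (β * v)) * f x - (v * r + 2 * (β * v) * x) * f1 x)| ≤ (2 * L + 2 * |β * v| * G0 r α L) * x + (2 * L * |r * (β * v)| + L * s + v * r * G0 r α L) := by
    have b1 := O.bd x
    have b2 : |x - r * (β * v)| ≤ x + |r * (β * v)| := by
      have := abs_sub x (r * (β * v)); rwa [abs_of_pos hx] at this
    have b3 : |(x - r * (β * v)) * f x| ≤ (x + |r * (β * v)|) * L := by
      rw [abs_mul]; gcongr; exact O.A1 x hx
    have b4 : |(v * r + 2 * (β * v) * x) * f1 x| ≤ (v * r + 2 * |β * v| * x) * G0 r α L := by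
      rw [abs_mul]; gcongr
      refine (abs_add_le _ _).trans ?_
      rw [abs_of_pos (by positivity : 0 < v * r), abs_mul, abs_mul, abs_of_pos hx, abs_of_pos (by norm_num : (0:ℝ) < 2)]
    have b5 : L * (|x - r * (β * v)| + s) ≤ L * (x + |r * (β * v)| + s) := by gcongr
    refine (abs_add_le _ _).trans ?_
    have := abs_sub ((x - r * (β * v)) * f x) ((v * r + 2 * (β * v) * x) * f1 x)
    linarith
  have h6 : pp (r + 1) α β x * |ht x + ((x - r * (β * v)) * f x - (v * r + 2 * (β * v) * x) * f1 x)| ≤ pp (r + 1) α β x * ((2 * L + 2 * |β * v| * G0 r α L) * x + (2 * L * |r * (β * v)| + L * s + v * r * G0 r α L)) := by gcongr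
  have h7 : qq (r + 1) v α β x * |f1 x| ≤ qq (r + 1) v α β x * G0 r α L := by gcongr
  linarith

lemma OD.A6u (O : OD r v α β L ht f f1 f2) {x : ℝ} (hx : 0 < x) (hX : 0 < x - (r + 1) * (β * v)) :
    (f2 x + (β + rho (r + 1) α x) * f1 x) * (x - (r + 1) * (β * v)) ≤ H0 r v α β L * (β + rho (r + 1) α x) := by
  have P := O.P.succ
  have hv := P.hv
  have hα := P.hα
  have hq0 : Tendsto (qq (r + 1) v α β) atTop (nhds 0) := by simpa using pow_qq_tendsto P 0
  set X : ℝ → ℝ := fun x => x - (r + 1) * (β * v) with hXd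
  have mono : ∀ z, x ≤ z → -(v * z * pp (r + 1) α β z) * f2 z + (-(qq (r + 1) v α β z) * f1 z + H0 r v α β L * (qq (r + 1) v α β z / X z)) ≤
      -(v * x * pp (r + 1) α β x) * f2 x + (-(qq (r + 1) v α β x) * f1 x + H0 r v α β L * (qq (r + 1) v α β x / X x)) := by
    intro z hz
    refine O.Y (A := fun x => -(v * x * pp (r + 1) α β x)) (B := fun x => -(qq (r + 1) v α β x) * f1 x + H0 r v α β L * (qq (r + 1) v α β x / X x))
      (A' := fun x => -(v * pp (r + 1) α β x * ((r + 1) + x * (β - rho (r + 1) α x))))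
      (B' := fun x => X x * pp (r + 1) α β x * f1 x - qq (r + 1) v α β x * f2 x + H0 r v α β L * (- pp (r + 1) α β x - qq (r + 1) v α β x / X x ^ 2)) hx hz ?_ ?_ ?_
    · intro y hy
      have hy0 : 0 < y := hx.trans_le hy.1
      have h1 := ((hasDerivAt_id y).const_mul v).mul (pp_hasDerivAt (r := r + 1) (β := β) hα hy0)
      refine HasDerivAt.congr_deriv (f := fun x => -(v * x * pp (r + 1) α β x)) h1.neg ?_
      simp only [id, add_sub_cancel_right, mul_one]
      field_simp
      ring
    · intro y hy
      have hy0 : 0 < y := hx.trans_le hy.1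
      have hXy : 0 < X y := by have := hy.1; simp only [hXd]; linarith
      have hq := qq_hasDerivAt P hy0
      have hXdd : HasDerivAt X 1 y := (hasDerivAt_id y).sub_const _
      refine ((hq.neg.mul (O.d2 y hy0)).add ((hq.div hXdd hXy.ne').const_mul _)).congr_deriv ?_
      have : y - (r + 1) * (β * v) = X y := rfl
      rw [this]
      simp only [Pi.neg_apply]
      field_simp
      ring
    · intro y hy η hη
      have hy0 : 0 < y := hx.trans_le hy.1
      have hXy : 0 < X y := by have := hy.1; simp only [hXd]; linarith
      have hp : 0 < pp (r + 1) α β y := pp_pos P.hα hy0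
      have hq := qq_pos P hy0
      have key : -(v * pp (r + 1) α β y * ((r + 1) + y * (β - rho (r + 1) α y))) * f2 y + -(v * y * pp (r + 1) α β y) * Dd r v β f f1 f2 y η
          + (X y * pp (r + 1) α β y * f1 y - qq (r + 1) v α β y * f2 y) = - (pp (r + 1) α β y * (η + f y - β * v * f1 y)) := by
        simp only [Dd, qq, hXd]
        field_simp
        ring
      have h1 := (abs_le.1 (O.eta hy0 hη)).1
      have h2 : 0 ≤ H0 r v α β L * (qq (r + 1) v α β y / X y ^ 2) := by have := O.H0_nn; positivity
      have h3 : -(pp (r + 1) α β y * (η + f y - β * v * f1 y)) ≤ pp (r + 1) α β y * H0 r v α β L := by nlinarith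
      linarith
  have hlim : Tendsto (fun z => -(v * z * pp (r + 1) α β z) * f2 z + (-(qq (r + 1) v α β z) * f1 z + H0 r v α β L * (qq (r + 1) v α β z / X z))) atTop (nhds 0) := by
    have h1 : Tendsto (fun z => qq (r + 1) v α β z / X z) atTop (nhds 0) := by
      refine squeeze_zero_norm' ?_ hq0
      filter_upwards [eventually_gt_atTop 0, eventually_ge_atTop (1 + (r + 1) * (β * v))] with z hz hz1
      have hq := qq_pos P hz
      have : 1 ≤ X z := by simp only [hXd]; linarith
      rw [Real.norm_eq_abs, abs_of_pos (by positivity)]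
      exact div_le_self hq.le this
    have := O.Tlim.add (h1.const_mul (H0 r v α β L))
    simp only [mul_zero, add_zero] at this
    refine this.congr fun z => ?_
    ring
  have h0 := le_of_tendsto hlim (by filter_upwards [eventually_ge_atTop x] with z hz using mono z hz)
  have hp : 0 < pp (r + 1) α β x := pp_pos P.hα hx
  have hX' : 0 < X x := hX
  have e : -(v * x * pp (r + 1) α β x) * f2 x + (-(qq (r + 1) v α β x) * f1 x + H0 r v α β L * (qq (r + 1) v α β x / X x)) =
      (v * x * pp (r + 1) α β x / X x) * (H0 r v α β L * (β + rho (r + 1) α x) - (f2 x + (β + rho (r + 1) α x) * f1 x) * X x) := by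
    unfold qq
    field_simp
    ring
  rw [e] at h0
  have := nonneg_of_mul_nonneg_right h0 (by positivity)
  linarith

end


section
variable {r v α β L : ℝ} {ht f f1 f2 : ℝ → ℝ}

lemma H0_neg : H0 r v α (-β) L = H0 r v α β L := by unfold H0; rw [abs_neg]

lemma OD.A6 (O : OD r v α β L ht f f1 f2) {x : ℝ} (hx : 0 < x) (hX : 0 < x - (r + 1) * (β * v)) :
    |(f2 x + (β + rho (r + 1) α x) * f1 x) * (x - (r + 1) * (β * v))| ≤ H0 r v α β L * (β + rho (r + 1) α x) := by
  have h1 := O.A6u hx hX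
  have h2 := O.neg.A6u hx hX
  rw [abs_le]; constructor <;> linarith

noncomputable def S1 (r v α β L : ℝ) : ℝ :=
  2 / (α - |β|) * G0 r α L + 2 * H0 r v α β L + (r + 1) * (|β| * v) * G0 r α L

lemma OD.A7u (O : OD r v α β L ht f f1 f2) {x : ℝ} (hx : 0 < x) :
    (x - (r + 1) * (β * v)) * f1 x ≤ S1 r v α β L := by
  have P := O.P.succ
  have hv := P.hv
  have hr := O.P.hr
  have hδ : 0 < α - |β| := by have := O.P.hβ; linarith
  have hG := O.G0_nn
  have hH := O.H0_nn
  set X0 := 2 / (α - |β|) with hX0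
  have hX0p : 0 < X0 := by positivity
  have hb1 : |β| = max β 0 + max (-β) 0 := by
    rcases le_total 0 β with h | h
    · rw [abs_of_nonneg h, max_eq_left h, max_eq_right (by linarith)]; ring
    · rw [abs_of_nonpos h, max_eq_right h, max_eq_left (by linarith)]; ring
  have hb2 : β = max β 0 - max (-β) 0 := by
    rcases le_total 0 β with h | h
    · rw [max_eq_left h, max_eq_right (by linarith)]; ring
    · rw [max_eq_right h, max_eq_left (by linarith)]; ring
  have hm1 : 0 ≤ max β 0 := le_max_right _ _
  have hm2 : 0 ≤ max (-β) 0 := le_max_right _ _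
  set b1 := max β 0
  set b2 := max (-β) 0
  have hn1 : 0 ≤ (r + 1) * (b1 * v) := by positivity
  have hn2 : 0 ≤ (r + 1) * (b2 * v) := by positivity
  have hsmall : ∀ y, 0 < y → y ≤ X0 + (r + 1) * (b1 * v) → (y - (r + 1) * (β * v)) * f1 y ≤ S1 r v α β L := by
    intro y hy hy1
    have e1 : |y - (r + 1) * (β * v)| ≤ X0 + (r + 1) * (|β| * v) := by
      rw [hb1, hb2, abs_le]
      constructor <;> nlinarith
    calc (y - (r + 1) * (β * v)) * f1 y ≤ |(y - (r + 1) * (β * v)) * f1 y| := le_abs_self _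
      _ ≤ (X0 + (r + 1) * (|β| * v)) * G0 r α L := by
          rw [abs_mul]
          exact mul_le_mul e1 (O.A4 hy) (abs_nonneg _) ((abs_nonneg _).trans e1)
      _ ≤ _ := by unfold S1; rw [← hX0]; linarith
  rcases le_or_gt x (X0 + (r + 1) * (b1 * v)) with h | h
  · exact hsmall x hx h
  have ha : 0 < X0 + (r + 1) * (b1 * v) := by linarith
  refine max_princ (F := fun x => (x - (r + 1) * (β * v)) * f1 x) (F' := fun x => f1 x + (x - (r + 1) * (β * v)) * f2 x) h.le ?_
    (hsmall _ ha le_rfl) ?_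
  · intro y hy
    have hy0 : 0 < y := ha.trans_le hy.1
    refine (((hasDerivAt_id y).sub_const _).mul (O.d2 y hy0)).congr_deriv ?_
    simp
  · intro y hy hF
    have hy0 : 0 < y := ha.trans_le hy.1
    have hXy : X0 ≤ y - (r + 1) * (β * v) := by
      have := hy.1
      rw [hb2]; nlinarith
    have hXy0 : 0 < y - (r + 1) * (β * v) := by linarith
    have h6 := O.A6u hy0 hXy0
    have hrho := rho_ge (α := α) P.hr P.hα hy0
    have hbr : α - |β| ≤ β + rho (r + 1) α y := by have := neg_abs_le β; linarith
    set X := y - (r + 1) * (β * v) with hX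
    set q := β + rho (r + 1) α y
    have hq : 0 < q := by linarith
    have hF2 : 2 * H0 r v α β L ≤ X * f1 y := by
      have : 2 * H0 r v α β L ≤ S1 r v α β L := by
        unfold S1
        have : 0 ≤ 2 / (α - |β|) * G0 r α L := by positivity
        have : 0 ≤ (r + 1) * (|β| * v) * G0 r α L := by positivity
        linarith
      linarith
    have hf1 : 0 ≤ f1 y := by
      have : 0 ≤ X * f1 y := by linarith
      exact nonneg_of_mul_nonneg_right this hXy0
    have hqX : 2 ≤ q * X := by
      have h1 : (α - |β|) * X0 = 2 := by rw [hX0]; field_simp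
      calc 2 = (α - |β|) * X0 := h1.symm
        _ ≤ q * X := by gcongr
    have e1 : 2 * f1 y ≤ q * X * f1 y := by gcongr
    have e2 : q * (2 * H0 r v α β L) ≤ q * (X * f1 y) := by gcongr
    nlinarith

lemma OD.A7 (O : OD r v α β L ht f f1 f2) {x : ℝ} (hx : 0 < x) :
    |(x - (r + 1) * (β * v)) * f1 x| ≤ S1 r v α β L := by
  have h1 := O.A7u hx
  have h2 := O.neg.A7u hx
  rw [abs_le]; constructor <;> linarith

noncomputable def S0 (r v α β L : ℝ) : ℝ := H0 r v α β L + S1 r v α β L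

lemma OD.S0_nn (O : OD r v α β L ht f f1 f2) : 0 ≤ S0 r v α β L := by
  have := (abs_nonneg _).trans (O.A7 (x := 1) one_pos)
  have := O.H0_nn
  unfold S0; linarith

lemma OD.eta2 (O : OD r v α β L ht f f1 f2) {x : ℝ} (hx : 0 < x) {η : ℝ} (hη : |η| ≤ L) :
    |η + f x - β * v * f1 x + (x - (r + 1) * (β * v)) * f1 x| ≤ S0 r v α β L :=
  (abs_add_le _ _).trans (add_le_add (O.eta hx hη) (O.A7 hx))

lemma OD.mmY (O : OD r v α β L ht f f1 f2) {b : ℝ} {Z Z' : ℝ → ℝ}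
    (hZ : ∀ x ∈ Set.Ioc 0 b, HasDerivAt Z (Z' x) x)
    (hZl : Tendsto Z (nhdsWithin 0 (Set.Ioi 0)) (nhds 0))
    (hZ' : ∀ x ∈ Set.Ioc 0 b, mm (r + 1) β x / (v * x) * S0 r v α β L ≤ Z' x) {x : ℝ} (hx : x ∈ Set.Ioc 0 b) :
    mm (r + 1) β x * f2 x ≤ Z x := by
  have hv := O.P.hv
  have hanti : AntitoneOn (fun x => mm (r + 1) β x * f2 x + -(Z x)) (Set.Ioc 0 b) := by
    intro y hy z hz hyz
    refine O.Y (A := mm (r + 1) β) (B := fun x => -(Z x)) (A' := fun x => mm (r + 1) β x * ((r + 1) / x + 2 * β)) (B' := fun x => - Z' x) hy.1 hyz ?_ ?_ ?_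
    · intro t ht; exact mm_hasDerivAt (hy.1.trans_le ht.1)
    · intro t ht; exact (hZ t ⟨hy.1.trans_le ht.1, ht.2.trans hz.2⟩).neg
    · intro t ht η hη
      have ht0 : 0 < t := hy.1.trans_le ht.1
      have h1 := hZ' t ⟨ht0, ht.2.trans hz.2⟩
      have h2 := (abs_le.1 (O.eta2 ht0 hη)).2
      have hm := mm_pos (r := r + 1) (β := β) ht0
      have key : mm (r + 1) β t * ((r + 1) / t + 2 * β) * f2 t + mm (r + 1) β t * Dd r v β f f1 f2 t η =
          mm (r + 1) β t / (v * t) * (η + f t - β * v * f1 t + (t - (r + 1) * (β * v)) * f1 t) := by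
        unfold Dd
        field_simp
        ring
      have h3 : mm (r + 1) β t / (v * t) * (η + f t - β * v * f1 t + (t - (r + 1) * (β * v)) * f1 t) ≤ mm (r + 1) β t / (v * t) * S0 r v α β L := by
        gcongr
      linarith
  have hl : Tendsto (fun x => mm (r + 1) β x * f2 x + -(Z x)) (nhdsWithin 0 (Set.Ioi 0)) (nhds 0) := by
    have := (mm_mul_tendsto (β := β) O.lim2).add hZl.neg
    simpa using this
  have := nonpos_of_anti hanti hl hx
  linarith

lemma OD.A8u (O : OD r v α β L ht f f1 f2) (hβ : 0 ≤ β) {x : ℝ} (hx : 0 < x) :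
    (v * (r + 1) + 2 * (β * v) * x) * f2 x ≤ 4 / 3 * S0 r v α β L := by
  have hv := O.P.hv; have hr := O.P.hr; have hS := O.S0_nn
  have h := O.mmY (b := x) (x := x) (Z := fun y => 4 / 3 * (S0 r v α β L / v) * (mm (r + 1) β y / ((r + 1) + 2 * β * y)))
    (Z' := fun y => 4 / 3 * (S0 r v α β L / v) * (mm (r + 1) β y * (1 / y - 2 * β / ((r + 1) + 2 * β * y) ^ 2))) ?_ ?_ ?_ ⟨hx, le_rfl⟩
  · have hm := mm_pos (r := r + 1) (β := β) hx
    have hd : 0 < r + 1 + 2 * β * x := by positivity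
    have e : 4 / 3 * (S0 r v α β L / v) * (mm (r + 1) β x / ((r + 1) + 2 * β * x)) = mm (r + 1) β x * (4 / 3 * S0 r v α β L / (v * (r + 1 + 2 * β * x))) := by
      field_simp
    rw [e] at h
    have h1 := le_of_mul_le_mul_left h hm
    rw [le_div_iff₀ (by positivity)] at h1
    linarith
  · intro y hy
    have hy0 := hy.1
    have hd : 0 < r + 1 + 2 * β * y := by positivity
    have h2 : HasDerivAt (fun y => r + 1 + 2 * β * y) (2 * β) y := by
      have := ((hasDerivAt_id y).const_mul (2 * β)).const_add (r + 1)
      simpa using this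
    refine (((mm_hasDerivAt (r := r + 1) (β := β) hy0).div h2 hd.ne').const_mul _).congr_deriv ?_
    field_simp
    
  · have h1 : Tendsto (fun y : ℝ => (r + 1) + 2 * β * y) (nhdsWithin 0 (Set.Ioi 0)) (nhds ((r + 1) + 2 * β * 0)) :=
      ((show Continuous fun y : ℝ => (r + 1) + 2 * β * y by fun_prop).tendsto 0).mono_left nhdsWithin_le_nhds
    have := ((mm_tendsto (r := r + 1) (β := β) (by linarith)).div h1 (by simp; linarith)).const_mul (4 / 3 * (S0 r v α β L / v))
    simpa using this
  · intro y hy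
    have hy0 := hy.1
    have hm := mm_pos (r := r + 1) (β := β) hy0
    have hd : 0 < r + 1 + 2 * β * y := by positivity
    have h1 : 2 * β * y / (r + 1 + 2 * β * y) ^ 2 ≤ 1 / 4 := by
      rw [div_le_iff₀ (by positivity)]
      have : 0 ≤ 2 * β * y := by positivity
      nlinarith [sq_nonneg (r + 1 - 2 * β * y)]
    have e : 4 / 3 * (S0 r v α β L / v) * (mm (r + 1) β y * (1 / y - 2 * β / ((r + 1) + 2 * β * y) ^ 2)) =
        mm (r + 1) β y / (v * y) * S0 r v α β L * (4 / 3 * (1 - 2 * β * y / (r + 1 + 2 * β * y) ^ 2)) := by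
      field_simp
    rw [e]
    refine le_mul_of_one_le_right (by positivity) ?_
    linarith

lemma OD.A9u (O : OD r v α β L ht f f1 f2) (hβ : β < 0) {x : ℝ} (hx : 0 < x) (hx1 : x ≤ (r + 1) / (4 * -β)) :
    v * (r + 1) * f2 x ≤ 2 * S0 r v α β L := by
  have hv := O.P.hv; have hr := O.P.hr; have hS := O.S0_nn
  have hnb : 0 < -β := by linarith
  have h := O.mmY (b := (r + 1) / (4 * -β)) (x := x) (Z := fun y => 2 * S0 r v α β L / (v * (r + 1)) * mm (r + 1) β y)
    (Z' := fun y => 2 * S0 r v α β L / (v * (r + 1)) * (mm (r + 1) β y * ((r + 1) / y + 2 * β))) ?_ ?_ ?_ ⟨hx, hx1⟩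
  · have hm := mm_pos (r := r + 1) (β := β) hx
    rw [mul_comm] at h
    have h1 := le_of_mul_le_mul_right h hm
    rw [le_div_iff₀ (by positivity)] at h1
    linarith
  · intro y hy
    exact (mm_hasDerivAt (r := r + 1) (β := β) hy.1).const_mul _
  · have := (mm_tendsto (r := r + 1) (β := β) (by linarith)).const_mul (2 * S0 r v α β L / (v * (r + 1)))
    simpa using this
  · intro y hy
    have hy0 := hy.1
    have hm := mm_pos (r := r + 1) (β := β) hy0
    have h1 : (-β) * y ≤ (r + 1) / 4 := by
      have := hy.2
      rw [le_div_iff₀ (by positivity)] at this; linarith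
    have e : 2 * S0 r v α β L / (v * (r + 1)) * (mm (r + 1) β y * ((r + 1) / y + 2 * β)) =
        mm (r + 1) β y / (v * y) * S0 r v α β L * (2 * ((r + 1) + 2 * β * y) / (r + 1)) := by
      field_simp
    rw [e]
    refine le_mul_of_one_le_right (by positivity) ?_
    rw [le_div_iff₀ (by positivity)]
    linarith

lemma OD.A89 (O : OD r v α β L ht f f1 f2) {x : ℝ} (hx : 0 < x) :
    |(v * (r + 1) + 2 * (β * v) * x) * f2 x| ≤ 9 * S0 r v α β L := by
  have hv := O.P.hv; have hr := O.P.hr; have hS := O.S0_nn; have hα := O.P.hα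
  rcases le_or_gt 0 β with h | h
  · have h1 := O.A8u h hx
    have h2 := O.neg.A8u h hx
    rw [abs_le]; constructor <;> linarith
  have hnb : 0 < -β := by linarith
  rcases le_or_gt x ((r + 1) / (4 * -β)) with hx1 | hx1
  · have h1 := O.A9u h hx hx1
    have h2 := O.neg.A9u h hx hx1
    have h3 : |v * (r + 1) * f2 x| ≤ 2 * S0 r v α β L := by rw [abs_le]; constructor <;> linarith
    have h4 : (-β) * x ≤ (r + 1) / 4 := by
      rw [le_div_iff₀ (by positivity)] at hx1; linarith
    rw [abs_mul] at h3 ⊢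
    have h5 : |v * (r + 1) + 2 * (β * v) * x| ≤ |v * (r + 1)| := by
      have e1 : 0 < (-β * x) * v := by positivity
      have e2 : (-β * x) * v ≤ (r + 1) / 4 * v := mul_le_mul_of_nonneg_right h4 hv.le
      have e3 : 0 < v * (r + 1) := by positivity
      rw [abs_of_pos e3, abs_le]
      constructor <;> linarith
    have := mul_le_mul_of_nonneg_right h5 (abs_nonneg (f2 x))
    linarith
  · set b := -β with hb
    have hβe : β = -b := by rw [hb]; ring
    have hX : 0 < x - (r + 1) * (β * v) := by rw [hβe]; have : 0 < (r + 1) * (b * v) := by positivity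
                                              linarith
    have h6 := O.A6 hx hX
    have h7 := O.A7 hx
    have hq := brho_pos O.P.succ hx
    have hrl := rho_le (r := r + 1) (α := α) (by linarith) hα hx
    have hab : b < α := by have := (abs_lt.1 O.P.hβ).1; linarith
    have hdiff : v * (α + b) * (α - b) = 1 := by
      have := O.P.hvab
      rw [hβe] at this
      linarith
    have hq2 : β + rho (r + 1) α x ≤ 1 / (2 * v * b) + (r + 1) / x := by
      have h1 : α - b ≤ 1 / (2 * v * b) := by
        rw [le_div_iff₀ (by positivity)]
        have : v * (2 * b) * (α - b) ≤ v * (α + b) * (α - b) := by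
          have : 0 < α - b := by linarith
          gcongr; linarith
        linarith
      linarith
    set q := β + rho (r + 1) α x
    set X := x - (r + 1) * (β * v) with hXd
    have hXe : X = x + (r + 1) * (b * v) := by rw [hXd, hβe]; ring
    have h8 : |f2 x * X| ≤ q * S0 r v α β L := by
      have e : f2 x * X = (f2 x + q * f1 x) * X - q * (X * f1 x) := by ring
      rw [e]
      refine (abs_sub _ _).trans ?_
      have : |q * (X * f1 x)| ≤ q * S1 r v α β L := by rw [abs_mul, abs_of_pos hq]; gcongr
      unfold S0; linarith
    have h9 : |v * (r + 1) + 2 * (β * v) * x| ≤ v * (r + 1) + 2 * (b * v) * x := by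
      have : 0 < v * (r + 1) := by positivity
      have : 0 < (b * v) * x := by positivity
      rw [hβe, abs_le]; constructor <;> linarith
    have h10 : (v * (r + 1) + 2 * (b * v) * x) * q ≤ 9 * X := by
      have hx4 : r + 1 ≤ 4 * (b * x) := by
        rw [div_lt_iff₀ (by positivity)] at hx1; linarith
      have h1 : (v * (r + 1) + 2 * (b * v) * x) * q ≤ (v * (r + 1) + 2 * (b * v) * x) * (1 / (2 * v * b) + (r + 1) / x) := by gcongr
      have h2 : (v * (r + 1) + 2 * (b * v) * x) * (1 / (2 * v * b) + (r + 1) / x) = (r + 1) / (2 * b) + x + v * (r + 1) * (r + 1) / x + 2 * (b * v) * (r + 1) := by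
        field_simp
        ring
      have h3 : (r + 1) / (2 * b) ≤ 2 * x := by rw [div_le_iff₀ (by positivity)]; linarith
      have h4 : v * (r + 1) * (r + 1) / x ≤ 4 * ((r + 1) * (b * v)) := by
        rw [div_le_iff₀ hx]
        have : v * (r + 1) * (r + 1) ≤ v * (r + 1) * (4 * (b * x)) := by gcongr
        linarith
      have : 0 < (r + 1) * (b * v) := by positivity
      rw [hXe]; linarith
    rw [abs_mul]
    rw [abs_mul, abs_of_pos hX] at h8
    refine le_of_mul_le_mul_right ?_ hX
    calc |v * (r + 1) + 2 * (β * v) * x| * |f2 x| * X ≤ (v * (r + 1) + 2 * (b * v) * x) * (|f2 x| * X) := by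
          rw [mul_assoc]; gcongr
      _ ≤ (v * (r + 1) + 2 * (b * v) * x) * (q * S0 r v α β L) := by gcongr
      _ = ((v * (r + 1) + 2 * (b * v) * x) * q) * S0 r v α β L := by ring
      _ ≤ 9 * X * S0 r v α β L := by gcongr
      _ = _ := by ring

lemma OD.A10 (O : OD r v α β L ht f f1 f2) {x d : ℝ} (hx : 0 < x) (hd : HasDerivAt f2 d x) :
    v * |x * d| ≤ 10 * S0 r v α β L := by
  have hv := O.P.hv
  have hh : HasDerivAt ht (v * f2 x + v * x * d - (f x + (x - r * (β * v)) * f1 x - 2 * (β * v) * f1 x - (v * r + 2 * (β * v) * x) * f2 x)) x := by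
    have h1 := ((hasDerivAt_id x).sub_const (r * (β * v))).mul (O.d1 x hx)
    have h2 := (((hasDerivAt_id x).const_mul (2 * (β * v))).const_add (v * r)).mul (O.d2 x hx)
    have h3 := ((hasDerivAt_id x).const_mul v).mul hd
    have h4 := h3.sub (h1.sub h2)
    refine (h4.congr_of_eventuallyEq ?_).congr_deriv ?_
    · filter_upwards [lt_mem_nhds hx] with y hy
      have := O.ode y hy
      simp
      linarith
    · simp; ring
  set η := v * f2 x + v * x * d - (f x + (x - r * (β * v)) * f1 x - 2 * (β * v) * f1 x - (v * r + 2 * (β * v) * x) * f2 x) with hη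
  have hηL : |η| ≤ L := by
    have hlim := (hasDerivAt_iff_tendsto_slope.1 hh).abs
    refine le_of_tendsto hlim ?_
    filter_upwards [self_mem_nhdsWithin] with z hz
    have : 0 < |z - x| := abs_pos.2 (sub_ne_zero.2 hz)
    rw [slope_def_field, abs_div, div_le_iff₀ this]
    exact O.lip z x
  have e : v * (x * d) = (η + f x - β * v * f1 x + (x - (r + 1) * (β * v)) * f1 x) - (v * (r + 1) + 2 * (β * v) * x) * f2 x := by
    rw [hη]; ring
  rw [← abs_of_pos hv, ← abs_mul, abs_of_pos hv, e]
  refine (abs_sub _ _).trans ?_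
  have := O.eta2 hx hηL
  have := O.A89 hx
  linarith

end


section
variable {r v α β L : ℝ} {ht : ℝ → ℝ}

noncomputable def sg (r v α β : ℝ) (ht : ℝ → ℝ) (x : ℝ) : ℝ :=
  -(Real.exp (-β * x) * besselK ((r - 1) / 2) (α * |x|) / (v * |x| ^ ((r - 1) / 2))) *
    (∫ t in (0:ℝ)..x, Real.exp (β * t) * |t| ^ ((r - 1) / 2) * besselI ((r - 1) / 2) (α * |t|) * ht t) -
  (Real.exp (-β * x) * besselI ((r - 1) / 2) (α * |x|) / (v * |x| ^ ((r - 1) / 2))) *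
    (∫ t in Set.Ioi x, Real.exp (β * t) * |t| ^ ((r - 1) / 2) * besselK ((r - 1) / 2) (α * |t|) * ht t)

lemma stein_sg (r θ σ : ℝ) (h : ℝ → ℝ) : steinSolution r θ σ h =
    sg r (σ ^ 2) (Real.sqrt (θ ^ 2 + σ ^ 2) / σ ^ 2) (θ / σ ^ 2) (htilde r θ σ h) := rfl

lemma HH_of (r θ σ : ℝ) (hr : 0 < r) (hσ : 0 < σ) (h : ℝ → ℝ) (hL : 0 ≤ L)
    (hlip : ∀ u v : ℝ, |h u - h v| ≤ L * |u - v|) :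
    HH r (σ ^ 2) (Real.sqrt (θ ^ 2 + σ ^ 2) / σ ^ 2) (θ / σ ^ 2) L (htilde r θ σ h) where
  P := PP_of r θ σ hr hσ
  hL := hL
  lip := fun a b => by
    have := hlip a b
    unfold htilde
    rwa [sub_sub_sub_cancel_right]
  mean := by
    have P := PP_of r θ σ hr hσ
    have h1 := vg_norm r θ σ hr hσ
    have h2 := lip_integrable P hL hlip
    have h3 := w_int P
    unfold htilde
    simp only [vg_eq r θ σ _ hσ]
    generalize ((σ * Real.sqrt Real.pi * Real.Gamma (r / 2))⁻¹ * (1 / (2 * Real.sqrt (θ ^ 2 + σ ^ 2))) ^ ((r - 1) / 2)) = c at h1 ⊢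
    generalize wfun ((r - 1) / 2) (Real.sqrt (θ ^ 2 + σ ^ 2) / σ ^ 2) (θ / σ ^ 2) = w at h1 h2 h3 ⊢
    have e1 : ∫ t, h t * (c * w t) = c * ∫ t, h t * w t := by
      rw [← integral_const_mul]; congr 1; ext t; ring
    rw [e1]
    simp only [sub_mul]
    have h4 : Integrable (fun x => (c * ∫ t, h t * w t) * w x) := h3.const_mul _
    rw [integral_sub h2 h4, integral_const_mul]
    linear_combination -(∫ t, h t * w t) * h1

lemma sg_pos (H : HH r v α β L ht) {x : ℝ} (hx : 0 < x) : sg r v α β ht x = sf r v α β ht x := by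
  have hα := H.P.hα
  have hv := H.P.hv
  unfold sg sf JI JJ
  have e1 : (∫ t in (0:ℝ)..x, Real.exp (β * t) * |t| ^ ((r - 1) / 2) * besselI ((r - 1) / 2) (α * |t|) * ht t) = ∫ t in (0:ℝ)..x, gI r α β ht t := by
    refine intervalIntegral.integral_congr_ae (Eventually.of_forall fun t hm => ?_)
    rw [Set.uIoc_of_le hx.le] at hm
    have ht0 : 0 < t := hm.1
    rw [abs_of_pos ht0, besselI_phi _ _ _ hα ht0]
    unfold gI
    rw [show r - 1 = (r - 1) / 2 + (r - 1) / 2 by ring, Real.rpow_add ht0]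
    ring_nf
  have e2 : (∫ t in Set.Ioi x, Real.exp (β * t) * |t| ^ ((r - 1) / 2) * besselK ((r - 1) / 2) (α * |t|) * ht t) = ∫ t in Set.Ioi x, ht t * wfun ((r - 1) / 2) α β t := by
    refine setIntegral_congr_fun measurableSet_Ioi fun t _ => ?_
    unfold wfun
    ring
  rw [e1, e2, abs_of_pos hx, besselI_phi _ _ _ hα hx]
  unfold psi
  rw [Real.rpow_neg hx.le]
  have : 0 < x ^ ((r - 1) / 2) := by positivity
  field_simp
  ring

lemma sg_neg (H : HH r v α β L ht) (x : ℝ) : sg r v α β ht x = - sg r v α (-β) (fun t => ht (-t)) (-x) := by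
  have hintg := H.int
  have hmean := H.mean
  unfold sg
  have e1 : (∫ t in (0:ℝ)..(-x), Real.exp (-β * t) * |t| ^ ((r - 1) / 2) * besselI ((r - 1) / 2) (α * |t|) * ht (-t)) = - ∫ t in (0:ℝ)..x, Real.exp (β * t) * |t| ^ ((r - 1) / 2) * besselI ((r - 1) / 2) (α * |t|) * ht t := by
    have := intervalIntegral.integral_comp_neg (a := 0) (b := -x) (fun t => Real.exp (β * t) * |t| ^ ((r - 1) / 2) * besselI ((r - 1) / 2) (α * |t|) * ht t)
    rw [neg_neg, neg_zero, intervalIntegral.integral_symm 0 x] at this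
    rw [← this]
    refine intervalIntegral.integral_congr fun t _ => ?_
    simp only [abs_neg, neg_mul, mul_neg]
  have e2 : (∫ t in Set.Ioi x, Real.exp (β * t) * |t| ^ ((r - 1) / 2) * besselK ((r - 1) / 2) (α * |t|) * ht t) = ∫ t in Set.Ioi x, ht t * wfun ((r - 1) / 2) α β t := by
    refine setIntegral_congr_fun measurableSet_Ioi fun t _ => ?_
    unfold wfun
    ring
  have e3 : (∫ t in Set.Ioi (-x), Real.exp (-β * t) * |t| ^ ((r - 1) / 2) * besselK ((r - 1) / 2) (α * |t|) * ht (-t)) = ∫ t in Set.Iic x, ht t * wfun ((r - 1) / 2) α β t := by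
    have := integral_comp_neg_Ioi (-x) (fun t => ht t * wfun ((r - 1) / 2) α β t)
    rw [neg_neg] at this
    rw [← this]
    refine setIntegral_congr_fun measurableSet_Ioi fun t _ => ?_
    simp only [wfun_neg]
    unfold wfun
    ring
  have e4 := intervalIntegral.integral_Iic_add_Ioi (b := x) hintg.integrableOn hintg.integrableOn
  rw [hmean] at e4
  rw [e1, e2, e3, eq_neg_of_add_eq_zero_left e4, abs_neg]
  simp only [neg_neg, neg_mul, mul_neg]
  ring

lemma bound_pos (H : HH r v α β L ht) {x : ℝ} (hx : 0 < x) {F g₁ g₂ : ℝ → ℝ} {d : ℝ}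
    (hF : ∀ y, 0 < y → F y = sf r v α β ht y)
    (h1 : ∀ᶠ y in nhds x, y ≠ 0 → HasDerivAt F (g₁ y) y)
    (h2 : ∀ᶠ y in nhds x, y ≠ 0 → HasDerivAt g₁ (g₂ y) y)
    (h3 : HasDerivAt g₂ d x) : v * |x * d| ≤ 10 * S0 r v α β L := by
  have hp : ∀ᶠ y in nhds x, 0 < y := lt_mem_nhds hx
  have k1 : ∀ᶠ y in nhds x, g₁ y = sf1 r v α β ht y := by
    filter_upwards [h1, hp] with y hy hy0
    have a := hy hy0.ne'
    have b := H.sf_deriv hy0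
    refine a.unique (b.congr_of_eventuallyEq ?_)
    filter_upwards [lt_mem_nhds hy0] with z hz using hF z hz
  have k2 : ∀ᶠ y in nhds x, g₂ y = sf2 r v α β ht y := by
    filter_upwards [h2, hp, k1.eventually_nhds] with y hy hy0 hk
    exact (hy hy0.ne').unique ((H.sf1_deriv hy0).congr_of_eventuallyEq hk)
  refine H.od.A10 hx (h3.congr_of_eventuallyEq ?_)
  filter_upwards [k2] with y hy using hy.symm

lemma S0_neg : S0 r v α (-β) L = S0 r v α β L := by
  unfold S0 S1
  rw [H0_neg, abs_neg]

lemma bound_all (H : HH r v α β L ht) {x : ℝ} (hx : x ≠ 0) {g₁ g₂ : ℝ → ℝ} {d : ℝ}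
    (h1 : ∀ᶠ y in nhds x, y ≠ 0 → HasDerivAt (sg r v α β ht) (g₁ y) y)
    (h2 : ∀ᶠ y in nhds x, y ≠ 0 → HasDerivAt g₁ (g₂ y) y)
    (h3 : HasDerivAt g₂ d x) : v * |x * d| ≤ 10 * S0 r v α β L := by
  rcases lt_or_gt_of_ne hx with hx | hx
  · have hx' : 0 < -x := by linarith
    have ht' : Tendsto (fun y : ℝ => -y) (nhds (-x)) (nhds x) := by
      have := (continuous_neg (G := ℝ)).tendsto (-x)
      rwa [neg_neg] at this
    have a1 : ∀ᶠ y in nhds (-x), y ≠ 0 → HasDerivAt (fun y => - sg r v α β ht (-y)) (g₁ (-y)) y := by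
      filter_upwards [ht'.eventually h1] with y hy hy0
      have := ((hy (neg_ne_zero.2 hy0)).scomp y (hasDerivAt_neg y)).neg
      refine HasDerivAt.congr_deriv (f := fun y => - sg r v α β ht (-y)) this ?_
      simp
    have a2 : ∀ᶠ y in nhds (-x), y ≠ 0 → HasDerivAt (fun y => g₁ (-y)) (- g₂ (-y)) y := by
      filter_upwards [ht'.eventually h2] with y hy hy0
      have := ((hy (neg_ne_zero.2 hy0)).scomp y (hasDerivAt_neg y))
      refine HasDerivAt.congr_deriv (f := fun y => g₁ (-y)) this ?_
      simp
    have a3 : HasDerivAt (fun y => - g₂ (-y)) d (-x) := by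
      have h3' : HasDerivAt g₂ d (- -x) := by rwa [neg_neg]
      have := (h3'.scomp (-x) (hasDerivAt_neg (-x))).neg
      refine HasDerivAt.congr_deriv (f := fun y => - g₂ (-y)) this ?_
      simp
    have := bound_pos H.refl hx' (F := fun y => - sg r v α β ht (-y)) (fun y hy => ?_) a1 a2 a3
    · rw [S0_neg, neg_mul, abs_neg] at this
      exact this
    · rw [sg_neg H (-y), neg_neg, neg_neg]
      exact sg_pos H.refl hy
  · exact bound_pos H hx (fun y hy => sg_pos H hy) h1 h2 h3

end


section

lemma Gamma_half_le {y : ℝ} (h1 : 1 ≤ y) (h2 : y ≤ 2) : 1 / 2 ≤ Real.Gamma y := by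
  have hc : ∀ x y a b : ℝ, 0 < x → 0 < y → 0 ≤ a → 0 ≤ b → a + b = 1 →
      Real.Gamma (a * x + b * y) ≤ a * Real.Gamma x + b * Real.Gamma y := by
    intro x y a b hx hy ha hb hab
    have := Real.convexOn_Gamma.2 (Set.mem_Ioi.2 hx) (Set.mem_Ioi.2 hy) ha hb hab
    simpa only [smul_eq_mul] using this
  have g2 : Real.Gamma 2 = 1 := Real.Gamma_two
  have g3 : Real.Gamma 3 = 2 := by
    have := Real.Gamma_add_one (s := 2) (by norm_num)
    rw [g2, show (2:ℝ) + 1 = 3 by norm_num] at this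
    linarith
  have g32 : 4 / 5 ≤ Real.Gamma (3 / 2) := by
    have := Real.Gamma_add_one (s := 1 / 2) (by norm_num)
    rw [Real.Gamma_one_half_eq] at this
    norm_num at this
    rw [this]
    have : (8 / 5 : ℝ) ≤ √π := Real.le_sqrt_of_sq_le (by nlinarith [Real.pi_gt_three])
    linarith
  rcases le_or_gt y (3 / 2) with h | h
  · have ha : 0 < 2 - y := by linarith
    have := hc y 2 ((1 / 2) / (2 - y)) ((3 / 2 - y) / (2 - y)) (by linarith) (by norm_num) (by positivity)
      (div_nonneg (by linarith) ha.le) (by field_simp; ring)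
    have e : (1 / 2) / (2 - y) * y + (3 / 2 - y) / (2 - y) * 2 = 3 / 2 := by field_simp; ring
    rw [e, g2] at this
    have h3 := mul_le_mul_of_nonneg_left this ha.le
    have e2 : (2 - y) * ((1 / 2) / (2 - y) * Real.Gamma y + (3 / 2 - y) / (2 - y) * 1) = 1 / 2 * Real.Gamma y + (3 / 2 - y) := by
      field_simp
    rw [e2] at h3
    nlinarith
  · have ha : 0 < 3 - y := by linarith
    have := hc y 3 (1 / (3 - y)) ((2 - y) / (3 - y)) (by linarith) (by norm_num) (by positivity)
      (div_nonneg (by linarith) ha.le) (by field_simp; ring)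
    have e : 1 / (3 - y) * y + (2 - y) / (3 - y) * 3 = 2 := by field_simp; ring
    rw [e, g2, g3] at this
    have h3 := mul_le_mul_of_nonneg_left this ha.le
    have e2 : (3 - y) * (1 / (3 - y) * Real.Gamma y + (2 - y) / (3 - y) * 2) = Real.Gamma y + (2 - y) * 2 := by
      field_simp
    rw [e2] at h3
    linarith

variable {r θ σ : ℝ}

lemma S_ge : 1 ≤ 1 + θ ^ 2 / σ ^ 2 := by
  have : 0 ≤ θ ^ 2 / σ ^ 2 := by positivity
  linarith

lemma A_big (hr : 2 ≤ r) : 5 / 2 * (1 + θ ^ 2 / σ ^ 2) ≤ √r * Aconst r θ σ := by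
  have hS := S_ge (θ := θ) (σ := σ)
  unfold Aconst
  rw [if_pos hr]
  set S := 1 + θ ^ 2 / σ ^ 2
  have h1 : S ≤ S ^ (r / 2) := by
    have := Real.rpow_le_rpow_of_exponent_le hS (show (1:ℝ) ≤ r / 2 by linarith)
    rwa [Real.rpow_one] at this
  have h0 : 0 < √(2 * r - 1) := Real.sqrt_pos.2 (by linarith)
  have h2 : 5 / 2 * √(2 * r - 1) ≤ √r * (2 * √π) := by
    refine abs_le_of_sq_le_sq' ?_ (by positivity) |>.2
    rw [mul_pow, mul_pow, mul_pow, Real.sq_sqrt (by linarith), Real.sq_sqrt (by linarith), Real.sq_sqrt Real.pi_pos.le]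
    nlinarith [Real.pi_gt_d2]
  have h3 : 5 / 2 ≤ √r * (2 * √π / √(2 * r - 1)) := by
    rw [← mul_div_assoc, le_div_iff₀ h0]; exact h2
  calc 5 / 2 * S ≤ (√r * (2 * √π / √(2 * r - 1))) * S ^ (r / 2) := mul_le_mul h3 h1 (by linarith) (by positivity)
    _ = _ := by ring

lemma A_small (hr0 : 0 < r) (hr : r < 2) : 12 * (1 + θ ^ 2 / σ ^ 2) ≤ r * Aconst r θ σ := by
  have hS := S_ge (θ := θ) (σ := σ)
  unfold Aconst
  rw [if_neg (not_le.2 hr)]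
  set S := 1 + θ ^ 2 / σ ^ 2
  have h1 := Real.Gamma_add_one (s := r / 2) (by positivity)
  have h2 := Gamma_half_le (y := r / 2 + 1) (by linarith) (by linarith)
  rw [h1] at h2
  have : (1 / 2) * S ≤ (r / 2 * Real.Gamma (r / 2)) * S := mul_le_mul_of_nonneg_right h2 (by linarith)
  linarith

lemma A_nonneg (hr0 : 0 < r) : 0 ≤ Aconst r θ σ := by
  unfold Aconst
  have := Real.Gamma_pos_of_pos (half_pos hr0)
  split_ifs <;> positivity

lemma B_big (hr : 1 ≤ r) : 5 / 4 * √r ≤ Bconst (r + 1) θ σ := by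
  have hS := S_ge (θ := θ) (σ := σ)
  unfold Bconst
  rw [if_pos (by linarith)]
  set S := 1 + θ ^ 2 / σ ^ 2
  have h1 : 1 ≤ S ^ ((r + 1) / 2 - 1) := Real.one_le_rpow hS (by linarith)
  have h2 : 5 / 4 * √r ≤ √(π * (r + 1 - 1) / 2) := by
    refine Real.le_sqrt_of_sq_le ?_
    rw [mul_pow, Real.sq_sqrt (by linarith)]
    nlinarith [Real.pi_gt_d2]
  calc 5 / 4 * √r ≤ √(π * (r + 1 - 1) / 2) * 1 := by rw [mul_one]; exact h2
    _ ≤ _ := mul_le_mul_of_nonneg_left h1 (by positivity)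

lemma C_ge (hr : 0 < r) (hσ : 0 < σ) : 6 + 14 / 5 * (1 / √r) + 2 * (7 / 5 * √r + r) * Aconst r θ σ ≤ Cconst r θ σ := by
  have hA := A_nonneg (r := r) (θ := θ) (σ := σ) hr
  have h2 : (7 / 5 : ℝ) ≤ √2 := Real.le_sqrt_of_sq_le (by norm_num)
  have hq : 0 < √r := Real.sqrt_pos.2 hr
  unfold Cconst
  have h3 : 0 ≤ 2 * √(2 * π * (r + 1)) * (|θ| / σ) * (1 + θ ^ 2 / σ ^ 2) ^ ((r - 1) / 2) := by positivity
  have h4 : 14 / 5 * (1 / √r) ≤ 2 * √2 / √r := by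
    rw [mul_one_div]; gcongr; linarith
  have h5 : 2 * (7 / 5 * √r + r) * Aconst r θ σ ≤ 2 * (√(2 * r) + r) * Aconst r θ σ := by
    rw [Real.sqrt_mul (by norm_num)]
    gcongr
  linarith

lemma num_ineq (hr : 0 < r) (hσ : 0 < σ) {u : ℝ} (hu : u ≤ (1 + θ ^ 2 / σ ^ 2) - 1 / 2) :
    10 * (6 + (12 + 3 * (1 / √r)) * (2 * (1 + θ ^ 2 / σ ^ 2) + (6 + r) * u)) ≤
      (5 + 2 * (r + 1) * Aconst (r + 1) θ σ +
            (5 + 4 * θ ^ 2 / σ ^ 2) * (1 + 6 / (r + 1) + Bconst (r + 1) θ σ)) *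
          (1 + (2 + θ ^ 2 / σ ^ 2) * Cconst r θ σ) := by
  have hS := S_ge (θ := θ) (σ := σ)
  have hC := C_ge (r := r) (θ := θ) (σ := σ) hr hσ
  have hA0 := A_nonneg (r := r) (θ := θ) (σ := σ) hr
  have hA1 := A_nonneg (r := r + 1) (θ := θ) (σ := σ) (by linarith)
  rw [show 5 + 4 * θ ^ 2 / σ ^ 2 = 4 * (1 + θ ^ 2 / σ ^ 2) + 1 by ring,
    show 2 + θ ^ 2 / σ ^ 2 = 1 + (1 + θ ^ 2 / σ ^ 2) by ring]
  have hAb := A_big (r := r) (θ := θ) (σ := σ)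
  have hAs := A_small (r := r) (θ := θ) (σ := σ) hr
  have hAb1 := A_big (r := r + 1) (θ := θ) (σ := σ)
  have hB1 := B_big (r := r) (θ := θ) (σ := σ)
  have hB2 : r < 1 → Bconst (r + 1) θ σ = 2 := fun h => by
    unfold Bconst; rw [if_neg (by linarith)]
  generalize 1 + θ ^ 2 / σ ^ 2 = S at *
  generalize Aconst (r + 1) θ σ = A1 at *
  generalize Aconst r θ σ = A at *
  generalize Bconst (r + 1) θ σ = B at *
  generalize Cconst r θ σ = C at *
  have hq0 : 0 < √r := Real.sqrt_pos.2 hr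
  have hqq : √r * √r = r := Real.mul_self_sqrt hr.le
  have hz : 0 < 1 / √r := by positivity
  have hzq : 1 / √r * √r = 1 := by field_simp
  have hQ : 10 * (6 + (12 + 3 * (1 / √r)) * (2 * S + (6 + r) * u)) ≤
      60 + (120 + 30 * (1 / √r)) * (2 * S + (6 + r) * (S - 1 / 2)) := by
    have : (6 + r) * u ≤ (6 + r) * (S - 1 / 2) := mul_le_mul_of_nonneg_left hu (by linarith)
    have := mul_le_mul_of_nonneg_left this (by positivity : 0 ≤ 12 + 3 * (1 / √r))
    linarith
  refine hQ.trans ?_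
  clear hQ hu
  obtain ⟨t, rfl⟩ : ∃ t, S = 1 + t := ⟨S - 1, by ring⟩
  have ht : 0 ≤ t := by linarith
  -- product helper
  have prod : ∀ F1 F2 : ℝ, 0 ≤ F1 → 0 ≤ F2 →
      F1 ≤ 5 + 2 * (r + 1) * A1 + (4 * (1 + t) + 1) * (1 + 6 / (r + 1) + B) →
      F2 ≤ C → F1 * (1 + (1 + (1 + t)) * F2) ≤
      (5 + 2 * (r + 1) * A1 + (4 * (1 + t) + 1) * (1 + 6 / (r + 1) + B)) * (1 + (1 + (1 + t)) * C) := by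
    intro F1 F2 h1 h2 h3 h4
    have : 1 + (1 + (1 + t)) * F2 ≤ 1 + (1 + (1 + t)) * C := by
      have := mul_le_mul_of_nonneg_left h4 (by linarith : 0 ≤ 1 + (1 + t))
      linarith
    exact mul_le_mul h3 this (by positivity) (h1.trans h3)
  generalize hqd : √r = q at *
  generalize hzd : 1 / q = z at *
  have h6 : 0 < 6 / (r + 1) := by positivity
  rcases le_or_gt 2 r with h | h
  · -- r at least two
    have hq1 : 7 / 5 ≤ q := by
      rw [← hqd]; exact Real.le_sqrt_of_sq_le (by linarith)
    have a := hAb h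
    have b := hB1 (by linarith)
    have a1 := hAb1 (by linarith)
    have c1 : q ≤ √(r + 1) := by rw [← hqd]; exact Real.sqrt_le_sqrt (by linarith)
    have c2 : √(r + 1) * √(r + 1) = r + 1 := Real.mul_self_sqrt (by linarith)
    have a2 : q * (5 / 2 * (1 + t)) ≤ (r + 1) * A1 := by
      rw [← c2, mul_assoc]
      exact mul_le_mul c1 a1 (by positivity) (by positivity)
    have a3 : q * (5 / 2 * (1 + t)) ≤ r * A := by
      rw [← hqq, mul_assoc]
      exact mul_le_mul_of_nonneg_left a hq0.le
    have hz1 : 30 * z ≤ 43 / 2 := by nlinarith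
    refine le_trans ?_ (prod (5 + 5 * q * (1 + t) + (4 * (1 + t) + 1) * (1 + 5 / 4 * q)) (6 + 7 * (1 + t) + 5 * (1 + t) * q) (by positivity) (by positivity) ?_ ?_)
    · obtain ⟨p, rfl⟩ : ∃ p, q = 7 / 5 + p := ⟨q - 7 / 5, by ring⟩
      have hp : 0 ≤ p := by linarith
      have e1 : (120 + 30 * z) * (2 * (1 + t) + (6 + r) * (1 + t - 1 / 2)) ≤
          (283 / 2) * (2 * (1 + t) + (6 + r) * (1 + t - 1 / 2)) := by
        refine mul_le_mul_of_nonneg_right (by linarith) ?_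
        have : 0 ≤ 1 + t - 1 / 2 := by linarith
        positivity
      rw [← hqq] at e1 ⊢
      refine (add_le_add_right e1 60).trans ?_
      rw [← sub_nonneg]
      ring_nf
      positivity
    · have e1 : (4 * (1 + t) + 1) * (1 + 5 / 4 * q) ≤ (4 * (1 + t) + 1) * (1 + 6 / (r + 1) + B) :=
        mul_le_mul_of_nonneg_left (by linarith) (by positivity)
      linarith
    · linarith
  have a := hAs h
  have hq2 : q ≤ 3 / 2 := by nlinarith
  have hqA : 12 * (1 + t) * z ≤ q * A := by
    have := mul_le_mul_of_nonneg_right a hz.le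
    have e : r * A * z = (z * q) * (q * A) := by rw [← hqq]; ring
    rw [e, hzq, one_mul] at this
    exact this
  rcases le_or_gt 1 r with h1 | h1
  · have b := hB1 h1
    have a1 := hAb1 (by linarith)
    have hq1 : 1 ≤ q := by
      rw [← hqd]; exact Real.le_sqrt_of_sq_le (by linarith)
    have c1 : 7 / 5 ≤ √(r + 1) := Real.le_sqrt_of_sq_le (by linarith)
    have c2 : √(r + 1) * √(r + 1) = r + 1 := Real.mul_self_sqrt (by linarith)
    have a2 : 7 / 5 * (5 / 2 * (1 + t)) ≤ (r + 1) * A1 := by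
      rw [← c2, mul_assoc]
      exact mul_le_mul c1 a1 (by positivity) (by positivity)
    have h6b : 2 ≤ 6 / (r + 1) := by rw [le_div_iff₀ (by linarith)]; linarith
    have hz1 : z ≤ 1 := by nlinarith
    have hqAp : 0 ≤ q * A := by positivity
    refine le_trans ?_ (prod (5 + 7 * (1 + t) + 17 / 4 * (4 * (1 + t) + 1)) (6 + 24 * (1 + t)) (by positivity) (by positivity) ?_ ?_)
    · have e1 : (120 + 30 * z) * (2 * (1 + t) + (6 + r) * (1 + t - 1 / 2)) ≤
          150 * (2 * (1 + t) + 8 * (1 + t - 1 / 2)) := by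
        have h0 : 0 ≤ 1 + t - 1 / 2 := by linarith
        refine mul_le_mul (by linarith) ?_ (by positivity) (by norm_num)
        have := mul_le_mul_of_nonneg_right (show 6 + r ≤ 8 by linarith) h0
        linarith
      refine (add_le_add_right e1 60).trans ?_
      rw [← sub_nonneg]
      ring_nf
      positivity
    · have e1 : (4 * (1 + t) + 1) * (17 / 4) ≤ (4 * (1 + t) + 1) * (1 + 6 / (r + 1) + B) :=
        mul_le_mul_of_nonneg_left (by linarith) (by positivity)
      linarith
    · linarith
  · have b := hB2 h1
    have hq1 : q ≤ 1 := by nlinarith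
    have hz1 : 1 ≤ z := by nlinarith
    have h6b : 3 ≤ 6 / (r + 1) := by rw [le_div_iff₀ (by linarith)]; linarith
    have hA2 : 0 ≤ (r + 1) * A1 := by positivity
    refine le_trans ?_ (prod (11 + 24 * (1 + t)) (6 + 24 * (1 + t) + 14 / 5 * z + 33 * z * (1 + t)) (by positivity) (by positivity) ?_ ?_)
    · have e1 : (120 + 30 * z) * (2 * (1 + t) + (6 + r) * (1 + t - 1 / 2)) ≤
          (120 + 30 * z) * (2 * (1 + t) + 7 * (1 + t - 1 / 2)) := by
        have h0 : 0 ≤ 1 + t - 1 / 2 := by linarith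
        refine mul_le_mul_of_nonneg_left ?_ (by positivity)
        have := mul_le_mul_of_nonneg_right (show 6 + r ≤ 7 by linarith) h0
        linarith
      refine (add_le_add_right e1 60).trans ?_
      clear prod
      obtain ⟨p, rfl⟩ : ∃ p, z = 1 + p := ⟨z - 1, by ring⟩
      have hp : 0 ≤ p := by linarith
      rw [← sub_nonneg]
      ring_nf
      positivity
    · have e1 : (4 * (1 + t) + 1) * 6 ≤ (4 * (1 + t) + 1) * (1 + 6 / (r + 1) + B) :=
        mul_le_mul_of_nonneg_left (by linarith) (by positivity)
      linarith
    · have : 0 ≤ (1 + t) * z := by positivity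
      linarith

lemma S0_eq {v α β L : ℝ} (P : PP r v α β) : S0 r v α β L =
    L * (6 + (12 + 3 * (1 / √r)) * (2 * (v * α ^ 2) + (6 + r) * (|β| * v * α))) := by
  have hα := P.hα; have hv := P.hv
  have hd : 0 < α - |β| := by have := P.hβ; linarith
  have h1 : v * (α + |β|) * (α - |β|) = 1 := by
    rw [← P.hvab, ← sq_abs β]; ring
  have h2 : 2 / (α - |β|) = 2 * (v * (α + |β|)) := by
    rw [div_eq_iff hd.ne']; linarith
  unfold S0 S1 H0 G0
  rw [h2]
  ring

end

theorem stein_factor_xf'''_lipschitz (r θ σ : ℝ) (hr : 0 < r) (hσ : 0 < σ)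
    (h : ℝ → ℝ) (L : ℝ) (hL : 0 ≤ L) (hlip : ∀ u v : ℝ, |h u - h v| ≤ L * |u - v|) :
    ∀ x : ℝ, x ≠ 0 → ∀ g₁ : ℝ → ℝ,
      (∀ᶠ y in nhds x, y ≠ 0 → HasDerivAt (steinSolution r θ σ h) (g₁ y) y) →
      ∀ g₂ : ℝ → ℝ,
      (∀ᶠ y in nhds x, y ≠ 0 → HasDerivAt g₁ (g₂ y) y) →
      ∀ d : ℝ, HasDerivAt g₂ d x →
      |x * d| ≤ (1 / σ ^ 2) * (5 + 2 * (r + 1) * Aconst (r + 1) θ σ +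
            (5 + 4 * θ ^ 2 / σ ^ 2) * (1 + 6 / (r + 1) + Bconst (r + 1) θ σ)) *
          (1 + (2 + θ ^ 2 / σ ^ 2) * Cconst r θ σ) * L := by
  intro x hx g₁ h1 g₂ h2 d h3
  have H := HH_of r θ σ hr hσ h hL hlip
  have hP := H.P
  rw [stein_sg] at h1
  have hb := bound_all H hx h1 h2 h3
  rw [S0_eq hP] at hb
  have hv : 0 < σ ^ 2 := by positivity
  have hD : 0 < θ ^ 2 + σ ^ 2 := by positivity
  have e1 : σ ^ 2 * (√(θ ^ 2 + σ ^ 2) / σ ^ 2) ^ 2 = 1 + θ ^ 2 / σ ^ 2 := by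
    rw [div_pow, Real.sq_sqrt hD.le]; field_simp; ring
  have e2 : |θ / σ ^ 2| * σ ^ 2 * (√(θ ^ 2 + σ ^ 2) / σ ^ 2) ≤ (1 + θ ^ 2 / σ ^ 2) - 1 / 2 := by
    have k1 : |θ| * √(θ ^ 2 + σ ^ 2) ≤ θ ^ 2 + σ ^ 2 / 2 := by
      have := sq_nonneg (|θ| - √(θ ^ 2 + σ ^ 2))
      have k2 := Real.sq_sqrt hD.le
      have k3 := sq_abs θ
      nlinarith
    rw [abs_div, abs_of_pos hv]
    have k4 : |θ| / σ ^ 2 * σ ^ 2 * (√(θ ^ 2 + σ ^ 2) / σ ^ 2) = |θ| * √(θ ^ 2 + σ ^ 2) / σ ^ 2 := by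
      field_simp
    have k5 : (1 + θ ^ 2 / σ ^ 2) - 1 / 2 = (θ ^ 2 + σ ^ 2 / 2) / σ ^ 2 := by
      field_simp; ring
    rw [k4, k5]
    gcongr
  rw [e1] at hb
  have hn := num_ineq hr hσ e2
  have hn2 := mul_le_mul_of_nonneg_left hn hL
  have hf := hb.trans (le_trans (le_of_eq (by ring)) hn2)
  rw [show ∀ a b : ℝ, 1 / σ ^ 2 * a * b * L = (L * (a * b)) / σ ^ 2 from fun a b => by ring, le_div_iff₀ hv]
  linarith
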